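/- Let d ≥ 3 be a fixed integer and set 𝔡 = min{1/8, (d−2)/(5d−6)}. There exists N such that for all n ≥ N with nd even, the number of fixed-point-free involutions σ of [n]×[d] whose adjacency matrix A(σ) has determinant 0 (as an integer matrix, i.e., is singular over ℝ) is at most n^{−𝔡}·(nd)!/(2^{nd/2}(nd/2)!). -/

import Mathlib

open Finset

/-- Adjacency matrix of the configuration model. -/
def adjMat (n d : ℕ) (σ : Equiv.Perm (Fin n × Fin d)) : Matrix (Fin n) (Fin n) ℤ :=
  fun k l => ((Finset.univ.filter (fun i : Fin d => (σ (k, i)).1 = l)).card : ℤ)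

set_option linter.unusedSectionVars false

def IsM {H : Type*} (σ : Equiv.Perm H) : Prop := (∀ x, σ (σ x) = x) ∧ (∀ x, σ x ≠ x)

instance {H : Type*} [Fintype H] [DecidableEq H] : DecidablePred (IsM (H := H)) :=
  fun σ => by unfold IsM; infer_instance

/-- conjugation -/
theorem IsM.conj {H : Type*} {σ : Equiv.Perm H} (h : IsM σ) (g : Equiv.Perm H) :
    IsM (g⁻¹ * σ * g) := by
  refine ⟨fun x => ?_, fun x hx => ?_⟩
  · simp [h.1]
  · apply h.2 (g x)
    have := congrArg g hx
    simpa using this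

/-- representatives of the 2-cycles -/
theorem exists_half {H : Type*} [Fintype H] [DecidableEq H] (σ : Equiv.Perm H) (hσ : IsM σ) :
    ∃ (E : Finset H) (e : E ⊕ E ≃ H), (∀ x, e (Sum.inl x) = x) ∧ (∀ x, e (Sum.inr x) = σ x) := by
  let o := Fintype.equivFin H
  let E : Finset H := univ.filter (fun h => o h < o (σ h))
  let f : E ⊕ E → H := Sum.elim (fun x => (x : H)) (fun x => σ x)
  have hb : Function.Bijective f := by
    constructor
    · rintro (⟨x, hx⟩ | ⟨x, hx⟩) (⟨y, hy⟩ | ⟨y, hy⟩) hxy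
      · simp [f] at hxy; simp [hxy]
      · simp only [f, Sum.elim_inl, Sum.elim_inr] at hxy
        simp only [E, mem_filter, mem_univ, true_and] at hx hy
        rw [hxy, hσ.1] at hx
        exact absurd hx (not_lt.mpr hy.le)
      · simp only [f, Sum.elim_inl, Sum.elim_inr] at hxy
        simp only [E, mem_filter, mem_univ, true_and] at hx hy
        rw [← hxy, hσ.1] at hy
        exact absurd hy (not_lt.mpr hx.le)
      · simp [f] at hxy; simp [hxy]
    · intro y
      by_cases hy : o y < o (σ y)
      · exact ⟨Sum.inl ⟨y, by simp [E, hy]⟩, rfl⟩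
      · refine ⟨Sum.inr ⟨σ y, ?_⟩, by simp [f, hσ.1]⟩
        simp only [E, mem_filter, mem_univ, true_and, hσ.1]
        rcases lt_or_eq_of_le (not_lt.mp hy) with h | h
        · exact h
        · exact absurd (o.injective h) (hσ.2 y)
  exact ⟨E, Equiv.ofBijective f hb, fun x => rfl, fun x => rfl⟩

theorem edge_lemma {H α R : Type*} [Fintype H] [DecidableEq H] [Fintype α] [CommSemiring R]
    (σ : Equiv.Perm H) (hσ : IsM σ) (φ : α → α → R) :
    ∑ u : H → α, ∏ h, φ (u h) (u (σ h)) =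
      (∑ a, ∑ b, φ a b * φ b a) ^ (Fintype.card H / 2) := by
  obtain ⟨E, e, h1, h2⟩ := exists_half σ hσ
  have hc : Fintype.card H / 2 = Fintype.card E := by
    rw [← Fintype.card_congr e, Fintype.card_sum]; omega
  let ψ : (E → α × α) ≃ (H → α) :=
    ((Equiv.arrowProdEquivProdArrow E (fun _ => α) (fun _ => α)).trans
      (Equiv.sumArrowEquivProdArrow E E α).symm).trans (Equiv.arrowCongr e (Equiv.refl α))
  have p1 : ∀ F x, ψ F (x : E) = (F x).1 := by
    intro F x
    rw [← h1]; simp [ψ, Equiv.arrowProdEquivProdArrow, Equiv.sumArrowEquivProdArrow]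
  have p2 : ∀ F (x : E), ψ F (σ x) = (F x).2 := by
    intro F x
    rw [← h2]; simp [ψ, Equiv.arrowProdEquivProdArrow, Equiv.sumArrowEquivProdArrow]
  rw [← ψ.sum_comp, hc, ← Fintype.sum_prod_type', ← Finset.card_univ, ← Finset.prod_const,
    Fintype.prod_sum]
  refine Finset.sum_congr rfl fun F _ => ?_
  rw [← e.prod_comp, Fintype.prod_sum_type, ← Finset.prod_mul_distrib]
  refine Finset.prod_congr rfl fun x _ => ?_
  rw [h1, h2, hσ.1, p1, p2]

/-- histogram -/
def hist {H β : Type*} [Fintype H] [DecidableEq β] (c : H → β) (b : β) : ℕ :=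
  (univ.filter (fun h => c h = b)).card

theorem hist_comp {H β : Type*} [Fintype H] [DecidableEq β] (c : H → β) (g : Equiv.Perm H) :
    hist (c ∘ g) = hist c := by
  ext b
  unfold hist
  refine Finset.card_bij (fun h _ => g h) ?_ ?_ ?_
  · intro a ha; simpa using ha
  · intro a _ b _ h; exact g.injective h
  · intro b hb; exact ⟨g.symm b, by simpa using hb, by simp⟩

theorem sum_hist {H β : Type*} [Fintype H] [Fintype β] [DecidableEq β] (c : H → β) :
    ∑ b, hist c b = Fintype.card H := by
  unfold hist
  rw [← Finset.card_univ (α := H)]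
  exact (Finset.card_eq_sum_card_fiberwise (fun _ _ => mem_univ _)).symm

theorem hist_le {H β : Type*} [Fintype H] [DecidableEq β] (c : H → β) (b : β) :
    hist c b ≤ Fintype.card H := Finset.card_le_univ _

theorem exists_perm_of_hist {H β : Type*} [Fintype H] [DecidableEq β] (c u : H → β)
    (h : hist c = hist u) : ∃ g : Equiv.Perm H, c ∘ g = u := by
  classical
  have : ∀ b, Nonempty ({a // u a = b} ≃ {a // c a = b}) := by
    intro b
    refine Fintype.card_eq.mp ?_
    rw [Fintype.card_subtype, Fintype.card_subtype]
    exact (congrFun h b).symm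
  have e := fun b => (this b).some
  refine ⟨Equiv.ofFiberEquiv e, ?_⟩
  ext a
  exact Equiv.ofFiberEquiv_map e a

theorem card_fiber_perm {H β : Type*} [Fintype H] [DecidableEq H] [Fintype β] [DecidableEq β]
    (c u : H → β) :
    (univ.filter (fun g : Equiv.Perm H => c ∘ g = u)).card =
      if hist u = hist c then ∏ b, (hist c b).factorial else 0 := by
  split_ifs with h
  · obtain ⟨g0, hg0⟩ := exists_perm_of_hist c u h.symm
    have h1 := DomMulAct.stabilizer_card c
    rw [Fintype.card_subtype] at h1
    have h2 : ∀ b, Fintype.card {a // c a = b} = hist c b := fun b => Fintype.card_subtype _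
    simp only [h2] at h1
    rw [← h1]
    refine Finset.card_bij (fun g _ => g * g0⁻¹) ?_ ?_ ?_
    · intro g hg
      simp only [mem_filter, mem_univ, true_and] at hg ⊢
      rw [Equiv.Perm.coe_mul, ← Function.comp_assoc, hg, ← hg0]
      ext x; simp
    · intro a _ b _ h; simpa using h
    · intro b hb
      refine ⟨b * g0, ?_, by simp⟩
      simp only [mem_filter, mem_univ, true_and] at hb ⊢
      rw [Equiv.Perm.coe_mul, ← Function.comp_assoc, hb, hg0]
  · rw [Finset.card_eq_zero, Finset.filter_eq_empty_iff]
    rintro g - rfl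
    exact h (hist_comp c g)

theorem sum_perm_comp {H β R : Type*} [Fintype H] [DecidableEq H] [Fintype β] [DecidableEq β]
    [CommSemiring R] (c : H → β) (G : (H → β) → R) :
    ∑ g : Equiv.Perm H, G (c ∘ g) =
      (∏ b, (hist c b).factorial : ℕ) * ∑ u ∈ univ.filter (fun u => hist u = hist c), G u := by
  have := Finset.sum_comp (s := univ) G (fun g : Equiv.Perm H => c ∘ g)
  rw [this, Finset.mul_sum, Finset.sum_filter]
  rw [Finset.sum_subset (Finset.subset_univ _)]
  · refine Finset.sum_congr rfl fun u _ => ?_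
    rw [card_fiber_perm]
    split_ifs <;> simp
  · intro u _ hu
    rw [Finset.card_eq_zero.mpr]; · simp
    rw [Finset.filter_eq_empty_iff]
    rintro g - rfl
    exact hu (by simp)

theorem sum_perm_comp_le {H β : Type*} [Fintype H] [DecidableEq H] [Fintype β] [DecidableEq β]
    (c : H → β) (G : (H → β) → ℝ) (hG : ∀ u, 0 ≤ G u) :
    ∑ g : Equiv.Perm H, G (c ∘ g) ≤ (∏ b, (hist c b).factorial : ℕ) * ∑ u, G u := by
  rw [sum_perm_comp]
  gcongr
  · intro _ _ _; exact hG _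
  · exact Finset.filter_subset _ _

theorem prod_hist {H β R : Type*} [Fintype H] [Fintype β] [DecidableEq β] [CommMonoid R]
    (c : H → β) (z : β → R) : ∏ h, z (c h) = ∏ b, z b ^ hist c b := by
  have := Finset.prod_comp (s := univ) z c
  rw [this]
  unfold hist
  rw [Finset.prod_subset (Finset.subset_univ _)]
  intro b _ hb
  rw [Finset.card_eq_zero.mpr, pow_zero]
  rw [Finset.filter_eq_empty_iff]
  rintro x - rfl
  exact hb (by simp)

theorem sum_hist_mul {H β R : Type*} [Fintype H] [Fintype β] [DecidableEq β] [CommSemiring R]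
    (c : H → β) (z : β → R) : ∑ h, z (c h) = ∑ b, (hist c b : R) * z b := by
  have := Finset.sum_comp (s := univ) z c
  rw [this]
  unfold hist
  rw [Finset.sum_subset (Finset.subset_univ _)]
  · simp
  intro b _ hb
  rw [Finset.card_eq_zero.mpr, zero_smul]
  rw [Finset.filter_eq_empty_iff]
  rintro x - rfl
  exact hb (by simp)

/-- discrete torus extraction -/
theorem extraction {H β : Type*} [Fintype H] [DecidableEq H] [Fintype β] [DecidableEq β]
    (N : β → ℕ) (hN : ∀ b, N b ≤ Fintype.card H) (G : (H → β) → ℂ) (B : ℝ)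
    (hB : ∀ z : β → ℂ, (∀ b, ‖z b‖ = 1) → ‖∑ u, G u * ∏ h, z (u h)‖ ≤ B) :
    ‖∑ u ∈ univ.filter (fun u => hist u = N), G u‖ ≤ B := by
  set L := Fintype.card H + 1 with hL
  have : NeZero L := ⟨by omega⟩
  let e := ZMod.stdAddChar (N := L)
  have hprim : e.IsPrimitive := ZMod.isPrimitive_stdAddChar L
  have key : ∀ u : H → β, (∑ ζ : β → ZMod L, ∏ b, (e (-(ζ b) * N b) * e (ζ b * hist u b)))
      = if hist u = N then (L : ℂ) ^ (Fintype.card β) else 0 := by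
    intro u
    rw [← Fintype.prod_sum (fun b (t : ZMod L) => e (-t * N b) * e (t * hist u b))]
    have h1 : ∀ b, ∑ t : ZMod L, e (-t * N b) * e (t * hist u b)
        = if hist u b = N b then (L : ℂ) else 0 := by
      intro b
      have h2 := AddChar.sum_mulShift (ψ := e) ((hist u b : ZMod L) - N b) hprim
      have h3 : (((hist u b : ZMod L) - N b) = 0) ↔ hist u b = N b := by
        rw [sub_eq_zero, ZMod.natCast_eq_natCast_iff, Nat.ModEq, Nat.mod_eq_of_lt, Nat.mod_eq_of_lt]
        · have := hN b; omega
        · have := hist_le u b; omega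
      simp only [h3, ZMod.card, Nat.cast_ite, Nat.cast_zero] at h2
      rw [← h2]
      refine Finset.sum_congr rfl fun t _ => ?_
      rw [← AddChar.map_add_eq_mul]
      congr 1; ring
    simp only [h1]
    split_ifs with h
    · subst h; simp
    · obtain ⟨b, hb⟩ := Function.ne_iff.mp h
      exact Finset.prod_eq_zero (mem_univ b) (by simp [hb])
  have hLpos : (0 : ℝ) < (L : ℝ) ^ (Fintype.card β) := by positivity
  have main : (L : ℂ) ^ (Fintype.card β) * ∑ u ∈ univ.filter (fun u => hist u = N), G u
      = ∑ ζ : β → ZMod L, (∏ b, e (-(ζ b) * N b)) * ∑ u, G u * ∏ h, e (ζ (u h)) := by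
    rw [Finset.sum_filter, Finset.mul_sum]
    simp only [Finset.mul_sum]
    rw [Finset.sum_comm]
    refine Finset.sum_congr rfl fun u _ => ?_
    have := key u
    calc _ = G u * (∑ ζ : β → ZMod L, ∏ b, (e (-(ζ b) * N b) * e (ζ b * hist u b))) := by
          rw [this]; split_ifs <;> ring
      _ = _ := by
          rw [Finset.mul_sum]
          refine Finset.sum_congr rfl fun ζ _ => ?_
          rw [Finset.prod_mul_distrib, prod_hist u (fun b => e (ζ b))]
          have : ∀ b, e (ζ b * hist u b) = e (ζ b) ^ hist u b := by
            intro b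
            rw [← AddChar.map_nsmul_eq_pow, nsmul_eq_mul, mul_comm]
          simp only [this]; ring
  have hn : ‖(L : ℂ) ^ (Fintype.card β) * ∑ u ∈ univ.filter (fun u => hist u = N), G u‖
      ≤ (L : ℝ) ^ (Fintype.card β) * B := by
    rw [main]
    refine (norm_sum_le _ _).trans ?_
    have : ∀ ζ : β → ZMod L, ‖(∏ b, e (-(ζ b) * N b)) * ∑ u, G u * ∏ h, e (ζ (u h))‖ ≤ B := by
      intro ζ
      rw [norm_mul, norm_prod]
      simp only [AddChar.norm_apply, Finset.prod_const_one, one_mul]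
      exact hB (fun b => e (ζ b)) (fun b => AddChar.norm_apply _ _)
    refine (Finset.sum_le_sum fun ζ _ => this ζ).trans ?_
    simp
  rw [norm_mul, norm_pow, Complex.norm_natCast] at hn
  exact le_of_mul_le_mul_left hn hLpos

theorem factorial_lower (m : ℕ) : (m : ℝ) ^ m ≤ m.factorial * Real.exp m := by
  have := Real.pow_div_factorial_le_exp (m : ℝ) (by positivity) m
  rw [div_le_iff₀ (by positivity)] at this
  linarith

theorem factorial_upper (m : ℕ) :
    (m.factorial : ℝ) * Real.exp m ≤ Real.exp 1 * (m + 1) * (m : ℝ) ^ m := by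
  have h1 : ∀ k : ℕ, ((k+1).factorial : ℝ) * Real.exp (k+1) ≤ Real.exp 1 * (k + 1) * ((k:ℝ)+1) ^ (k+1) := by
    intro k
    induction k with
    | zero => simp
    | succ k ih =>
      have h2 : ((k:ℝ)+1)^(k+2) * Real.exp 1 ≤ ((k:ℝ)+2)^(k+2) := by
        have h3 : ((k:ℝ)+1)/(k+2) ≤ Real.exp (-(1/(k+2))) := by
          have := Real.add_one_le_exp (-(1/((k:ℝ)+2)))
          refine le_trans (le_of_eq ?_) this
          field_simp; ring
        have h4 := pow_le_pow_left₀ (by positivity) h3 (k+2)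
        rw [← Real.exp_nat_mul, div_pow, div_le_iff₀ (by positivity)] at h4
        have h5 : ((k+2:ℕ):ℝ) * -(1/((k:ℝ)+2)) = -1 := by push_cast; field_simp
        rw [h5, Real.exp_neg] at h4
        calc _ ≤ ((Real.exp 1)⁻¹ * (↑k + 2) ^ (k + 2)) * Real.exp 1 := by gcongr
          _ = _ := by field_simp
      rw [Nat.factorial_succ]
      push_cast
      have e1 : Real.exp ((k:ℝ)+1+1) = Real.exp (k+1) * Real.exp 1 := by rw [Real.exp_add]
      rw [e1]
      calc ((k:ℝ)+1+1) * ((k+1).factorial) * (Real.exp (k+1) * Real.exp 1)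
          = ((k:ℝ)+1+1) * (((k+1).factorial) * Real.exp (k+1)) * Real.exp 1 := by ring
        _ ≤ ((k:ℝ)+1+1) * (Real.exp 1 * (k + 1) * ((k:ℝ)+1) ^ (k+1)) * Real.exp 1 := by gcongr
        _ = ((k:ℝ)+1+1) * Real.exp 1 * (((k:ℝ)+1) ^ (k+2) * Real.exp 1) := by ring
        _ ≤ ((k:ℝ)+1+1) * Real.exp 1 * ((k:ℝ)+2)^(k+2) := by gcongr
        _ = _ := by ring
  rcases m with _ | k
  · simp
  · have := h1 k
    push_cast
    refine this.trans ?_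
    gcongr
    linarith

theorem prod_factorial_le {β : Type*} [Fintype β] (N : β → ℕ) (m : ℕ) (hm : ∑ b, N b = m) :
    ((∏ b, (N b).factorial : ℕ) : ℝ) ≤ m.factorial * (Real.exp 1 * (m + 1)) ^ (Fintype.card β)
      * ∏ b, ((N b : ℝ) / m) ^ (N b) := by
  have hle : ∀ b, N b ≤ m := fun b => hm ▸ Finset.single_le_sum (fun _ _ => Nat.zero_le _) (mem_univ b)
  have h1 : ((∏ b, (N b).factorial : ℕ) : ℝ) * Real.exp m
      ≤ (Real.exp 1 * (m + 1)) ^ (Fintype.card β) * ∏ b, (N b : ℝ) ^ (N b) := by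
    have : Real.exp m = ∏ b, Real.exp (N b) := by
      rw [← Real.exp_sum, ← hm]; push_cast; rfl
    rw [this, Nat.cast_prod, ← Finset.prod_mul_distrib, ← Finset.card_univ, ← Finset.prod_const,
      ← Finset.prod_mul_distrib]
    refine Finset.prod_le_prod (fun _ _ => by positivity) fun b _ => ?_
    refine (factorial_upper _).trans ?_
    gcongr
    exact hle b
  have h2 : ∏ b, ((N b : ℝ) / m) ^ (N b) = (∏ b, (N b : ℝ) ^ (N b)) / (m:ℝ)^m := by
    simp only [div_pow, Finset.prod_div_distrib]
    rw [Finset.prod_pow_eq_pow_sum, hm]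
  have h3 := factorial_lower m
  have hmm : (0:ℝ) < (m:ℝ)^m := by
    rcases m with _ | m
    · simp
    · positivity
  rw [h2, mul_div_assoc', le_div_iff₀ hmm]
  calc _ ≤ ((∏ b, (N b).factorial : ℕ) : ℝ) * (m.factorial * Real.exp m) := by gcongr
    _ = m.factorial * (((∏ b, (N b).factorial : ℕ) : ℝ) * Real.exp m) := by ring
    _ ≤ m.factorial * ((Real.exp 1 * (m + 1)) ^ (Fintype.card β) * ∏ b, (N b : ℝ) ^ (N b)) := by gcongr
    _ = _ := by ring

/-- chi-square -/
noncomputable def kap {β : Type*} [Fintype β] (N : β → ℕ) (m : ℕ) : ℝ :=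
  (Fintype.card β : ℝ) * ∑ b, ((N b : ℝ) / m) ^ 2 - 1

theorem prod_pow_kap {β : Type*} [Fintype β] (N : β → ℕ) (m : ℕ) (hm : ∑ b, N b = m) :
    (Fintype.card β : ℝ) ^ m * ∏ b, ((N b : ℝ) / m) ^ (N b) ≤ Real.exp (m * kap N m) := by
  have h0 : (Fintype.card β : ℝ) ^ m = ∏ b, (Fintype.card β : ℝ) ^ (N b) := by
    rw [Finset.prod_pow_eq_pow_sum, hm]
  rw [h0, ← Finset.prod_mul_distrib]
  have h1 : (m : ℝ) * kap N m = ∑ b, (N b : ℝ) * ((Fintype.card β : ℝ) * ((N b : ℝ) / m) - 1) := by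
    unfold kap
    rcases Nat.eq_zero_or_pos m with h | h
    · subst h
      have : ∀ b, N b = 0 := by intro b; simpa using (Finset.sum_eq_zero_iff.mp hm) b
      simp [this]
    · simp only [mul_sub, Finset.sum_sub_distrib, mul_one, ← Nat.cast_sum, hm]
      congr 1
      rw [Finset.mul_sum, Finset.mul_sum]
      refine Finset.sum_congr rfl fun b _ => ?_
      field_simp
  rw [h1, Real.exp_sum]
  refine Finset.prod_le_prod (fun _ _ => by positivity) fun b _ => ?_
  rw [← mul_pow, Real.exp_nat_mul]
  refine pow_le_pow_left₀ (by positivity) ?_ _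
  have := Real.add_one_le_exp ((Fintype.card β : ℝ) * ((N b : ℝ) / m) - 1)
  linarith

theorem transfer {H β : Type*} [Fintype H] [DecidableEq H] [Fintype β] [DecidableEq β] [Nonempty β]
    (c : H → β) (G : (H → β) → ℂ) (B : ℝ)
    (hB : ∀ z : β → ℂ, (∀ b, ‖z b‖ = 1) → ‖∑ u, G u * ∏ h, z (u h)‖ ≤ B) :
    ‖∑ g : Equiv.Perm H, G (c ∘ g)‖ ≤ (Fintype.card H).factorial *
      ((Real.exp 1 * (Fintype.card H + 1)) ^ (Fintype.card β) *
        Real.exp (Fintype.card H * kap (hist c) (Fintype.card H))) *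
          (B / (Fintype.card β : ℝ) ^ (Fintype.card H)) := by
  rw [sum_perm_comp, norm_mul, Complex.norm_natCast]
  have h1 := extraction (hist c) (hist_le c) G B hB
  have hB0 : 0 ≤ B := (norm_nonneg _).trans h1
  have h2 := prod_factorial_le (hist c) _ (sum_hist c)
  have h3 := prod_pow_kap (hist c) _ (sum_hist c)
  have hp : (0:ℝ) < (Fintype.card β : ℝ) ^ (Fintype.card H) := by
    have : 0 < Fintype.card β := Fintype.card_pos
    positivity
  rw [← le_div_iff₀' hp] at h3
  calc _ ≤ ((∏ b, (hist c b).factorial : ℕ) : ℝ) * B := by gcongr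
    _ ≤ ((Fintype.card H).factorial * (Real.exp 1 * (Fintype.card H + 1)) ^ (Fintype.card β)
      * (Real.exp (Fintype.card H * kap (hist c) (Fintype.card H)) / (Fintype.card β : ℝ) ^ (Fintype.card H))) * B := by
        gcongr
        exact h2.trans (by gcongr)
    _ = _ := by ring

theorem small_supp {H : Type*} [Fintype H] [DecidableEq H] (m0 : ℕ) (β : ℝ)
    (hβ0 : 0 < β) (hβ1 : β ≤ 1) (hβ : 2 * (m0 : ℝ) ≤ Fintype.card H * β ^ 2)
    (hm0 : m0 < Fintype.card H) (A : Finset H) :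
    ∀ (φ : H → H → ℂ) (u : H → ℝ), A.card ≤ m0 → (∀ h ∈ A, ∀ y, ‖φ h y‖ ≤ 1) →
    (∀ h ∈ A, 0 ≤ u h) → (∀ h ∈ A, ‖∑ y, φ h y‖ ≤ Fintype.card H * u h) →
    ‖∑ g : Equiv.Perm H, ∏ h ∈ A, φ h (g h)‖ ≤ (Fintype.card H).factorial *
      ((Fintype.card H : ℝ) / (Fintype.card H - m0)) ^ A.card * ∏ h ∈ A, (u h + β) := by
  set x := Fintype.card H with hx
  have hxm : (0:ℝ) < (x:ℝ) - m0 := by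
    have : (m0:ℝ) < x := by exact_mod_cast hm0
    linarith
  set R := (x:ℝ) / (x - m0) with hR
  have hR0 : 0 ≤ R := by positivity
  induction A using Finset.induction_on with
  | empty =>
    intro φ u _ _ _ _
    simp [Fintype.card_perm, ← hx]
  | insert h0 A h0A ih =>
    intro φ u hc h1 hu0 hu
    rw [card_insert_of_notMem h0A] at hc
    have h1' : ∀ h ∈ A, ∀ y, ‖φ h y‖ ≤ 1 := fun h hh => h1 h (mem_insert_of_mem hh)
    have hu0' : ∀ h ∈ A, 0 ≤ u h := fun h hh => hu0 h (mem_insert_of_mem hh)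
    have hu' : ∀ h ∈ A, ‖∑ y, φ h y‖ ≤ x * u h := fun h hh => hu h (mem_insert_of_mem hh)
    set Pr := ∏ h ∈ A, (u h + β) with hPr
    have hPr0 : 0 ≤ Pr := Finset.prod_nonneg fun h hh => by have := hu0' h hh; positivity
    have ih0 := ih φ u (by omega) h1' hu0' hu'
    -- merged terms
    have ihj : ∀ j ∈ A, ‖∑ g : Equiv.Perm H, φ h0 (g j) * ∏ h ∈ A, φ h (g h)‖ ≤
        x.factorial * R ^ A.card * (Pr * ((1 + β) / β)) := by
      intro j hj
      have hne : ∀ h ∈ A, h ≠ h0 := fun h hh e => h0A (e ▸ hh)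
      have := ih (Function.update φ j (fun y => φ h0 y * φ j y)) (Function.update u j 1) (by omega)
        (by
          intro h hh y
          by_cases e : h = j
          · subst e
            simp only [Function.update_self, norm_mul]
            exact mul_le_one₀ (h1 h0 (mem_insert_self _ _) y) (norm_nonneg _) (h1' h hh y)
          · simp only [Function.update_of_ne e]; exact h1' h hh y)
        (by
          intro h hh
          by_cases e : h = j
          · subst e; simp
          · simp only [Function.update_of_ne e]; exact hu0' h hh)
        (by
          intro h hh
          by_cases e : h = j
          · subst e
            simp only [Function.update_self, mul_one]
            refine (norm_sum_le _ _).trans ?_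
            refine (Finset.sum_le_sum (g := fun _ => (1:ℝ)) fun y _ => ?_).trans (by simp [hx])
            rw [norm_mul]
            exact mul_le_one₀ (h1 h0 (mem_insert_self _ _) y) (norm_nonneg _) (h1' h hh y)
          · simp only [Function.update_of_ne e]; exact hu' h hh)
      have e1 : ∀ g : Equiv.Perm H,
          ∏ h ∈ A, (Function.update φ j (fun y => φ h0 y * φ j y)) h (g h)
            = φ h0 (g j) * ∏ h ∈ A, φ h (g h) := by
        intro g
        rw [← Finset.mul_prod_erase A _ hj, ← Finset.mul_prod_erase A (fun h => φ h (g h)) hj,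
          Function.update_self, mul_assoc]
        congr 2
        refine Finset.prod_congr rfl fun h hh => ?_
        rw [Function.update_of_ne (Finset.ne_of_mem_erase hh)]
      simp only [e1] at this
      refine this.trans ?_
      gcongr
      rw [hPr, ← Finset.mul_prod_erase A _ hj, ← Finset.mul_prod_erase A (fun h => u h + β) hj,
          Function.update_self]
      have e2 : ∏ x ∈ A.erase j, (Function.update u j 1 x + β) = ∏ x ∈ A.erase j, (u x + β) := by
        refine Finset.prod_congr rfl fun h hh => ?_
        rw [Function.update_of_ne (Finset.ne_of_mem_erase hh)]
      rw [e2]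
      have e3 : 0 ≤ ∏ x ∈ A.erase j, (u x + β) := Finset.prod_nonneg fun h hh => by
        have := hu0' h (Finset.mem_of_mem_erase hh); positivity
      have e4 : (1 + β) ≤ (u j + β) * ((1+β)/β) := by
        rw [mul_div_assoc', le_div_iff₀ hβ0]
        nlinarith [hu0' j hj, mul_nonneg (hu0' j hj) hβ0.le]
      nlinarith
    -- recursion
    have hsym : ∀ h, h ∉ A → ∑ g : Equiv.Perm H, φ h0 (g h) * ∏ j ∈ A, φ j (g j)
        = ∑ g : Equiv.Perm H, ∏ j ∈ insert h0 A, φ j (g j) := by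
      intro h hh
      rw [← Equiv.sum_comp (Equiv.mulRight (Equiv.swap h0 h))]
      refine Finset.sum_congr rfl fun g _ => ?_
      rw [Finset.prod_insert h0A]
      simp only [Equiv.coe_mulRight, Equiv.Perm.coe_mul, Function.comp, Equiv.swap_apply_right]
      congr 1
      refine Finset.prod_congr rfl fun j hj => ?_
      rw [Equiv.swap_apply_of_ne_of_ne]
      · rintro rfl; exact h0A hj
      · rintro rfl; exact hh hj
    set S := ∑ g : Equiv.Perm H, ∏ j ∈ insert h0 A, φ j (g j) with hS
    have hrec : (∑ y, φ h0 y) * ∑ g : Equiv.Perm H, ∏ h ∈ A, φ h (g h) =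
        ((x:ℂ) - A.card) * S + ∑ j ∈ A, ∑ g : Equiv.Perm H, φ h0 (g j) * ∏ h ∈ A, φ h (g h) := by
      have e1 : (∑ y, φ h0 y) * ∑ g : Equiv.Perm H, ∏ h ∈ A, φ h (g h) =
          ∑ h, ∑ g : Equiv.Perm H, φ h0 (g h) * ∏ j ∈ A, φ j (g j) := by
        rw [Finset.sum_comm, Finset.mul_sum]
        refine Finset.sum_congr rfl fun g _ => ?_
        rw [← Finset.sum_mul, Equiv.sum_comp g (φ h0)]
      rw [e1, ← Finset.sum_compl_add_sum A]
      congr 1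
      rw [Finset.sum_congr rfl (fun h hh => hsym h (Finset.mem_compl.mp hh))]
      rw [Finset.sum_const, Finset.card_compl, nsmul_eq_mul, Nat.cast_sub (Finset.card_le_univ A), hx]
    have hcm : (A.card : ℝ) + 1 ≤ m0 := by exact_mod_cast hc
    have hD : (0:ℝ) < (x:ℝ) - A.card := by linarith
    have hnorm : ((x:ℝ) - A.card) * ‖S‖ ≤ x * u h0 * (x.factorial * R ^ A.card * Pr)
        + A.card * (x.factorial * R ^ A.card * (Pr * ((1 + β) / β))) := by
      have e1 : ((x:ℝ) - A.card) * ‖S‖ = ‖((x:ℂ) - A.card) * S‖ := by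
        rw [norm_mul]
        congr 1
        have : ((x:ℂ) - A.card) = (((x:ℝ) - A.card : ℝ) : ℂ) := by push_cast; rfl
        rw [this, Complex.norm_real, Real.norm_of_nonneg hD.le]
      rw [e1, eq_sub_of_add_eq hrec.symm]
      refine (norm_sub_le _ _).trans ?_
      gcongr
      · rw [norm_mul]
        have := hu h0 (mem_insert_self _ _)
        exact mul_le_mul this ih0 (norm_nonneg _) (le_trans (norm_nonneg _) this)
      · refine (norm_sum_le _ _).trans ?_
        refine (Finset.sum_le_sum ihj).trans ?_
        simp
    have hu00 := hu0 h0 (mem_insert_self _ _)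
    rw [card_insert_of_notMem h0A, Finset.prod_insert h0A, ← hPr]
    set Q := (x.factorial : ℝ) * R ^ A.card * Pr with hQ
    have hQ0 : 0 ≤ Q := by positivity
    have f1 : (A.card : ℝ) * ((1+β)/β) ≤ x * β := by
      rw [mul_div_assoc', div_le_iff₀ hβ0]
      nlinarith [Nat.cast_nonneg (α := ℝ) A.card]
    have f2 : ((x:ℝ) - A.card) * ‖S‖ ≤ x * (u h0 + β) * Q := by
      refine hnorm.trans ?_
      have : A.card * (x.factorial * R ^ A.card * (Pr * ((1 + β) / β))) = (A.card * ((1+β)/β)) * Q := by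
        rw [hQ]; ring
      rw [this]
      nlinarith
    have f3 : (x:ℝ) ≤ R * (x - A.card) := by
      rw [hR, div_mul_eq_mul_div, le_div_iff₀ hxm]
      have : (0:ℝ) ≤ x := by positivity
      nlinarith
    have f4 : ((x:ℝ) - A.card) * ‖S‖ ≤ ((x:ℝ) - A.card) * (R * (u h0 + β) * Q) := by
      refine f2.trans ?_
      have : 0 ≤ (u h0 + β) * Q := by positivity
      nlinarith
    have := le_of_mul_le_mul_left f4 hD
    refine this.trans (le_of_eq ?_)
    rw [hQ]; ring

theorem gibbs {β : Type*} [Fintype β] (N : β → ℕ) (a : β → ℝ) (M : ℕ)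
    (ha : ∀ b, 0 ≤ a b) (hs : ∑ b, a b ≤ 1) (hM : ∑ b, N b = M) :
    ∏ b, a b ^ N b ≤ ∏ b, ((N b : ℝ) / M) ^ N b := by
  have key : ∀ b, a b ^ N b ≤ ((N b : ℝ) / M) ^ N b * Real.exp (M * a b - N b) := by
    intro b
    rcases Nat.eq_zero_or_pos (N b) with h | h
    · simp only [h, pow_zero, one_mul, Nat.cast_zero, sub_zero]
      exact Real.one_le_exp (mul_nonneg (Nat.cast_nonneg _) (ha b))
    · have hMp : 0 < M := lt_of_lt_of_le h
        (hM ▸ Finset.single_le_sum (fun _ _ => Nat.zero_le _) (mem_univ b))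
      have h1 : a b ≤ ((N b : ℝ) / M) * Real.exp (M * a b / N b - 1) := by
        have := Real.add_one_le_exp (M * a b / N b - 1)
        calc a b = ((N b : ℝ) / M) * (M * a b / N b - 1 + 1) := by field_simp; ring
          _ ≤ _ := by gcongr
      refine (pow_le_pow_left₀ (ha b) h1 (N b)).trans (le_of_eq ?_)
      rw [mul_pow, ← Real.exp_nat_mul]
      congr 2
      field_simp
  refine (Finset.prod_le_prod (fun b _ => pow_nonneg (ha b) _) fun b _ => key b).trans ?_
  rw [Finset.prod_mul_distrib, ← Real.exp_sum]
  have h2 : ∑ b, ((M:ℝ) * a b - N b) ≤ 0 := by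
    rw [Finset.sum_sub_distrib, ← Finset.mul_sum, ← Nat.cast_sum, hM]
    have : (0:ℝ) ≤ M := Nat.cast_nonneg _
    nlinarith
  exact mul_le_of_le_one_right (Finset.prod_nonneg fun _ _ => by positivity) (Real.exp_le_one_iff.mpr h2)

/-- sum over profiles -/
theorem sum_profile {V β : Type*} [Fintype V] [DecidableEq V] [Fintype β] [DecidableEq β] (hV : 0 < Fintype.card V) :
    ∑ t : V → β, ∏ k, ((hist t (t k) : ℝ) / Fintype.card V) ≤
      ((Fintype.card V : ℝ) + 1) ^ Fintype.card β := by
  set M := Fintype.card V with hM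
  let f : (V → β) → (β → Fin (M+1)) := fun t b => ⟨hist t b, Nat.lt_succ_of_le (hist_le t b)⟩
  have h1 : ∑ t : V → β, ∏ k, ((hist t (t k) : ℝ) / M) =
      ∑ N : β → Fin (M+1), ∑ t ∈ univ.filter (fun t => f t = N), ∏ k, ((hist t (t k) : ℝ) / M) :=
    (Finset.sum_fiberwise univ f _).symm
  rw [h1]
  have h2 : ∀ N : β → Fin (M+1), ∑ t ∈ univ.filter (fun t => f t = N), ∏ k, ((hist t (t k) : ℝ) / M) ≤ 1 := by
    intro N
    by_cases hN : ∃ t, f t = N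
    · obtain ⟨t0, ht0⟩ := hN
      have e0 : ∑ b, ((N b : ℕ) : ℝ) / M = 1 := by
        rw [← Finset.sum_div, ← Nat.cast_sum]
        have : ∑ b, (N b : ℕ) = M := by
          rw [← ht0]; exact sum_hist t0
        rw [this]; field_simp
      calc ∑ t ∈ univ.filter (fun t => f t = N), ∏ k, ((hist t (t k) : ℝ) / M)
          = ∑ t ∈ univ.filter (fun t => f t = N), ∏ k, (((N (t k) : ℕ) : ℝ) / M) := by
            refine Finset.sum_congr rfl fun t ht => Finset.prod_congr rfl fun k _ => ?_
            rw [← (Finset.mem_filter.mp ht).2]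
        _ ≤ ∑ t : V → β, ∏ k, (((N (t k) : ℕ) : ℝ) / M) :=
            Finset.sum_le_sum_of_subset_of_nonneg (Finset.filter_subset _ _)
              (fun _ _ _ => Finset.prod_nonneg fun _ _ => by positivity)
        _ = 1 := by
            rw [← Fintype.prod_sum (fun (_ : V) b => ((N b : ℕ) : ℝ) / M)]
            simp [e0]
    · push Not at hN
      rw [Finset.filter_false_of_mem (fun t _ => hN t)]
      simp
  refine (Finset.sum_le_sum fun N _ => h2 N).trans ?_
  simp

section
variable {p : ℕ} [Fact p.Prime]

/-- Parseval -/
theorem parseval (z : ZMod p → ℂ) :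
    ∑ τ : ZMod p, ‖∑ b, z b * ZMod.stdAddChar (τ * b)‖ ^ 2 = p * ∑ b, ‖z b‖ ^ 2 := by
  have hprim := ZMod.isPrimitive_stdAddChar p
  have : ((∑ τ : ZMod p, ‖∑ b, z b * ZMod.stdAddChar (τ * b)‖ ^ 2 : ℝ) : ℂ) = ((p * ∑ b, ‖z b‖ ^ 2 : ℝ) : ℂ) := by
    push_cast
    simp only [← Complex.mul_conj', map_sum, map_mul, Finset.sum_mul_sum]
    rw [Finset.sum_comm]
    calc _ = ∑ b : ZMod p, ∑ b' : ZMod p, z b * (starRingEnd ℂ) (z b') *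
          ∑ τ : ZMod p, ZMod.stdAddChar (τ * (b - b')) := by
          rw [Finset.sum_congr rfl fun b _ => Finset.sum_comm]
          refine Finset.sum_congr rfl fun b _ => Finset.sum_congr rfl fun b' _ => ?_
          rw [Finset.mul_sum]
          refine Finset.sum_congr rfl fun τ _ => ?_
          rw [← AddChar.map_neg_eq_conj, mul_sub, sub_eq_add_neg, AddChar.map_add_eq_mul]
          ring
      _ = _ := by
          simp only [AddChar.sum_mulShift _ hprim, sub_eq_zero, ZMod.card, Nat.cast_ite, Nat.cast_zero]
          rw [Finset.mul_sum]
          refine Finset.sum_congr rfl fun b _ => ?_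
          simp; ring
  exact_mod_cast this

theorem kap_parseval {H : Type*} [Fintype H] (w : H → ZMod p) (hH : 0 < Fintype.card H) :
    ∑ τ ∈ univ.filter (fun τ : ZMod p => τ ≠ 0),
      (‖∑ h, (ZMod.stdAddChar (τ * w h) : ℂ)‖ / Fintype.card H) ^ 2 = kap (hist w) (Fintype.card H) := by
  set x := Fintype.card H with hx
  have h1 := parseval (p := p) (fun b => ((hist w b : ℝ) : ℂ))
  have h2 : ∀ τ : ZMod p, ∑ b, ((hist w b : ℝ) : ℂ) * ZMod.stdAddChar (τ * b) = ∑ h, (ZMod.stdAddChar (τ * w h) : ℂ) := by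
    intro τ
    rw [sum_hist_mul w (fun b => (ZMod.stdAddChar (τ * b) : ℂ))]
    simp
  simp only [h2, Complex.norm_real] at h1
  rw [← Finset.sum_filter_add_sum_filter_not univ (fun τ : ZMod p => τ ≠ 0)] at h1
  have h3 : ∑ τ ∈ univ.filter (fun τ : ZMod p => ¬ τ ≠ 0), ‖∑ h, (ZMod.stdAddChar (τ * w h) : ℂ)‖ ^ 2 = x ^ 2 := by
    have : univ.filter (fun τ : ZMod p => ¬ τ ≠ 0) = {0} := by ext; simp
    rw [this]; simp [hx]
  rw [h3] at h1
  have h4 : ∑ τ ∈ univ.filter (fun τ : ZMod p => τ ≠ 0), ‖∑ h, (ZMod.stdAddChar (τ * w h) : ℂ)‖ ^ 2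
    = p * ∑ b, ‖(hist w b : ℝ)‖ ^ 2 - x ^ 2 := by linarith
  have hx0 : (x:ℝ) ≠ 0 := by positivity
  simp only [div_pow]
  rw [← Finset.sum_div, h4]
  unfold kap
  rw [ZMod.card]
  simp only [div_pow, ← Finset.sum_div, Real.norm_natCast]
  field_simp

end

theorem addChar_sum {ι A : Type*} [AddCommMonoid A] (ψ : AddChar A ℂ) (s : Finset ι) (f : ι → A) :
    ψ (∑ i ∈ s, f i) = ∏ i ∈ s, ψ (f i) := by
  classical
  induction s using Finset.induction_on with
  | empty => simp
  | insert a s ha ih => rw [Finset.sum_insert ha, Finset.prod_insert ha, AddChar.map_add_eq_mul, ih]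

section
variable {p : ℕ} [Fact p.Prime] {V : Type*} [Fintype V] [DecidableEq V] {d : ℕ}

noncomputable def Et (w : V × Fin d → ZMod p) (t : V → ZMod p) : ℂ :=
  ∑ g : Equiv.Perm (V × Fin d), ∏ h : V × Fin d, ZMod.stdAddChar (t h.1 * w (g h))

theorem Et_shift (w : V × Fin d → ZMod p) (hw : ∑ h, w h = 0) (t : V → ZMod p) (c : ZMod p) :
    Et w (fun k => t k + c) = Et w t := by
  unfold Et
  refine Finset.sum_congr rfl fun g _ => ?_
  simp only [add_mul, AddChar.map_add_eq_mul]
  rw [Finset.prod_mul_distrib]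
  have : ∏ h : V × Fin d, (ZMod.stdAddChar (c * w (g h)) : ℂ) = 1 := by
    rw [← addChar_sum, ← Finset.mul_sum, Equiv.sum_comp g w, hw]; simp
  rw [this, mul_one]

theorem Et_zero (w : V × Fin d → ZMod p) : Et w (fun _ => 0) = (Fintype.card (V × Fin d)).factorial := by
  simp [Et, Fintype.card_perm]

theorem count_eq (w : V × Fin d → ZMod p) :
    (p : ℂ) ^ Fintype.card V *
      ((univ.filter (fun g : Equiv.Perm (V × Fin d) => ∀ k, ∑ i, w (g (k, i)) = 0)).card : ℂ)
      = ∑ t : V → ZMod p, Et w t := by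
  unfold Et
  rw [Finset.sum_comm, Finset.card_filter, Nat.cast_sum, Finset.mul_sum]
  refine Finset.sum_congr rfl fun g _ => ?_
  have h1 : ∀ t : V → ZMod p, ∏ h : V × Fin d, (ZMod.stdAddChar (t h.1 * w (g h)) : ℂ)
      = ∏ k, ZMod.stdAddChar (t k * ∑ i, w (g (k, i))) := by
    intro t
    rw [Fintype.prod_prod_type]
    refine Finset.prod_congr rfl fun k _ => ?_
    rw [Finset.mul_sum, addChar_sum]
  simp only [h1]
  rw [← Fintype.prod_sum (fun k (τ : ZMod p) => (ZMod.stdAddChar (τ * ∑ i, w (g (k, i))) : ℂ))]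
  simp only [AddChar.sum_mulShift _ (ZMod.isPrimitive_stdAddChar p), ZMod.card]
  split_ifs with h
  · simp [h]
  · push Not at h
    obtain ⟨k, hk⟩ := h
    rw [Finset.prod_eq_zero (mem_univ k)] <;> simp [hk]

theorem sum_shift (w : V × Fin d → ZMod p) (hw : ∑ h, w h = 0) :
    ∑ t : V → ZMod p, ‖Et w t‖ ≤
      p * ∑ t ∈ univ.filter (fun t : V → ZMod p => ∀ c, hist t c ≤ hist t 0), ‖Et w t‖ := by
  set Z := univ.filter (fun t : V → ZMod p => ∀ c, hist t c ≤ hist t 0) with hZ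
  have h1 : ∀ t : V → ZMod p, ‖Et w t‖ ≤ ∑ c : ZMod p, if (fun k => t k + c) ∈ Z then ‖Et w t‖ else 0 := by
    intro t
    obtain ⟨c0, -, hc0⟩ := Finset.exists_max_image (univ : Finset (ZMod p)) (hist t) ⟨0, mem_univ _⟩
    have hh : ∀ c, hist (fun k => t k + -c0) c = hist t (c + c0) := by
      intro c
      unfold hist
      congr 1
      ext k
      simp only [mem_filter, mem_univ, true_and]
      exact ⟨fun h => by rw [← h]; ring, fun h => by rw [h]; ring⟩
    have hm : (fun k => t k + -c0) ∈ Z := by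
      simp only [hZ, mem_filter, mem_univ, true_and]
      intro c
      rw [hh, hh, zero_add]
      exact hc0 _ (mem_univ _)
    refine le_trans ?_ (Finset.single_le_sum (f := fun c => if (fun k => t k + c) ∈ Z then ‖Et w t‖ else 0)
      (fun c _ => by split_ifs <;> simp) (mem_univ (-c0)))
    simp [hm]
  refine (Finset.sum_le_sum fun t _ => h1 t).trans ?_
  rw [Finset.sum_comm]
  have h2 : ∀ c : ZMod p, (∑ t : V → ZMod p, if (fun k => t k + c) ∈ Z then ‖Et w t‖ else 0)
      = ∑ t ∈ Z, ‖Et w t‖ := by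
    intro c
    rw [← Finset.sum_filter]
    refine Finset.sum_bij (fun t _ => fun k => t k + c) ?_ ?_ ?_ ?_
    · intro t ht; exact (Finset.mem_filter.mp ht).2
    · intro a _ b _ hab
      funext k
      have := congrFun hab k
      simpa using this
    · intro t ht
      refine ⟨fun k => t k - c, ?_, by simp⟩
      simp only [mem_filter, mem_univ, true_and, sub_add_cancel]
      exact ht
    · intro t _
      rw [Et_shift w hw]
  simp [h2, ZMod.card]

theorem prod_kd (f : V → ℝ) : ∏ h : V × Fin d, f h.1 = ∏ k, f k ^ d := by
  rw [Fintype.prod_prod_type]; simp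

/-- Region B -/
theorem region_B (hd : 3 ≤ d) (w : V × Fin d → ZMod p) (t : V → ZMod p) (hV : 0 < Fintype.card V)
    (s0 : ℝ)
    (ht : ∀ c, (hist t c : ℝ) ≤ Fintype.card V - s0) :
    ‖Et w t‖ ≤ (Fintype.card (V × Fin d)).factorial *
      ((Real.exp 1 * (Fintype.card (V × Fin d) + 1)) ^ p *
        Real.exp (Fintype.card (V × Fin d) * kap (hist w) (Fintype.card (V × Fin d)))) *
          (Real.exp (-s0 / 2) * ∏ k, ((hist t (t k) : ℝ) / Fintype.card V)) := by
  set M := Fintype.card V with hM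
  have hp : (0:ℝ) < p := by exact_mod_cast (Fact.out : p.Prime).pos
  set ρ := ∏ k, ((hist t (t k) : ℝ) / M) with hρ
  have hρ0 : 0 ≤ ρ := Finset.prod_nonneg fun _ _ => by positivity
  have hρs : Real.sqrt ρ ≤ Real.exp (-s0/2) := by
    have : ρ ≤ Real.exp (-s0/2) ^ 2 := by
      rw [← Real.exp_nat_mul]
      have h1 : ∀ k, ((hist t (t k) : ℝ) / M) ≤ Real.exp (-s0 / M) := by
        intro k
        refine le_trans ?_ (Real.add_one_le_exp _)
        rw [div_le_iff₀ (by positivity)]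
        have := ht (t k)
        have e : (-s0 / M + 1) * M = M - s0 := by field_simp; ring
        rw [e]; exact this
      refine (Finset.prod_le_prod (fun _ _ => by positivity) fun k _ => h1 k).trans ?_
      rw [Finset.prod_const, Finset.card_univ, ← hM, ← Real.exp_nat_mul]
      apply le_of_eq; congr 1; push_cast; field_simp
    calc Real.sqrt ρ ≤ Real.sqrt (Real.exp (-s0/2) ^ 2) := Real.sqrt_le_sqrt this
      _ = _ := Real.sqrt_sq (Real.exp_pos _).le
  have hx : Fintype.card (V × Fin d) = M * d := by simp [hM]
  have := transfer w (fun u => ∏ h : V × Fin d, (ZMod.stdAddChar (t h.1 * u h) : ℂ))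
    ((p:ℝ) ^ Fintype.card (V × Fin d) * (Real.sqrt ρ * ρ)) ?_
  · unfold Et
    simp only [Function.comp_apply, ZMod.card] at this
    refine this.trans ?_
    rw [mul_div_cancel_left₀ _ (by positivity)]
    gcongr
  · intro z hz
    simp only [← Finset.prod_mul_distrib]
    rw [← Fintype.prod_sum (fun (h : V × Fin d) b => (ZMod.stdAddChar (t h.1 * b) : ℂ) * z b)]
    rw [norm_prod]
    set y : ZMod p → ℝ := fun τ => ‖∑ b, (ZMod.stdAddChar (τ * b) : ℂ) * z b‖ / p with hy
    have hy0 : ∀ τ, 0 ≤ y τ := fun τ => by positivity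
    have hy1 : ∀ τ, y τ ≤ 1 := by
      intro τ
      rw [hy, div_le_one hp]
      refine (norm_sum_le _ _).trans ?_
      simp [hz, ZMod.card]
    have hpar : ∑ τ, y τ ^ 2 = 1 := by
      have := parseval (p := p) z
      simp only [hz] at this
      simp only [hy, div_pow, ← Finset.sum_div]
      rw [div_eq_iff (by positivity), one_mul]
      simp only [mul_comm (ZMod.stdAddChar _)]
      rw [this]; simp [ZMod.card]; ring
    have e1 : ∏ h : V × Fin d, ‖∑ b, (ZMod.stdAddChar (t h.1 * b) : ℂ) * z b‖
        = (p:ℝ) ^ Fintype.card (V × Fin d) * ∏ k, y (t k) ^ d := by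
      rw [← prod_kd (fun k => y (t k)), ← Finset.card_univ, ← Finset.prod_const, ← Finset.prod_mul_distrib]
      refine Finset.prod_congr rfl fun h _ => ?_
      simp only [hy]; field_simp
    rw [e1]
    gcongr
    have e2 : ∏ k, y (t k) ^ d ≤ (∏ k, y (t k)) ^ 3 := by
      rw [← Finset.prod_pow]
      exact Finset.prod_le_prod (fun k _ => pow_nonneg (hy0 _) _)
        (fun k _ => pow_le_pow_of_le_one (hy0 _) (hy1 _) hd)
    have e3 : (∏ k, y (t k)) ^ 2 ≤ ρ := by
      have g := gibbs (hist t) (fun τ => y τ ^ 2) M (fun τ => by positivity) hpar.le (sum_hist t)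
      rw [← prod_hist t, ← prod_hist t (fun b => ((hist t b : ℝ) / M))] at g
      rw [← Finset.prod_pow]; exact g
    have e4 : ∏ k, y (t k) ≤ Real.sqrt ρ := Real.le_sqrt_of_sq_le e3
    have e5 : 0 ≤ ∏ k, y (t k) := Finset.prod_nonneg fun k _ => hy0 _
    calc _ ≤ _ := e2
      _ = (∏ k, y (t k)) * (∏ k, y (t k)) ^ 2 := by ring
      _ ≤ _ := by gcongr

end

section
variable {p : ℕ} [Fact p.Prime] {V : Type*} [Fintype V] [DecidableEq V] {d : ℕ}

def supp (t : V → ZMod p) : Finset V := univ.filter (fun k => t k ≠ 0)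

noncomputable def qh (w : V × Fin d → ZMod p) (τ : ZMod p) : ℝ :=
  ‖∑ h, (ZMod.stdAddChar (τ * w h) : ℂ)‖ / Fintype.card (V × Fin d)

theorem region_A (hd : 3 ≤ d) (w : V × Fin d → ZMod p) (t : V → ZMod p)
    (hs1 : 1 ≤ (supp t).card) (hs2 : 2 * d * (supp t).card ^ 2 ≤ Fintype.card V) :
    ‖Et w t‖ ≤ (Fintype.card (V × Fin d)).factorial * 2 *
      ∏ k ∈ supp t, (qh w (t k) + Real.sqrt (2 * (supp t).card / Fintype.card V)) ^ d := by
  set S := supp t with hS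
  set s := S.card with hs
  set M := Fintype.card V with hM
  set β := Real.sqrt (2 * s / M) with hβ
  have hx : Fintype.card (V × Fin d) = M * d := by simp [hM]
  have hsM : 2 * s < M := by nlinarith
  have hMpos : 0 < M := by omega
  have hβ2 : β ^ 2 = 2 * s / M := Real.sq_sqrt (by positivity)
  have hβ0 : 0 < β := Real.sqrt_pos.mpr (by positivity)
  have hβ1 : β ≤ 1 := by
    rw [hβ, Real.sqrt_le_left (by norm_num), one_pow, div_le_one (by positivity)]
    exact_mod_cast hsM.le
  have hcard : (S ×ˢ (univ : Finset (Fin d))).card = s * d := by simp [hs]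
  have key := small_supp (H := V × Fin d) (s * d) β hβ0 hβ1
    (by rw [hβ2, hx]; push_cast; apply le_of_eq; field_simp)
    (by rw [hx]; have : 0 < d := by omega
        exact Nat.mul_lt_mul_of_pos_right (by omega) this) (S ×ˢ univ)
    (fun h y => ZMod.stdAddChar (t h.1 * w y)) (fun h => qh w (t h.1)) hcard.le
    (fun h _ y => (AddChar.norm_apply _ _).le)
    (fun h _ => by unfold qh; positivity)
    (fun h _ => by
      unfold qh
      rw [mul_div_cancel₀]
      rw [hx]; push_cast
      have : 0 < d := by omega
      positivity)
  have e1 : ∀ g : Equiv.Perm (V × Fin d), ∏ h ∈ S ×ˢ (univ : Finset (Fin d)), (ZMod.stdAddChar (t h.1 * w (g h)) : ℂ)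
      = ∏ h : V × Fin d, ZMod.stdAddChar (t h.1 * w (g h)) := by
    intro g
    refine Finset.prod_subset (Finset.subset_univ _) ?_
    intro h _ hh
    have : t h.1 = 0 := by
      by_contra hne
      exact hh (by simp [hS, supp, hne])
    simp [this]
  simp only [e1] at key
  unfold Et
  refine key.trans ?_
  rw [Finset.prod_product]
  simp only [Finset.prod_const, Finset.card_univ, Fintype.card_fin]
  have hpr : 0 ≤ ∏ k ∈ S, (qh w (t k) + β) ^ d := Finset.prod_nonneg fun k _ => by
    unfold qh; positivity
  refine mul_le_mul_of_nonneg_right ?_ hpr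
  refine mul_le_mul_of_nonneg_left ?_ (by positivity)
  rw [hcard, hx]
  -- (x/(x-m))^m ≤ 2
  set m := s * d with hm
  have hm2 : 2 * m ^ 2 ≤ M * d := by
    calc 2 * m^2 = (2 * d * s^2) * d := by rw [hm]; ring
      _ ≤ M * d := Nat.mul_le_mul_right _ hs2
  have hxr : (2:ℝ) * (m:ℝ) ^ 2 ≤ ((M * d : ℕ):ℝ) := by exact_mod_cast hm2
  set x : ℝ := ((M * d : ℕ):ℝ) with hxx
  have hm1 : (1:ℝ) ≤ m := by
    have : 1 ≤ m := by rw [hm]; nlinarith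
    exact_mod_cast this
  have hxp : 0 < x := by nlinarith
  have hxm : 0 < x - m := by nlinarith
  have b1 : 1 + (m:ℝ) * (-(m/x)) ≤ (1 + -(m/x)) ^ m := by
    apply one_add_mul_le_pow
    have : (m:ℝ)/x ≤ 1 := by rw [div_le_one hxp]; linarith
    linarith
  have b2 : (1:ℝ)/2 ≤ 1 + (m:ℝ) * (-(m/x)) := by
    have : (m:ℝ) * (m/x) ≤ 1/2 := by
      rw [mul_div_assoc', div_le_iff₀ hxp]; nlinarith
    linarith
  have b3 : x / (x - m) = (1 + -((m:ℝ)/x))⁻¹ := by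
    rw [eq_comm, inv_eq_iff_eq_inv, inv_div]
    field_simp
    ring
  rw [b3, inv_pow]
  rw [inv_le_comm₀ (by linarith) (by norm_num)]
  linarith

/-- sum over all vectors with given support -/
theorem sum_supp (S : Finset V) (c : ZMod p → ℝ) (hc : ∀ τ, 0 ≤ c τ) :
    ∑ t ∈ univ.filter (fun t : V → ZMod p => supp t = S), ∏ k ∈ S, c (t k)
      ≤ (∑ τ ∈ univ.filter (fun τ : ZMod p => τ ≠ 0), c τ) ^ S.card := by
  let f : V → ZMod p → ℝ := fun k τ => if k ∈ S then (if τ ≠ 0 then c τ else 0) else (if τ = 0 then 1 else 0)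
  have hf : ∀ k τ, 0 ≤ f k τ := by
    intro k τ; simp only [f]; split_ifs <;> simp [hc]
  calc _ = ∑ t ∈ univ.filter (fun t : V → ZMod p => supp t = S), ∏ k, f k (t k) := by
        refine Finset.sum_congr rfl fun t ht => ?_
        have hts := (Finset.mem_filter.mp ht).2
        rw [← Finset.prod_subset (Finset.subset_univ S)]
        · refine Finset.prod_congr rfl fun k hk => ?_
          have : t k ≠ 0 := by rw [← hts] at hk; simpa [supp] using hk
          simp [f, hk, this]
        · intro k _ hk
          have : t k = 0 := by rw [← hts] at hk; simpa [supp] using hk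
          simp [f, hk, this]
    _ ≤ ∑ t : V → ZMod p, ∏ k, f k (t k) :=
        Finset.sum_le_sum_of_subset_of_nonneg (Finset.filter_subset _ _)
          (fun _ _ _ => Finset.prod_nonneg fun _ _ => hf _ _)
    _ = ∏ k, ∑ τ, f k τ := (Fintype.prod_sum f).symm
    _ = ∏ k ∈ S, ∑ τ, f k τ := by
        refine (Finset.prod_subset (Finset.subset_univ S) ?_).symm
        intro k _ hk
        simp [f, hk]
    _ = _ := by
        rw [← Finset.prod_const]
        refine Finset.prod_congr rfl fun k hk => ?_
        rw [Finset.sum_filter]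
        simp [f, hk]

theorem qh_nonneg (w : V × Fin d → ZMod p) (τ : ZMod p) : 0 ≤ qh w τ := by unfold qh; positivity

theorem qh_le_one (w : V × Fin d → ZMod p) (τ : ZMod p) : qh w τ ≤ 1 := by
  unfold qh
  refine div_le_one_of_le₀ ?_ (by positivity)
  refine (norm_sum_le _ _).trans ?_
  simp

theorem sum_qh (hd : 3 ≤ d) (w : V × Fin d → ZMod p) (hV : 0 < Fintype.card V) (β : ℝ) (hβ0 : 0 ≤ β) (hβ1 : β ≤ 1) :
    ∑ τ ∈ univ.filter (fun τ : ZMod p => τ ≠ 0), (qh w τ + β) ^ d ≤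
      2 ^ d * (kap (hist w) (Fintype.card (V × Fin d)) * Real.sqrt (kap (hist w) (Fintype.card (V × Fin d))) + p * β ^ 3) := by
  set κ := kap (hist w) (Fintype.card (V × Fin d)) with hκ
  have hpar : ∑ τ ∈ univ.filter (fun τ : ZMod p => τ ≠ 0), qh w τ ^ 2 = κ := by
    refine kap_parseval w ?_
    simp; exact ⟨hV, by omega⟩
  have hle : ∀ τ ∈ univ.filter (fun τ : ZMod p => τ ≠ 0), qh w τ ≤ Real.sqrt κ := by
    intro τ hτ
    apply Real.le_sqrt_of_sq_le
    rw [← hpar]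
    exact Finset.single_le_sum (f := fun τ => qh w τ ^ 2) (fun _ _ => by positivity) hτ
  have h1 : ∀ τ ∈ univ.filter (fun τ : ZMod p => τ ≠ 0), (qh w τ + β) ^ d ≤ 2 ^ d * (qh w τ ^ 2 * Real.sqrt κ + β ^ 3) := by
    intro τ hτ
    have a0 := qh_nonneg w τ
    have a1 := qh_le_one w τ
    calc (qh w τ + β) ^ d ≤ 2 ^ (d-1) * (qh w τ ^ d + β ^ d) := add_pow_le a0 hβ0 d
      _ ≤ 2 ^ d * (qh w τ ^ 3 + β ^ 3) := by
          have q1 := pow_le_pow_of_le_one a0 a1 hd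
          have q2 := pow_le_pow_of_le_one hβ0 hβ1 hd
          have q3 : (2:ℝ) ^ (d-1) ≤ 2 ^ d := pow_le_pow_right₀ (by norm_num) (by omega)
          exact mul_le_mul q3 (add_le_add q1 q2) (by positivity) (by positivity)
      _ ≤ _ := by
          gcongr
          have := hle τ hτ
          nlinarith [sq_nonneg (qh w τ)]
  refine (Finset.sum_le_sum h1).trans ?_
  rw [← Finset.mul_sum, Finset.sum_add_distrib, ← Finset.sum_mul, hpar]
  gcongr
  rw [Finset.sum_const, nsmul_eq_mul]
  gcongr
  refine (Finset.card_le_univ _).trans ?_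
  simp [ZMod.card]

theorem choose_bound (M s : ℕ) (hs : 1 ≤ s) : (M.choose s : ℝ) ≤ (3 * M / s) ^ s := by
  have h1 := Nat.choose_le_pow_div (α := ℝ) s M
  have h2 := factorial_lower s
  refine h1.trans ?_
  rw [div_pow, mul_pow, div_le_div_iff₀ (by positivity) (by positivity)]
  have h3 : Real.exp s ≤ 3 ^ s := by
    have : Real.exp s = Real.exp 1 ^ s := by rw [← Real.exp_nat_mul]; simp
    rw [this]
    gcongr
    exact Real.exp_one_lt_three.le
  calc (M:ℝ)^s * s^s ≤ M^s * (s.factorial * Real.exp s) := by gcongr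
    _ ≤ M^s * (s.factorial * 3^s) := by gcongr
    _ = _ := by ring

theorem geom_bound (r : ℝ) (hr0 : 0 ≤ r) (hr : r ≤ 1/2) (s0 : ℕ) :
    ∑ s ∈ Finset.Icc 1 s0, r ^ s ≤ 2 * r := by
  have h : ∀ n : ℕ, ∑ s ∈ Finset.Icc 1 n, r ^ s ≤ 2 * r - 2 * r ^ (n+1) := by
    intro n
    induction n with
    | zero => simp
    | succ n ih =>
      rw [Finset.sum_Icc_succ_top (by omega)]
      have : 0 ≤ r ^ (n+1) := by positivity
      have e : r ^ (n+1+1) = r ^ (n+1) * r := pow_succ _ _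
      nlinarith
  have := h s0
  have : 0 ≤ r ^ (s0+1) := by positivity
  linarith [h s0]

theorem class_lemma (hd : 3 ≤ d) (w : V × Fin d → ZMod p) (hw : ∑ h, w h = 0)
    (s0 : ℕ) (hs0 : 1 ≤ s0) (hs2 : 2 * d * s0 ^ 2 ≤ Fintype.card V) (r : ℝ)
    (hr : r = 3 * 2 ^ d * (Fintype.card V * (kap (hist w) (Fintype.card (V × Fin d)) *
      Real.sqrt (kap (hist w) (Fintype.card (V × Fin d)))) + 3 * p * Real.sqrt (s0 / Fintype.card V)))
    (hr2 : r ≤ 1 / 2) :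
    ((univ.filter (fun g : Equiv.Perm (V × Fin d) => ∀ k, ∑ i, w (g (k, i)) = 0)).card : ℝ) ≤
      (Fintype.card (V × Fin d)).factorial * (p : ℝ) / (p : ℝ) ^ Fintype.card V *
      (1 + 4 * r + ((Real.exp 1 * (Fintype.card (V × Fin d) + 1)) ^ p *
        Real.exp (Fintype.card (V × Fin d) * kap (hist w) (Fintype.card (V × Fin d)))) *
          (Real.exp (-s0 / 2) * ((Fintype.card V : ℝ) + 1) ^ p)) := by
  set M := Fintype.card V with hM
  set x := Fintype.card (V × Fin d) with hx
  set κ := kap (hist w) x with hκ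
  set K := ((Real.exp 1 * ((x:ℝ) + 1)) ^ p * Real.exp (x * κ)) with hK
  have hMpos : 0 < M := by nlinarith
  have hsM : 2 * s0 < M := by nlinarith
  have hp : (0:ℝ) < p := by exact_mod_cast (Fact.out : p.Prime).pos
  have hxM : x = M * d := by simp [hx, hM]
  have hκ0 : 0 ≤ κ := by
    rw [hκ, ← kap_parseval w (by rw [← hx, hxM]; have : 0 < d := by omega
                                 positivity)]
    exact Finset.sum_nonneg fun _ _ => by positivity
  have hr0 : 0 ≤ r := by rw [hr]; positivity
  set Z := univ.filter (fun t : V → ZMod p => ∀ c, hist t c ≤ hist t 0) with hZ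
  -- Split
  have hA : ∑ t ∈ univ.filter (fun t : V → ZMod p => 1 ≤ (supp t).card ∧ (supp t).card ≤ s0), ‖Et w t‖
      ≤ x.factorial * (4 * r) := by
    have e1 : ∑ t ∈ univ.filter (fun t : V → ZMod p => 1 ≤ (supp t).card ∧ (supp t).card ≤ s0), ‖Et w t‖
        = ∑ s ∈ Finset.Icc 1 s0, ∑ t ∈ univ.filter (fun t : V → ZMod p => (supp t).card = s), ‖Et w t‖ := by
      rw [← Finset.sum_fiberwise_of_maps_to (t := Finset.Icc 1 s0) (g := fun t => (supp t).card)]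
      · refine Finset.sum_congr rfl fun s hs => ?_
        refine Finset.sum_congr ?_ fun _ _ => rfl
        ext t
        simp only [mem_filter, mem_univ, true_and, mem_Icc] at hs ⊢
        constructor
        · exact fun h => h.2
        · intro h; exact ⟨by omega, h⟩
      · intro t ht
        simp only [mem_filter, mem_univ, true_and] at ht
        exact Finset.mem_Icc.mpr ht
    have e2 : ∀ s ∈ Finset.Icc 1 s0, ∑ t ∈ univ.filter (fun t : V → ZMod p => (supp t).card = s), ‖Et w t‖
        ≤ x.factorial * 2 * r ^ s := by
      intro s hs
      rw [mem_Icc] at hs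
      set β := Real.sqrt (2 * s / M) with hβ
      have hsM' : 2 * s ≤ M := by omega
      have hβ0 : 0 ≤ β := Real.sqrt_nonneg _
      have hβ1 : β ≤ 1 := by
        rw [hβ, Real.sqrt_le_left (by norm_num), one_pow, div_le_one (by positivity)]
        exact_mod_cast hsM'
      have hβ2 : β ^ 2 = 2 * s / M := Real.sq_sqrt (by positivity)
      rw [← Finset.sum_fiberwise_of_maps_to (t := Finset.powersetCard s univ) (g := fun t => supp t)]
      swap
      · intro t ht
        simp only [mem_filter, mem_univ, true_and] at ht
        exact Finset.mem_powersetCard.mpr ⟨Finset.subset_univ _, ht⟩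
      have e3 : ∀ S ∈ Finset.powersetCard s (univ : Finset V),
          ∑ t ∈ (univ.filter (fun t : V → ZMod p => (supp t).card = s)).filter (fun t => supp t = S), ‖Et w t‖
          ≤ x.factorial * 2 * (2 ^ d * (κ * Real.sqrt κ + p * β ^ 3)) ^ s := by
        intro S hS
        have hSc := (Finset.mem_powersetCard.mp hS).2
        calc _ ≤ ∑ t ∈ (univ.filter (fun t : V → ZMod p => (supp t).card = s)).filter (fun t => supp t = S),
              x.factorial * 2 * ∏ k ∈ S, (qh w (t k) + β) ^ d := by
              refine Finset.sum_le_sum fun t ht => ?_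
              rw [mem_filter, mem_filter] at ht
              have := region_A hd w t (by omega)
                (by rw [ht.1.2]; refine le_trans ?_ hs2; gcongr; exact hs.2)
              rw [ht.1.2, ht.2] at this
              exact this
          _ ≤ ∑ t ∈ univ.filter (fun t : V → ZMod p => supp t = S),
              x.factorial * 2 * ∏ k ∈ S, (qh w (t k) + β) ^ d := by
              refine Finset.sum_le_sum_of_subset_of_nonneg ?_ ?_
              · intro t ht
                rw [mem_filter] at ht ⊢
                exact ⟨mem_univ _, ht.2⟩
              · intro t _ _
                refine mul_nonneg (by positivity) (Finset.prod_nonneg fun k _ => ?_)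
                have := qh_nonneg w (t k)
                positivity
          _ ≤ x.factorial * 2 * (∑ τ ∈ univ.filter (fun τ : ZMod p => τ ≠ 0), (qh w τ + β) ^ d) ^ s := by
              rw [← Finset.mul_sum]
              have := sum_supp S (fun τ => (qh w τ + β) ^ d) (fun τ => by
                have := qh_nonneg w τ
                positivity)
              rw [hSc] at this
              gcongr
          _ ≤ _ := by
              have h1 := sum_qh hd w hMpos β hβ0 hβ1
              have h2 : 0 ≤ ∑ τ ∈ univ.filter (fun τ : ZMod p => τ ≠ 0), (qh w τ + β) ^ d :=
                Finset.sum_nonneg fun τ _ => by have := qh_nonneg w τ; positivity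
              gcongr
      refine (Finset.sum_le_sum e3).trans ?_
      rw [Finset.sum_const, Finset.card_powersetCard, Finset.card_univ, ← hM, nsmul_eq_mul]
      have h1 := choose_bound M s hs.1
      have hspos : (0:ℝ) < s := by exact_mod_cast hs.1
      have hMr : (0:ℝ) < M := by exact_mod_cast hMpos
      have h2 : 3 * (M:ℝ) / s * (2 ^ d * (κ * Real.sqrt κ + p * β ^ 3)) ≤ r := by
        rw [hr]
        have a1 : (M:ℝ) / s * (κ * Real.sqrt κ) ≤ M * (κ * Real.sqrt κ) := by
          have : (M:ℝ)/s ≤ M := div_le_self hMr.le (by exact_mod_cast hs.1)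
          gcongr
        have a2 : (M:ℝ) / s * (p * β ^ 3) ≤ 3 * p * Real.sqrt (s0 / M) := by
          have : (M:ℝ)/s * (p * β^3) = 2 * p * β := by
            have : β ^ 3 = β * (2 * s / M) := by rw [← hβ2]; ring
            rw [this]; field_simp
          rw [this]
          have b1 : β ≤ Real.sqrt 2 * Real.sqrt (s0 / M) := by
            rw [← Real.sqrt_mul (by norm_num), hβ]
            apply Real.sqrt_le_sqrt
            rw [mul_div_assoc]
            have : (s:ℝ) ≤ s0 := by exact_mod_cast hs.2
            gcongr
          have b2 : Real.sqrt 2 ≤ 3/2 := by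
            rw [Real.sqrt_le_left (by norm_num)]; norm_num
          have b3 : β ≤ 3/2 * Real.sqrt (s0 / M) := b1.trans (by gcongr)
          nlinarith
        calc 3 * (M:ℝ) / s * (2 ^ d * (κ * Real.sqrt κ + p * β ^ 3))
            = 3 * 2 ^ d * ((M:ℝ) / s * (κ * Real.sqrt κ) + (M:ℝ) / s * (p * β ^ 3)) := by ring
          _ ≤ _ := by gcongr
      calc (M.choose s : ℝ) * (x.factorial * 2 * (2 ^ d * (κ * Real.sqrt κ + p * β ^ 3)) ^ s)
          ≤ (3 * M / s) ^ s * (x.factorial * 2 * (2 ^ d * (κ * Real.sqrt κ + p * β ^ 3)) ^ s) := by gcongr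
        _ = x.factorial * 2 * (3 * M / s * (2 ^ d * (κ * Real.sqrt κ + p * β ^ 3))) ^ s := by
            rw [mul_pow (3 * (M:ℝ) / s)]; ring
        _ ≤ _ := by gcongr
    rw [e1]
    refine (Finset.sum_le_sum e2).trans ?_
    rw [← Finset.mul_sum]
    have := geom_bound r hr0 hr2 s0
    have hf : (0:ℝ) ≤ x.factorial * 2 := by positivity
    nlinarith
  have hB : ∑ t ∈ univ.filter (fun t : V → ZMod p => (∀ c, hist t c ≤ hist t 0) ∧ s0 < (supp t).card), ‖Et w t‖
      ≤ x.factorial * (K * (Real.exp (-s0 / 2) * ((M : ℝ) + 1) ^ p)) := by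
    calc _ ≤ ∑ t ∈ univ.filter (fun t : V → ZMod p => (∀ c, hist t c ≤ hist t 0) ∧ s0 < (supp t).card),
            x.factorial * K * (Real.exp (-s0 / 2) * ∏ k, ((hist t (t k) : ℝ) / M)) := by
          refine Finset.sum_le_sum fun t ht => ?_
          rw [mem_filter] at ht
          have h0 : hist t 0 + (supp t).card = M := by
            unfold hist supp
            rw [Finset.card_filter_add_card_filter_not, Finset.card_univ]
          refine region_B hd w t hMpos s0 ?_
          intro c
          have := ht.2.1 c
          have h2 := ht.2.2
          have : hist t c + s0 ≤ M := by omega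
          have : (hist t c : ℝ) + s0 ≤ M := by exact_mod_cast this
          linarith
      _ ≤ ∑ t : V → ZMod p, x.factorial * K * (Real.exp (-s0 / 2) * ∏ k, ((hist t (t k) : ℝ) / M)) := by
          refine Finset.sum_le_sum_of_subset_of_nonneg (Finset.filter_subset _ _) ?_
          intro t _ _
          have : 0 ≤ ∏ k, ((hist t (t k) : ℝ) / M) := Finset.prod_nonneg fun _ _ => by positivity
          positivity
      _ ≤ _ := by
          rw [← Finset.mul_sum, ← Finset.mul_sum, mul_assoc]
          have := sum_profile (V := V) (β := ZMod p) hMpos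
          rw [ZMod.card] at this
          gcongr
  have hZs : ∑ t ∈ Z, ‖Et w t‖ ≤ x.factorial *
      (1 + 4 * r + K * (Real.exp (-s0 / 2) * ((M : ℝ) + 1) ^ p)) := by
    have hsub : Z ⊆ {fun _ => 0} ∪ univ.filter (fun t : V → ZMod p => 1 ≤ (supp t).card ∧ (supp t).card ≤ s0)
        ∪ univ.filter (fun t : V → ZMod p => (∀ c, hist t c ≤ hist t 0) ∧ s0 < (supp t).card) := by
      intro t ht
      rw [hZ, mem_filter] at ht
      simp only [mem_union, mem_singleton, mem_filter, mem_univ, true_and]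
      rcases Nat.eq_zero_or_pos (supp t).card with h | h
      · left; left
        rw [Finset.card_eq_zero] at h
        funext k
        by_contra hne
        have : k ∈ supp t := by simp [supp, hne]
        simp [h] at this
      · by_cases h2 : (supp t).card ≤ s0
        · left; right; exact ⟨h, h2⟩
        · right; exact ⟨ht.2, by omega⟩
    refine (Finset.sum_le_sum_of_subset_of_nonneg hsub (fun _ _ _ => norm_nonneg _)).trans ?_
    have hun : ∀ A B : Finset (V → ZMod p), ∑ t ∈ A ∪ B, ‖Et w t‖ ≤ ∑ t ∈ A, ‖Et w t‖ + ∑ t ∈ B, ‖Et w t‖ := by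
      intro A B
      rw [← Finset.sum_union_inter]
      have : 0 ≤ ∑ t ∈ A ∩ B, ‖Et w t‖ := Finset.sum_nonneg fun _ _ => norm_nonneg _
      linarith
    have u1 := hun ({fun _ => 0} ∪ univ.filter (fun t : V → ZMod p => 1 ≤ (supp t).card ∧ (supp t).card ≤ s0))
      (univ.filter (fun t : V → ZMod p => (∀ c, hist t c ≤ hist t 0) ∧ s0 < (supp t).card))
    have u2 := hun {fun _ => 0} (univ.filter (fun t : V → ZMod p => 1 ≤ (supp t).card ∧ (supp t).card ≤ s0))
    have u3 : ∑ t ∈ {(fun _ => 0 : V → ZMod p)}, ‖Et w t‖ = x.factorial := by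
      rw [Finset.sum_singleton, Et_zero, Complex.norm_natCast]
    nlinarith
  have hfin : (p:ℝ) ^ M * ((univ.filter (fun g : Equiv.Perm (V × Fin d) => ∀ k, ∑ i, w (g (k, i)) = 0)).card : ℝ)
      ≤ p * (x.factorial * (1 + 4 * r + K * (Real.exp (-s0 / 2) * ((M : ℝ) + 1) ^ p))) := by
    have h1 := congrArg norm (count_eq w)
    rw [norm_mul, norm_pow, Complex.norm_natCast, Complex.norm_natCast] at h1
    rw [h1]
    refine (norm_sum_le _ _).trans ((sum_shift w hw).trans ?_)
    gcongr
  have hpM : (0:ℝ) < (p:ℝ) ^ M := by positivity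
  rw [← le_div_iff₀' hpM] at hfin
  refine hfin.trans (le_of_eq ?_)
  ring

end

/-- all matchings -/
def MM (H : Type*) [Fintype H] [DecidableEq H] : Finset (Equiv.Perm H) := univ.filter IsM

theorem sum_conj {H R : Type*} [Fintype H] [DecidableEq H] [AddCommMonoid R]
    (f : Equiv.Perm H → R) (g : Equiv.Perm H) :
    ∑ σ ∈ MM H, f (g * σ * g⁻¹) = ∑ σ ∈ MM H, f σ := by
  refine Finset.sum_bij (fun σ _ => g * σ * g⁻¹) ?_ ?_ ?_ ?_
  · intro σ hσ
    simp only [MM, mem_filter, mem_univ, true_and] at hσ ⊢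
    have := hσ.conj g⁻¹
    simpa using this
  · intro a _ b _ h
    simpa using h
  · intro σ hσ
    refine ⟨g⁻¹ * σ * g, ?_, by simp [mul_assoc]⟩
    simp only [MM, mem_filter, mem_univ, true_and] at hσ ⊢
    exact hσ.conj g
  · intro _ _; rfl

theorem sum_conj_avg {H R ι : Type*} [Fintype H] [DecidableEq H] [CommSemiring R] [Fintype ι]
    (γ : ι → Equiv.Perm H) (f : Equiv.Perm H → R) :
    (Fintype.card ι : R) * ∑ σ ∈ MM H, f σ = ∑ σ ∈ MM H, ∑ i, f (γ i * σ * (γ i)⁻¹) := by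
  rw [Finset.sum_comm]
  simp only [sum_conj]
  simp

section
variable {p : ℕ} [Fact p.Prime]

theorem root_far (ζ : ZMod p) (hζ : ζ ≠ 0) : 1 / (p:ℝ) ≤ ‖(ZMod.stdAddChar ζ : ℂ) - 1‖ := by
  have hp : (0:ℝ) < p := by exact_mod_cast (Fact.out : p.Prime).pos
  set e := (ZMod.stdAddChar ζ : ℂ) with he
  have hk : ∀ k : ℕ, ‖e ^ k - 1‖ ≤ k * ‖e - 1‖ := by
    intro k
    induction k with
    | zero => simp
    | succ k ih =>
      have h1 : e ^ (k+1) - 1 = e ^ k * (e - 1) + (e ^ k - 1) := by ring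
      rw [h1]
      refine (norm_add_le _ _).trans ?_
      have h2 : ‖e‖ = 1 := AddChar.norm_apply _ _
      rw [norm_mul, norm_pow, h2, one_pow]
      push_cast
      linarith
  have hne : e ≠ 1 := by
    intro h
    have := ZMod.injective_stdAddChar (N := p) (a₁ := ζ) (a₂ := 0) (by rw [← he, h]; simp)
    exact hζ this
  have hpow : e ^ p = 1 := by
    rw [he, ← AddChar.map_nsmul_eq_pow]; simp
  have hsum : ∑ k ∈ range p, e ^ k = 0 := by
    rw [geom_sum_eq hne, hpow]; simp
  have h3 : ∑ k ∈ range p, (e ^ k - 1) = -(p:ℂ) := by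
    rw [Finset.sum_sub_distrib, hsum]; simp
  have h4 : (p:ℝ) ≤ p * (p * ‖e - 1‖) := by
    have : (p:ℝ) = ‖∑ k ∈ range p, (e ^ k - 1)‖ := by rw [h3]; simp
    calc (p:ℝ) = _ := this
      _ ≤ ∑ k ∈ range p, ‖e ^ k - 1‖ := norm_sum_le _ _
      _ ≤ ∑ k ∈ range p, (p:ℝ) * ‖e - 1‖ := by
          refine Finset.sum_le_sum fun k hk' => (hk k).trans ?_
          have : (k:ℝ) ≤ p := by exact_mod_cast (Finset.mem_range.mp hk').le
          gcongr
      _ = _ := by simp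
  rw [div_le_iff₀ hp]
  have : (p:ℝ) * 1 ≤ p * (p * ‖e-1‖) := by linarith
  have := le_of_mul_le_mul_left this hp
  linarith

theorem unit_gap (α β : ℂ) (hα : ‖α‖ = 1) (hβ : ‖β‖ = 1) (η : ℝ) (hη0 : 0 ≤ η) (hη : η ≤ ‖α * β - 1‖) :
    ‖α + β + 2‖ ≤ 4 - η ^ 2 / 16 := by
  have one : ∀ α : ℂ, ‖α‖ = 1 → ‖α + 1‖ ≤ 2 - ‖α - 1‖ ^ 2 / 4 := by
    intro α hα
    have h1 : ‖α + 1‖ ^ 2 + ‖α - 1‖ ^ 2 = 4 := by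
      have := parallelogram_law_with_norm ℝ α 1
      rw [hα] at this
      simp at this
      nlinarith
    have h2 : ‖α - 1‖ ^ 2 ≤ 4 := by nlinarith [sq_nonneg ‖α + 1‖]
    apply le_of_sq_le_sq _ (by linarith)
    nlinarith [sq_nonneg (‖α - 1‖ ^ 2)]
  have h1 := one α hα
  have h2 := one β hβ
  have h3 : η ≤ ‖α - 1‖ + ‖β - 1‖ := by
    refine hη.trans ?_
    have : α * β - 1 = (α - 1) + α * (β - 1) := by ring
    rw [this]
    refine (norm_add_le _ _).trans ?_
    rw [norm_mul, hα, one_mul]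
  have h4 : ‖α + β + 2‖ ≤ ‖α + 1‖ + ‖β + 1‖ := by
    have : α + β + 2 = (α + 1) + (β + 1) := by ring
    rw [this]; exact norm_add_le _ _
  have h5 : η ^ 2 / 4 ≤ ‖α - 1‖ ^ 2 + ‖β - 1‖ ^ 2 := by
    nlinarith [sq_nonneg (‖α - 1‖ - ‖β - 1‖), norm_nonneg (α - 1), norm_nonneg (β - 1)]
  linarith

theorem quad_gap (hp2 : p ≠ 2) (f : ZMod p → ZMod p) (hf : ¬ ∀ a, f a = f 0) (z : ZMod p → ℂ) (hz : ∀ b, ‖z b‖ = 1) :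
    ‖∑ a, ∑ b, (z a * ZMod.stdAddChar (f a * b)) * (z b * ZMod.stdAddChar (f b * a))‖
      ≤ (p:ℝ) ^ 2 - 1 / (16 * (p:ℝ) ^ 2) := by
  have hp : (0:ℝ) < p := by exact_mod_cast (Fact.out : p.Prime).pos
  push Not at hf
  obtain ⟨a, ha⟩ := hf
  have hane : a ≠ 0 := by rintro rfl; exact ha rfl
  set X : ZMod p × ZMod p → ℂ := fun q => (z q.1 * ZMod.stdAddChar (f q.1 * q.2)) * (z q.2 * ZMod.stdAddChar (f q.2 * q.1)) with hX
  have hX1 : ∀ q, ‖X q‖ = 1 := by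
    intro q; simp [hX, hz]
  rw [← Fintype.sum_prod_type' (f := fun a b => (z a * ZMod.stdAddChar (f a * b)) * (z b * ZMod.stdAddChar (f b * a)))]
  change ‖∑ q, X q‖ ≤ _
  set Q : Finset (ZMod p × ZMod p) := {(a,a), (0,0), (a,0), (0,a)} with hQ
  have hQc : Q.card = 4 := by
    rw [hQ, card_insert_of_notMem, card_insert_of_notMem, card_insert_of_notMem, card_singleton]
    · simp [hane]
    · simp [hane.symm]
    · simp [hane]
  have hQs : ∑ q ∈ Q, X q = X (a,a) + X (0,0) + 2 * X (a,0) := by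
    rw [hQ, sum_insert, sum_insert, sum_insert, sum_singleton]
    · have : X (0,a) = X (a,0) := by simp only [hX]; ring
      rw [this]; ring
    · simp [hane]
    · simp [hane.symm]
    · simp [hane]
  have hC : X (a,0) ≠ 0 := by
    intro h; have := hX1 (a,0); rw [h] at this; simp at this
  have hgap : ‖X (a,a) + X (0,0) + 2 * X (a,0)‖ ≤ 4 - (1/(p:ℝ)) ^ 2 / 16 := by
    have e1 : X (a,a) + X (0,0) + 2 * X (a,0) = X (a,0) * (X (a,a) / X (a,0) + X (0,0) / X (a,0) + 2) := by
      field_simp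
    rw [e1, norm_mul, hX1, one_mul]
    apply unit_gap
    · rw [norm_div, hX1, hX1]; simp
    · rw [norm_div, hX1, hX1]; simp
    · positivity
    · have e2 : X (a,a) / X (a,0) * (X (0,0) / X (a,0)) = ZMod.stdAddChar (2 * (f a - f 0) * a) := by
        rw [div_mul_div_comm, div_eq_iff (mul_ne_zero hC hC)]
        simp only [hX, mul_zero, AddChar.map_zero_eq_one, mul_one]
        have : (ZMod.stdAddChar (f a * a) : ℂ) = ZMod.stdAddChar ((f a - f 0) * a) * ZMod.stdAddChar (f 0 * a) := by
          rw [← AddChar.map_add_eq_mul]; congr 1; ring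
        have h2 : (ZMod.stdAddChar (2 * (f a - f 0) * a) : ℂ) = ZMod.stdAddChar ((f a - f 0) * a) * ZMod.stdAddChar ((f a - f 0) * a) := by
          rw [← AddChar.map_add_eq_mul]; congr 1; ring
        rw [this, h2]; ring
      rw [e2]
      apply root_far
      have h2 : (2 : ZMod p) ≠ 0 := by
        intro h
        have : ((2:ℕ) : ZMod p) = 0 := by exact_mod_cast h
        rw [ZMod.natCast_eq_zero_iff] at this
        exact hp2 ((Nat.prime_dvd_prime_iff_eq Fact.out Nat.prime_two).mp this)
      exact mul_ne_zero (mul_ne_zero h2 (sub_ne_zero.mpr ha)) hane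
  rw [← Finset.sum_compl_add_sum Q]
  refine (norm_add_le _ _).trans ?_
  rw [hQs]
  have h5 : ‖∑ q ∈ Qᶜ, X q‖ ≤ (p:ℝ)^2 - 4 := by
    refine (norm_sum_le _ _).trans ?_
    simp only [hX1, sum_const, nsmul_eq_mul, mul_one]
    rw [Finset.card_compl, hQc, Fintype.card_prod, ZMod.card]
    have h4 : 4 ≤ p * p := by
      have := (Fact.out : p.Prime).two_le
      nlinarith
    rw [Nat.cast_sub h4]
    push_cast
    apply le_of_eq; ring
  have e3 : (1/(p:ℝ)) ^ 2 / 16 = 1 / (16 * (p:ℝ)^2) := by field_simp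
  linarith

set_option maxHeartbeats 1000000 in
theorem D_count {H : Type*} [Fintype H] [DecidableEq H] (hH : Even (Fintype.card H)) (hp2 : p ≠ 2) (c : H → ZMod p) :
    (p:ℝ) ^ p * ((MM H).filter (fun σ => ∀ a, ∑ h ∈ univ.filter (fun h => c h = a), c (σ h) = 0)).card
      ≤ p * (MM H).card * (if ∑ h, c h = 0 then 1 else 0) +
       (p:ℝ) ^ p * ((MM H).card * ((Real.exp 1 * (Fintype.card H + 1)) ^ p *
        Real.exp (Fintype.card H * kap (hist c) (Fintype.card H)) *
          Real.exp (-(Fintype.card H : ℝ) / (32 * (p:ℝ) ^ 4)))) := by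
  have hp : (0:ℝ) < p := by exact_mod_cast (Fact.out : p.Prime).pos
  set m := Fintype.card H with hm
  set K := ((Real.exp 1 * ((m:ℝ) + 1)) ^ p *
        Real.exp (m * kap (hist c) m)) with hK
  obtain ⟨Ft, hFt⟩ : ∃ Ft : (ZMod p → ZMod p) → ℂ, ∀ f, Ft f = ∑ σ ∈ MM H, ∏ h, ZMod.stdAddChar (f (c h) * c (σ h)) :=
    ⟨_, fun _ => rfl⟩
  have hcount : (p:ℂ) ^ p * (((MM H).filter (fun σ => ∀ a, ∑ h ∈ univ.filter (fun h => c h = a), c (σ h) = 0)).card : ℂ)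
      = ∑ f, Ft f := by
    simp only [hFt]
    rw [Finset.sum_comm, Finset.card_filter, Nat.cast_sum, Finset.mul_sum]
    refine Finset.sum_congr rfl fun σ _ => ?_
    have h1 : ∀ f : ZMod p → ZMod p, ∏ h, (ZMod.stdAddChar (f (c h) * c (σ h)) : ℂ)
        = ∏ a, ZMod.stdAddChar (f a * ∑ h ∈ univ.filter (fun h => c h = a), c (σ h)) := by
      intro f
      rw [← Finset.prod_fiberwise univ c]
      refine Finset.prod_congr rfl fun a _ => ?_
      rw [Finset.mul_sum, addChar_sum]
      refine Finset.prod_congr rfl fun h hh => ?_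
      rw [(Finset.mem_filter.mp hh).2]
    simp only [h1]
    rw [← Fintype.prod_sum (fun a (τ : ZMod p) => (ZMod.stdAddChar (τ * ∑ h ∈ univ.filter (fun h => c h = a), c (σ h)) : ℂ))]
    simp only [AddChar.sum_mulShift _ (ZMod.isPrimitive_stdAddChar p), ZMod.card]
    split_ifs with h
    · simp [h, ZMod.card]
    · push Not at h
      obtain ⟨k, hk⟩ := h
      rw [Finset.prod_eq_zero (mem_univ k)] <;> simp [hk]
  have hconst : ‖∑ f ∈ univ.filter (fun f : ZMod p → ZMod p => ∀ a, f a = f 0), Ft f‖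
      ≤ p * (MM H).card * (if ∑ h, c h = 0 then 1 else 0) := by
    have e1 : ∑ f ∈ univ.filter (fun f : ZMod p → ZMod p => ∀ a, f a = f 0), Ft f
        = ∑ β : ZMod p, Ft (fun _ => β) := by
      refine Finset.sum_bij' (fun f _ => f 0) (fun β _ => fun _ => β) ?_ ?_ ?_ ?_ ?_
      · intros; exact mem_univ _
      · intros; simp
      · intro f hf; funext a; exact ((mem_filter.mp hf).2 a).symm
      · intros; rfl
      · intro f hf
        have hff : f = fun _ => f 0 := funext (mem_filter.mp hf).2
        exact congrArg Ft hff
    have e2 : ∀ β : ZMod p, Ft (fun _ => β) = (MM H).card * ZMod.stdAddChar (β * ∑ h, c h) := by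
      intro β
      simp only [hFt]
      have : ∀ σ ∈ MM H, ∏ h, (ZMod.stdAddChar (β * c (σ h)) : ℂ) = ZMod.stdAddChar (β * ∑ h, c h) := by
        intro σ _
        rw [← addChar_sum, ← Finset.mul_sum, Equiv.sum_comp σ c]
      rw [Finset.sum_congr rfl this]; simp
    rw [e1]
    simp only [e2]
    rw [← Finset.mul_sum, AddChar.sum_mulShift _ (ZMod.isPrimitive_stdAddChar p), ZMod.card]
    split_ifs
    · simp [mul_comm]
    · simp
  have hnon : ∀ f ∈ univ.filter (fun f : ZMod p → ZMod p => ¬ ∀ a, f a = f 0),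
      ‖Ft f‖ ≤ (MM H).card * (K * Real.exp (-(m : ℝ) / (32 * (p:ℝ) ^ 4))) := by
    intro f hf
    have hf' := (mem_filter.mp hf).2
    have avg := sum_conj_avg (H := H) (fun g : Equiv.Perm H => g) (fun σ => ∏ h, (ZMod.stdAddChar (f (c h) * c (σ h)) : ℂ))
    have e1 : ∀ σ g : Equiv.Perm H, ∏ h, (ZMod.stdAddChar (f (c h) * c ((g * σ * g⁻¹) h)) : ℂ)
        = ∏ h, ZMod.stdAddChar (f ((c ∘ g) h) * (c ∘ g) (σ h)) := by
      intro σ g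
      rw [← Equiv.prod_comp g]
      simp
    simp only [e1] at avg
    have e2 : ∀ σ ∈ MM H, ‖∑ g : Equiv.Perm H, ∏ h, (ZMod.stdAddChar (f ((c ∘ g) h) * (c ∘ g) (σ h)) : ℂ)‖
        ≤ m.factorial * K * Real.exp (-(m : ℝ) / (32 * (p:ℝ) ^ 4)) := by
      intro σ hσ
      have hσ' : IsM σ := (mem_filter.mp hσ).2
      have tr := transfer c (fun u => ∏ h, (ZMod.stdAddChar (f (u h) * u (σ h)) : ℂ))
        (((p:ℝ) ^ 2 - 1 / (16 * (p:ℝ) ^ 2)) ^ (m / 2)) ?_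
      · refine tr.trans ?_
        rw [ZMod.card, ← hm, ← hK]
        refine mul_le_mul_of_nonneg_left ?_ (by positivity)
        obtain ⟨j, hj⟩ := hH
        have hj2 : m / 2 = j := by omega
        have hj3 : (p:ℝ) ^ m = ((p:ℝ)^2) ^ j := by rw [← pow_mul, hj]; congr 1; ring
        rw [hj2, hj3, ← div_pow]
        have hmj : (m:ℝ) = 2 * j := by rw [hj]; push_cast; ring
        have b1 : ((p:ℝ) ^ 2 - 1 / (16 * (p:ℝ) ^ 2)) / (p:ℝ)^2 ≤ Real.exp (-(1 / (16 * (p:ℝ)^4))) := by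
          refine le_trans (le_of_eq ?_) (Real.add_one_le_exp _)
          field_simp; ring
        have b0 : 0 ≤ ((p:ℝ) ^ 2 - 1 / (16 * (p:ℝ) ^ 2)) / (p:ℝ)^2 := by
          have h1 : (1:ℝ) ≤ (p:ℝ)^2 := by
            have : (1:ℝ) ≤ p := by exact_mod_cast (Fact.out : p.Prime).one_le
            nlinarith
          have h2 : 1 / (16 * (p:ℝ) ^ 2) ≤ 1 := by
            rw [div_le_one (by positivity)]; linarith
          have : 0 ≤ (p:ℝ) ^ 2 - 1 / (16 * (p:ℝ) ^ 2) := by linarith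
          positivity
        refine (pow_le_pow_left₀ b0 b1 j).trans (le_of_eq ?_)
        rw [← Real.exp_nat_mul, hmj]
        congr 1
        field_simp; ring
      · intro z hz
        simp only [← Finset.prod_mul_distrib]
        have := edge_lemma σ hσ' (fun a b => (ZMod.stdAddChar (f a * b) : ℂ) * z a)
        rw [this, norm_pow]
        have hq := quad_gap hp2 f hf' z hz
        refine pow_le_pow_left₀ (norm_nonneg _) ?_ _
        refine le_trans (le_of_eq ?_) hq
        congr 1
        refine Finset.sum_congr rfl fun a _ => Finset.sum_congr rfl fun b _ => ?_
        ring
    have hfac : (0:ℝ) < m.factorial := by positivity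
    have e3 : (m.factorial : ℝ) * ‖Ft f‖ ≤ m.factorial * ((MM H).card * (K * Real.exp (-(m : ℝ) / (32 * (p:ℝ) ^ 4)))) := by
      have h1 := congrArg norm avg
      rw [norm_mul, Complex.norm_natCast, Fintype.card_perm, ← hm] at h1
      rw [← hFt] at h1
      rw [h1]
      refine (norm_sum_le _ _).trans ((Finset.sum_le_sum e2).trans (le_of_eq ?_))
      rw [Finset.sum_const, nsmul_eq_mul]; ring
    exact le_of_mul_le_mul_left e3 hfac
  have h1 := congrArg norm hcount
  rw [norm_mul, norm_pow, Complex.norm_natCast, Complex.norm_natCast] at h1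
  rw [h1, ← Finset.sum_filter_add_sum_filter_not univ (fun f : ZMod p → ZMod p => ∀ a, f a = f 0)]
  refine (norm_add_le _ _).trans (add_le_add hconst ?_)
  refine (norm_sum_le _ _).trans ((Finset.sum_le_sum hnon).trans ?_)
  rw [Finset.sum_const, nsmul_eq_mul]
  gcongr
  refine le_trans (Nat.cast_le.mpr (Finset.card_le_univ _)) ?_
  simp [ZMod.card]

end

section
variable {n d : ℕ} {α : Type*} [Fintype α] [DecidableEq α]

/-- splitting the half-edges into classes -/
def clsE (v : Fin n → α) : (Σ a : α, ({k : Fin n // v k = a} × Fin d)) ≃ Fin n × Fin d where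
  toFun q := (q.2.1.1, q.2.2)
  invFun h := ⟨v h.1, (⟨h.1, rfl⟩, h.2)⟩
  left_inv := by rintro ⟨a, ⟨k, rfl⟩, i⟩; rfl
  right_inv := by rintro ⟨k, i⟩; rfl

def clsG (v : Fin n → α) (g : ∀ a : α, Equiv.Perm ({k : Fin n // v k = a} × Fin d)) :
    Equiv.Perm (Fin n × Fin d) :=
  (clsE v).permCongr (Equiv.sigmaCongrRight g)

theorem clsG_apply (v : Fin n → α) (g : ∀ a : α, Equiv.Perm ({k : Fin n // v k = a} × Fin d))
    (a : α) (q : {k : Fin n // v k = a} × Fin d) :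
    clsG v g (q.1.1, q.2) = ((g a q).1.1, (g a q).2) := by
  have : ((q.1.1, q.2) : Fin n × Fin d) = clsE v ⟨a, q⟩ := rfl
  rw [this]
  simp [clsG, Equiv.permCongr_apply]
  rfl

theorem clsG_v (v : Fin n → α) (g : ∀ a : α, Equiv.Perm ({k : Fin n // v k = a} × Fin d))
    (h : Fin n × Fin d) : v (clsG v g h).1 = v h.1 := by
  have := clsG_apply v g (v h.1) (⟨h.1, rfl⟩, h.2)
  simp only [Prod.mk.eta] at this
  rw [this]
  exact (g (v h.1) (⟨h.1, rfl⟩, h.2)).1.2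
end

section
variable {n d p : ℕ} [Fact p.Prime]

theorem class_avg (v : Fin n → ZMod p) (Q : Equiv.Perm (Fin n × Fin d) → Prop)
    (hQ : ∀ σ γ : Equiv.Perm (Fin n × Fin d), (∀ h, v (γ h).1 = v h.1) → Q σ → Q (γ * σ * γ⁻¹))
    (C : ℝ) (hC0 : 0 ≤ C)
    (hC : ∀ σ ∈ MM (Fin n × Fin d), Q σ →
      (∀ a, ∑ h ∈ univ.filter (fun h : Fin n × Fin d => v h.1 = a), v (σ h).1 = 0) →
      ∏ a, (((univ.filter (fun g : Equiv.Perm ({k : Fin n // v k = a} × Fin d) =>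
        ∀ k, ∑ i, v (σ ((g (k, i)).1.1, (g (k, i)).2)).1 = 0)).card : ℝ) /
          (Fintype.card ({k : Fin n // v k = a} × Fin d)).factorial) ≤ C) [DecidablePred Q] :
    (((MM (Fin n × Fin d)).filter (fun σ => Q σ ∧ ∀ k, ∑ i, v (σ (k, i)).1 = 0)).card : ℝ) ≤
      C * ((MM (Fin n × Fin d)).filter (fun σ =>
        ∀ a, ∑ h ∈ univ.filter (fun h : Fin n × Fin d => v h.1 = a), v (σ h).1 = 0)).card := by
  let I := ∀ a : ZMod p, Equiv.Perm ({k : Fin n // v k = a} × Fin d)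
  have hγi : ∀ (γ : Equiv.Perm (Fin n × Fin d)), (∀ h, v (γ h).1 = v h.1) → ∀ h, v (γ⁻¹ h).1 = v h.1 := by
    intro γ hγ h
    have := hγ (γ⁻¹ h)
    simp at this
    exact this.symm
  -- the condition after conjugation
  let P : Equiv.Perm (Fin n × Fin d) → Prop := fun σ => Q σ ∧ ∀ k, ∑ i, v (σ (k, i)).1 = 0
  let D : Equiv.Perm (Fin n × Fin d) → Prop := fun σ =>
    ∀ a, ∑ h ∈ univ.filter (fun h : Fin n × Fin d => v h.1 = a), v (σ h).1 = 0
  have avg := sum_conj_avg (R := ℝ) (H := Fin n × Fin d) (fun g : I => (clsG v g)⁻¹)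
    (fun σ => if P σ then 1 else 0)
  have hI : (Fintype.card I : ℝ) = ∏ a, ((Fintype.card ({k : Fin n // v k = a} × Fin d)).factorial : ℝ) := by
    simp only [I, Fintype.card_pi, Fintype.card_perm]; push_cast; rfl
  have hIpos : 0 < (Fintype.card I : ℝ) := by rw [hI]; exact Finset.prod_pos fun _ _ => by positivity
  -- D from rows
  have hPD : ∀ σ, (∀ k, ∑ i, v (σ (k, i)).1 = 0) → D σ := by
    intro σ h a
    rw [Finset.sum_filter, Fintype.sum_prod_type]
    refine Finset.sum_eq_zero fun k _ => ?_
    by_cases hk : v k = a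
    · simp [hk, h k]
    · simp [hk]
  have hDinv : ∀ σ γ, (∀ h, v (γ h).1 = v h.1) → D (γ * σ * γ⁻¹) → D σ := by
    intro σ γ hγ h a
    rw [← h a]
    refine Finset.sum_bij (fun x _ => γ x) ?_ ?_ ?_ ?_
    · intro x hx; simpa [hγ] using hx
    · intro x _ y _ hxy; exact γ.injective hxy
    · intro y hy
      refine ⟨γ⁻¹ y, ?_, by simp⟩
      rw [mem_filter, hγi γ hγ]; exact ⟨mem_univ _, (mem_filter.mp hy).2⟩
    · intro x _; simp [hγ]
  have hrow : ∀ (σ : Equiv.Perm (Fin n × Fin d)) (g : I),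
      (∀ k, ∑ i, v (((clsG v g)⁻¹ * σ * ((clsG v g)⁻¹)⁻¹) (k, i)).1 = 0) ↔
      ∀ a, ∀ k : {k : Fin n // v k = a}, ∑ i, v (σ ((g a (k, i)).1.1, (g a (k, i)).2)).1 = 0 := by
    intro σ g
    have e : ∀ (k : Fin n) (i : Fin d), v (((clsG v g)⁻¹ * σ * ((clsG v g)⁻¹)⁻¹) (k, i)).1
        = v (σ ((g (v k) (⟨k, rfl⟩, i)).1.1, (g (v k) (⟨k, rfl⟩, i)).2)).1 := by
      intro k i
      rw [inv_inv, Equiv.Perm.mul_apply, Equiv.Perm.mul_apply, hγi _ (clsG_v v g)]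
      have := clsG_apply v g (v k) (⟨k, rfl⟩, i)
      simp only at this
      rw [this]
    simp only [e]
    constructor
    · rintro h a ⟨k, rfl⟩
      exact h k
    · intro h k
      exact h (v k) ⟨k, rfl⟩
  have hb : ∀ σ ∈ MM (Fin n × Fin d), (∑ g : I, if P ((clsG v g)⁻¹ * σ * ((clsG v g)⁻¹)⁻¹) then (1:ℝ) else 0)
      ≤ if D σ then (Fintype.card I : ℝ) * C else 0 := by
    intro σ hσ
    by_cases hex : ∃ g : I, P ((clsG v g)⁻¹ * σ * ((clsG v g)⁻¹)⁻¹)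
    · obtain ⟨g, hg⟩ := hex
      have hDσ : D σ := hDinv σ (clsG v g)⁻¹ (hγi _ (clsG_v v g)) (hPD _ hg.2)
      have hQσ : Q σ := by
        have := hQ _ (clsG v g) (clsG_v v g) hg.1
        simpa [mul_assoc] using this
      rw [if_pos hDσ]
      have h1 := hC σ hσ hQσ hDσ
      rw [Finset.prod_div_distrib, ← hI, div_le_iff₀ hIpos] at h1
      refine le_trans ?_ (h1.trans (le_of_eq (mul_comm _ _)))
      rw [← Nat.cast_prod]
      rw [← Fintype.card_piFinset, Finset.sum_boole]
      refine Nat.cast_le.mpr (Finset.card_le_card ?_)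
      intro g hg
      rw [mem_filter] at hg
      rw [Fintype.mem_piFinset]
      intro a
      rw [mem_filter]
      exact ⟨mem_univ _, (hrow σ g).mp hg.2.2 a⟩
    · push Not at hex
      simp only [hex, if_false, Finset.sum_const_zero]
      split_ifs with hD
      · positivity
      · exact le_rfl
  have hfin : (Fintype.card I : ℝ) * (∑ σ ∈ MM (Fin n × Fin d), if P σ then (1:ℝ) else 0) ≤
      (Fintype.card I : ℝ) * (C * ((MM (Fin n × Fin d)).filter D).card) := by
    rw [avg]
    refine (Finset.sum_le_sum hb).trans (le_of_eq ?_)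
    rw [← Finset.sum_filter, Finset.sum_const, nsmul_eq_mul]; ring
  have := le_of_mul_le_mul_left hfin hIpos
  rw [Finset.sum_boole] at this
  exact this
end

theorem match_count {H α : Type*} [Fintype H] [DecidableEq H] [Fintype α] [DecidableEq α]
    (u w : H → α) (φ : α → α → ℝ) (hφ : ∀ a b, 0 ≤ φ a b) :
    (((MM H).filter (fun σ => ∀ h, u (σ h) = w h)).card : ℝ) * (Fintype.card H).factorial *
      ∏ h, φ (u h) (w h) ≤
    (MM H).card * (∏ b : α × α, (hist (fun h => (u h, w h)) b).factorial : ℕ) *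
      (∑ a, ∑ b, φ a b * φ b a) ^ (Fintype.card H / 2) := by
  classical
  set c : H → α × α := fun h => (u h, w h) with hc
  set f : Equiv.Perm H → ℝ := fun σ => if ∀ h, u (σ h) = w h then 1 else 0 with hf
  have h0 : (((MM H).filter (fun σ => ∀ h, u (σ h) = w h)).card : ℝ) = ∑ σ ∈ MM H, f σ := by
    simp [hf, Finset.sum_ite]
  have h1 := sum_conj_avg (fun g : Equiv.Perm H => g) f
  rw [Fintype.card_perm] at h1
  rw [h0, mul_comm (∑ σ ∈ MM H, f σ) _, h1, Finset.sum_mul]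
  rw [mul_assoc, ← nsmul_eq_mul]
  refine Finset.sum_le_card_nsmul _ _ _ ?_
  intro σ hσ
  have hσ' : IsM σ := by simpa [MM] using hσ
  set G : (H → α × α) → ℝ := fun e =>
    (if ∀ h, (e (σ h)).1 = (e h).2 then 1 else 0) * ∏ h, φ (e h).1 (e h).2 with hG
  have hG0 : ∀ e, 0 ≤ G e := by
    intro e
    refine mul_nonneg (by split_ifs <;> norm_num) (Finset.prod_nonneg fun h _ => hφ _ _)
  have h2 : (∑ g : Equiv.Perm H, f (g * σ * g⁻¹)) * ∏ h, φ (u h) (w h) = ∑ g : Equiv.Perm H, G (c ∘ g) := by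
    rw [Finset.sum_mul]
    refine Finset.sum_congr rfl fun g _ => ?_
    simp only [hf, hG, hc, Function.comp]
    congr 1
    · congr 1
      apply propext
      constructor
      · intro h x
        have := h (g x)
        simpa using this
      · intro h x
        have := h (g⁻¹ x)
        simpa using this
    · exact (Equiv.prod_comp g (fun h => φ (u h) (w h))).symm
  rw [h2]
  refine (sum_perm_comp_le c G hG0).trans (le_of_eq ?_)
  congr 1
  rw [← edge_lemma σ hσ' φ]
  symm
  refine Finset.sum_of_injOn (fun (u' : H → α) => (fun h => (u' h, u' (σ h)))) ?_ ?_ ?_ ?_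
  · intro a _ b _ hab
    funext h
    exact congrArg Prod.fst (congrFun hab h)
  · simp
  · intro e _ he
    simp only [hG]
    rw [if_neg, zero_mul]
    intro hh
    apply he
    refine ⟨fun h => (e h).1, by simp, ?_⟩
    funext h
    exact Prod.ext rfl (hh h)
  · intro u' _
    simp [hG]

section
variable {V α : Type*} [Fintype V] [DecidableEq V] [Fintype α] [DecidableEq α] {d : ℕ}

def lab (v : V → α) (σ : Equiv.Perm (V × Fin d)) (h : V × Fin d) : α × α := (v h.1, v (σ h).1)

theorem row_count (C : α → (Fin d → α) → Prop) [∀ a z, Decidable (C a z)] (x : α → α → ℝ)  :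
    ∑ v : V → α, ∑ w : V × Fin d → α, (if ∀ k, C (v k) (fun i => w (k,i)) then ∏ h, x (v h.1) (w h) else 0) =
    (∑ a, ∑ z : Fin d → α, if C a z then ∏ i, x a (z i) else 0) ^ (Fintype.card V) := by
  have e1 : ∀ (v : V → α), ∑ w : V × Fin d → α, (if ∀ k, C (v k) (fun i => w (k,i)) then ∏ h, x (v h.1) (w h) else 0)
     = ∑ w : V → Fin d → α, ∏ k, (if C (v k) (w k) then ∏ i, x (v k) (w k i) else 0) := by
    intro v
    rw [← Equiv.sum_comp (Equiv.curry V (Fin d) α).symm]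
    refine Finset.sum_congr rfl fun w _ => ?_
    rw [Finset.prod_ite_zero]
    simp [Function.uncurry, Fintype.prod_prod_type]
  simp only [e1]
  have e2 : ∀ (v : V → α), ∑ w : V → Fin d → α, ∏ k, (if C (v k) (w k) then ∏ i, x (v k) (w k i) else 0)
    = ∏ k, ∑ z : Fin d → α, (if C (v k) z then ∏ i, x (v k) (z i) else 0) := by
    intro v
    rw [Finset.prod_univ_sum]
    simp
  simp only [e2]
  rw [← Finset.card_univ, ← Finset.prod_const, Finset.prod_univ_sum]
  simp

theorem lemmaG (C : α → (Fin d → α) → Prop) [∀ a z, Decidable (C a z)] (x φ : α → α → ℝ)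
    (hx : ∀ a b, 0 ≤ x a b) (hφ : ∀ a b, 0 ≤ φ a b) (N : α × α → ℕ) :
    (∑ v : V → α, (((MM (V × Fin d)).filter (fun σ => (∀ k, C (v k) (fun i => v (σ (k,i)).1)) ∧
        hist (lab v σ) = N)).card : ℝ)) * (Fintype.card (V × Fin d)).factorial *
      ∏ b : α × α, (φ b.1 b.2 * x b.1 b.2) ^ N b ≤
    (MM (V × Fin d)).card * (∏ b : α × α, (N b).factorial : ℕ) *
      (∑ a, ∑ b, φ a b * φ b a) ^ (Fintype.card (V × Fin d) / 2) *
      (∑ a, ∑ z : Fin d → α, if C a z then ∏ i, x a (z i) else 0) ^ (Fintype.card V) := by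
  classical
  set K : ℝ := (MM (V × Fin d)).card * (∏ b : α × α, (N b).factorial : ℕ) *
      (∑ a, ∑ b, φ a b * φ b a) ^ (Fintype.card (V × Fin d) / 2) with hK
  have hK0 : 0 ≤ K := by
    refine mul_nonneg (mul_nonneg (by positivity) (by positivity)) (pow_nonneg ?_ _)
    exact Finset.sum_nonneg fun a _ => Finset.sum_nonneg fun b _ => mul_nonneg (hφ _ _) (hφ _ _)
  rw [← row_count, Finset.sum_mul, Finset.sum_mul, Finset.mul_sum]
  refine Finset.sum_le_sum fun v _ => ?_
  have e1 : (((MM (V × Fin d)).filter (fun σ => (∀ k, C (v k) (fun i => v (σ (k,i)).1)) ∧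
        hist (lab v σ) = N)).card : ℝ) = ∑ w : V × Fin d → α,
        if (∀ k, C (v k) (fun i => w (k,i))) ∧ hist (fun h => (v h.1, w h)) = N then
        (((MM (V × Fin d)).filter (fun σ => ∀ h, (v (σ h).1) = w h)).card : ℝ) else 0 := by
    rw [Finset.card_eq_sum_card_fiberwise (f := fun σ => fun h => v (σ h).1) (t := univ) (by intro; simp)]
    push_cast
    refine Finset.sum_congr rfl fun w _ => ?_
    split_ifs with hw
    · congr 2
      ext σ
      simp only [mem_filter]
      constructor
      · rintro ⟨⟨h1, h2⟩, h3⟩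
        exact ⟨h1, fun h => congrFun h3 h⟩
      · rintro ⟨h1, h2⟩
        have h3 : (fun h => v (σ h).1) = w := funext h2
        refine ⟨⟨h1, ?_⟩, h3⟩
        subst h3
        exact hw
    · rw [Nat.cast_eq_zero, Finset.card_eq_zero, Finset.filter_eq_empty_iff]
      intro σ hσ h3
      apply hw
      simp only [mem_filter] at hσ
      subst h3
      exact hσ.2
  rw [e1, Finset.sum_mul, Finset.sum_mul, Finset.mul_sum]
  refine Finset.sum_le_sum fun w _ => ?_
  by_cases hw : (∀ k, C (v k) (fun i => w (k,i))) ∧ hist (fun h => (v h.1, w h)) = N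
  · rw [if_pos hw, if_pos hw.1]
    have h1 := match_count (fun h : V × Fin d => v h.1) w φ hφ
    rw [hw.2] at h1
    have h2 : ∏ b : α × α, (φ b.1 b.2 * x b.1 b.2) ^ N b = (∏ h, φ (v h.1) (w h)) * ∏ h, x (v h.1) (w h) := by
      rw [← Finset.prod_mul_distrib, ← hw.2]
      exact (prod_hist (fun h : V × Fin d => (v h.1, w h)) (fun b => φ b.1 b.2 * x b.1 b.2)).symm
    rw [h2, ← mul_assoc]
    exact mul_le_mul_of_nonneg_right h1 (Finset.prod_nonneg fun h _ => hx _ _)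
  · rw [if_neg hw]
    simp only [zero_mul]
    split_ifs
    · exact mul_nonneg hK0 (Finset.prod_nonneg fun h _ => hx _ _)
    · simp
end

section
variable {V α : Type*} [Fintype V] [DecidableEq V] [Fintype α] [DecidableEq α] {d : ℕ}

theorem hist_lab_symm (v : V → α) (σ : Equiv.Perm (V × Fin d)) (hσ : IsM σ) (a b : α) :
    hist (lab v σ) (a,b) = hist (lab v σ) (b,a) := by
  unfold hist
  refine Finset.card_bij (fun h _ => σ h) ?_ ?_ ?_
  · intro h hh
    simp only [lab, mem_filter, mem_univ, true_and, Prod.mk.injEq, hσ.1] at hh ⊢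
    exact ⟨hh.2, hh.1⟩
  · intro a _ b _ h
    exact σ.injective h
  · intro h hh
    refine ⟨σ h, ?_, hσ.1 h⟩
    simp only [lab, mem_filter, mem_univ, true_and, Prod.mk.injEq, hσ.1] at hh ⊢
    exact ⟨hh.2, hh.1⟩

theorem hist_lab_row (v : V → α) (σ : Equiv.Perm (V × Fin d)) (a : α) :
    ∑ b, hist (lab v σ) (a,b) = d * (univ.filter (fun k => v k = a)).card := by
  have h1 : ∑ b, hist (lab v σ) (a,b) = (univ.filter (fun h : V × Fin d => v h.1 = a)).card := by
    rw [Finset.card_eq_sum_card_fiberwise (f := fun h => v (σ h).1) (t := univ) (by intro; simp)]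
    refine Finset.sum_congr rfl fun b _ => ?_
    unfold hist
    congr 1
    ext h
    simp [lab]
  rw [h1]
  have h2 : (univ.filter (fun h : V × Fin d => v h.1 = a)) = (univ.filter (fun k => v k = a)) ×ˢ univ := by
    ext h; simp
  rw [h2, Finset.card_product]
  simp [mul_comm]
end

def NB (m a j : ℕ) (b : Bool × Bool) : ℕ :=
  if b.1 then (if b.2 then a - j else j) else (if b.2 then j else m - a - j)

theorem hist_bool {V : Type*} [Fintype V] [DecidableEq V] {d : ℕ} (v : V → Bool) (σ : Equiv.Perm (V × Fin d)) (hσ : IsM σ) :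
    ∃ j ≤ d * (univ.filter (fun k => v k = true)).card, hist (lab v σ) =
      NB (Fintype.card (V × Fin d)) (d * (univ.filter (fun k => v k = true)).card) j := by
  have h1 := hist_lab_row v σ true
  have h2 := hist_lab_symm v σ hσ false true
  have h3 := sum_hist (lab v σ)
  rw [Fintype.sum_prod_type] at h3
  simp only [Fintype.sum_bool] at h1 h3
  refine ⟨hist (lab v σ) (true,false), by omega, ?_⟩
  funext b
  generalize Fintype.card (V × Fin d) = m at *
  rcases b with ⟨_ | _, _ | _⟩ <;> simp [NB] <;> omega

theorem fact_ratio (m a j : ℕ) (hj : j ≤ a) (hm : 4 * a ≤ m) (ha : 0 < a) :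
    (((a-j).factorial * (j.factorial * j.factorial) * (m-a-j).factorial : ℕ) : ℝ) ≤
      m.factorial * (2 * a / m : ℝ) ^ (a + j) := by
  have h1 : (m-a-j).factorial * (m - a - j + 1)^(a+j) ≤ m.factorial := by
    have := Nat.factorial_mul_pow_le_factorial (m := m-a-j) (n := a+j)
    rwa [show m - a - j + (a+j) = m by omega] at this
  have h2 : (a-j).factorial * (j.factorial * j.factorial) ≤ a^(a+j) := by
    have e1 : (a-j).factorial ≤ a^(a-j) := (Nat.factorial_le_pow (a-j)).trans (Nat.pow_le_pow_left (by omega) _)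
    have e2 : j.factorial ≤ a^j := (Nat.factorial_le_pow j).trans (Nat.pow_le_pow_left (by omega) _)
    calc _ ≤ a^(a-j) * (a^j * a^j) := Nat.mul_le_mul e1 (Nat.mul_le_mul e2 e2)
      _ = a^(a+j) := by rw [← pow_add, ← pow_add]; congr 1; omega
  have hm0 : (0:ℝ) < m := by exact_mod_cast (by omega : 0 < m)
  have h3 : (m/2 : ℝ)^(a+j) ≤ ((m - a - j + 1 : ℕ):ℝ)^(a+j) := by
    refine pow_le_pow_left₀ (by positivity) ?_ _
    rw [div_le_iff₀ (by norm_num)]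
    exact_mod_cast (by omega : m ≤ (m - a - j + 1) * 2)
  have h4 : ((m-a-j).factorial : ℝ) * (m/2:ℝ)^(a+j) ≤ m.factorial :=
    (mul_le_mul_of_nonneg_left h3 (by positivity)).trans (by exact_mod_cast h1)
  have h5 : (2 * a / m : ℝ) ^ (a + j) = (a:ℝ)^(a+j) / (m/2:ℝ)^(a+j) := by
    rw [← div_pow]; congr 1; field_simp
  rw [h5, ← mul_div_assoc, le_div_iff₀ (by positivity)]
  push_cast
  have h6 : (((a-j).factorial:ℝ) * (j.factorial * j.factorial)) ≤ (a:ℝ)^(a+j) := by exact_mod_cast h2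
  calc _ = (((a-j).factorial:ℝ) * (j.factorial * j.factorial)) * (((m-a-j).factorial : ℝ) * (m/2:ℝ)^(a+j)) := by ring
    _ ≤ (a:ℝ)^(a+j) * m.factorial := mul_le_mul h6 h4 (by positivity) (by positivity)
    _ = _ := by ring

theorem row_bool (d : ℕ) (y η t : ℝ) (hη0 : 0 ≤ η) (hη : η ^ d = y) (ht0 : 0 ≤ t) (ht : t ^ 2 = y) (hy1 : y ≤ 1) :
    (∑ a : Bool, ∑ z : Fin d → Bool, if (univ.filter (fun i => z i = true)).card ≠ 1 then
      ∏ i, (if a then η else (if z i then t else 1)) else 0) ≤ 1 + 2 ^ (d+1) * y := by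
  have hy0 : 0 ≤ y := by rw [← ht]; positivity
  have ht1 : t ≤ 1 := by
    by_contra hh
    push Not at hh
    nlinarith
  rw [Fintype.sum_bool]
  have hcard : ∑ z : Fin d → Bool, (y:ℝ) = 2^d * y := by simp
  have h1 : (∑ z : Fin d → Bool, if (univ.filter (fun i => z i = true)).card ≠ 1 then
      ∏ i, (if true then η else (if z i then t else 1)) else 0) ≤ 2^d * y := by
    rw [← hcard]
    refine Finset.sum_le_sum fun z _ => ?_
    by_cases h3 : (univ.filter (fun i => z i = true)).card ≠ 1
    · rw [if_pos h3]; simp [hη]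
    · rw [if_neg h3]; exact hy0
  have h2 : (∑ z : Fin d → Bool, if (univ.filter (fun i => z i = true)).card ≠ 1 then
      ∏ i, (if false = true then η else (if z i then t else 1)) else 0) ≤ 1 + 2^d * y := by
    rw [← hcard]
    have e : (1:ℝ) = ∑ z : Fin d → Bool, if z = (fun _ => false) then 1 else 0 := by simp
    nth_rw 2 [e]
    rw [← Finset.sum_add_distrib]
    refine Finset.sum_le_sum fun z _ => ?_
    have e2 : ∏ i, (if false = true then η else (if z i then t else 1)) = t ^ (univ.filter (fun i => z i = true)).card := by
      simp [Finset.prod_ite]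
    rw [e2]
    by_cases hz : z = (fun _ => false)
    · subst hz
      simp [hy0]
    · rw [if_neg hz]
      split_ifs with h3
      · have h4 : (univ.filter (fun i => z i = true)).card ≠ 0 := by
          rw [Finset.card_ne_zero]
          by_contra h5
          rw [Finset.not_nonempty_iff_eq_empty, Finset.filter_eq_empty_iff] at h5
          apply hz
          funext i
          have := h5 (mem_univ i)
          simpa using this
        rw [zero_add, ← ht]
        exact pow_le_pow_of_le_one ht0 ht1 (by omega)
      · linarith
  calc _ ≤ 2^d*y + (1 + 2^d*y) := add_le_add h1 h2
    _ = _ := by ring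

noncomputable def CS (d : ℕ) : ℝ := 4 ^ d * Real.exp (3 * d / 2 + 2^(d+1))

theorem small_N {V : Type*} [Fintype V] [DecidableEq V] (d : ℕ) (hd : 3 ≤ d) (s j : ℕ) (hs : 1 ≤ s)
    (hs4 : 4 * s ≤ Fintype.card V) (hj : j ≤ d * s) :
    (∑ v : V → Bool, (((MM (V × Fin d)).filter (fun σ => (∀ k, (univ.filter (fun i => v (σ (k,i)).1 = true)).card ≠ 1) ∧
        hist (lab v σ) = NB (Fintype.card (V × Fin d)) (d*s) j)).card : ℝ)) ≤
      (MM (V × Fin d)).card * (CS d * Real.sqrt (s / Fintype.card V)) ^ s := by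
  set n := Fintype.card V with hn
  have hcard : Fintype.card (V × Fin d) = n * d := by simp [hn]
  have hn0 : (0:ℝ) < n := by exact_mod_cast (by omega : 0 < n)
  have hs0 : (0:ℝ) < s := by exact_mod_cast hs
  set y : ℝ := s / n with hy
  have hy0 : 0 < y := by positivity
  have hy1 : y ≤ 1 := by
    rw [hy, div_le_one hn0]; exact_mod_cast (by omega : s ≤ n)
  set t := Real.sqrt y with ht
  have ht0 : 0 < t := Real.sqrt_pos.mpr hy0
  have ht2 : t ^ 2 = y := Real.sq_sqrt hy0.le
  set η := y ^ ((d:ℝ)⁻¹) with hη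
  have hη0 : 0 < η := by positivity
  have hηd : η ^ d = y := Real.rpow_inv_natCast_pow hy0.le (by omega)
  have ht1 : t ≤ 1 := by rw [ht]; exact Real.sqrt_le_one.mpr hy1
  have hG := lemmaG (V := V) (d := d) (α := Bool) (fun _ z => (univ.filter (fun i => z i = true)).card ≠ 1)
    (fun a b => if a then η else (if b then t else 1)) (fun a b => if a then t else (if b then t else 1))
    (by intro a b; split_ifs <;> linarith) (by intro a b; split_ifs <;> linarith) (NB (Fintype.card (V × Fin d)) (d*s) j)
  set S := (∑ v : V → Bool, (((MM (V × Fin d)).filter (fun σ => (∀ k, (univ.filter (fun i => v (σ (k,i)).1 = true)).card ≠ 1) ∧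
        hist (lab v σ) = NB (Fintype.card (V × Fin d)) (d*s) j)).card : ℝ)) with hS
  set T : ℝ := ((MM (V × Fin d)).card : ℝ) with hT
  have hrow := row_bool d y η t hη0.le hηd ht0.le ht2 hy1
  have hrow2 := pow_le_pow_left₀ (by
    refine Finset.sum_nonneg fun a _ => Finset.sum_nonneg fun z _ => ?_
    split_ifs <;> positivity) hrow n
  rw [hcard] at hG
  simp only [Fintype.prod_prod_type, Fintype.prod_bool] at hG
  simp only [NB, if_true, Bool.false_eq_true, if_false] at hG
  rw [show (∑ a : Bool, ∑ b : Bool, (if a = true then t else if b = true then t else 1) * (if b = true then t else if a = true then t else 1) : ℝ)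
    = 1 + 3 * y by simp [Fintype.sum_bool]; rw [← ht2]; ring] at hG
  have e1 : (1 + 3*y)^(n*d/2) ≤ Real.exp (3*d/2*s) := by
    calc _ ≤ (Real.exp (3*y))^(n*d/2) := pow_le_pow_left₀ (by positivity) (by linarith [Real.add_one_le_exp (3*y)]) _
      _ = Real.exp ((n*d/2 : ℕ) * (3*y)) := by rw [← Real.exp_nat_mul]
      _ ≤ _ := by
        apply Real.exp_le_exp.mpr
        have : ((n*d/2 : ℕ):ℝ) ≤ n*d/2 := by
          have := @Nat.cast_div_le ℝ _ _ _ (n*d) 2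
          push_cast at this
          exact this
        calc _ ≤ (n*d/2:ℝ) * (3*y) := mul_le_mul_of_nonneg_right this (by positivity)
          _ = _ := by rw [hy]; field_simp
  have e2 : (1 + 2^(d+1)*y)^n ≤ Real.exp (2^(d+1)*s) := by
    calc _ ≤ (Real.exp (2^(d+1)*y))^n := pow_le_pow_left₀ (by positivity) (by linarith [Real.add_one_le_exp (2^(d+1)*y)]) _
      _ = Real.exp (n * (2^(d+1)*y)) := by rw [← Real.exp_nat_mul]
      _ = _ := by rw [hy]; congr 1; field_simp
  have e3 := fact_ratio (n*d) (d*s) j hj (by nlinarith) (by positivity)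
  have e4 : (2 * ((d*s:ℕ):ℝ) / ((n*d:ℕ):ℝ)) = 2 * y := by
    have : (d:ℝ) ≠ 0 := by positivity
    rw [hy]; push_cast; field_simp
  rw [e4] at e3
  have hf0 : (0:ℝ) < (n*d).factorial := by positivity
  have hT0 : 0 ≤ T := by positivity
  -- lhs product
  have e5 : ((t * η) ^ (d*s - j) * (t*η)^j * ((t*t)^j * (1*1:ℝ)^(n*d-d*s-j))) = t^(d*s) * y^s * y^j := by
    rw [← pow_add, show d*s - j + j = d*s by omega, mul_pow, pow_mul η, hηd, ← sq, ht2]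
    simp
  rw [e5] at hG
  set X := Real.exp (3*d/2*s) with hX
  set Y := Real.exp (2^(d+1)*s) with hY
  have h6 : S * (n*d).factorial * (t^(d*s) * y^s * y^j) ≤ T * ((n*d).factorial * (2*y)^(d*s+j)) * X * Y := by
    refine hG.trans ?_
    refine mul_le_mul ?_ (hrow2.trans e2) ?_ (by positivity)
    · refine mul_le_mul ?_ e1 (by positivity) (by positivity)
      refine mul_le_mul_of_nonneg_left ?_ hT0
      refine le_trans (le_of_eq ?_) e3
      push_cast; ring
    · refine pow_nonneg (Finset.sum_nonneg fun a _ => Finset.sum_nonneg fun z _ => ?_) _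
      split_ifs <;> positivity
  have h7 : (2*y)^(d*s+j) ≤ (4^(d*s)) * (t^s) * (t^(d*s) * y^s * y^j) := by
    have f1 : (2*y)^(d*s+j) = 2^(d*s+j) * (t^(d*s) * t^(d*s)) * y^j := by
      rw [mul_pow, pow_add y, ← ht2]; ring
    rw [f1]
    have f2 : (2:ℝ)^(d*s+j) ≤ 4^(d*s) := by
      rw [show (4:ℝ) = 2^2 by norm_num, ← pow_mul]
      exact pow_le_pow_right₀ (by norm_num) (by omega)
    have f3 : t^(d*s) ≤ t^s * y^s := by
      rw [← ht2, ← pow_mul, ← pow_add]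
      exact pow_le_pow_of_le_one ht0.le ht1 (by nlinarith)
    calc _ ≤ 4^(d*s) * (t^(d*s) * (t^s*y^s)) * y^j := by gcongr
      _ = _ := by ring
  have h8 : (CS d * t)^s = 4^(d*s) * t^s * X * Y := by
    rw [CS, mul_pow, mul_pow, ← pow_mul, ← Real.exp_nat_mul, hX, hY, mul_assoc (_*t^s), ← Real.exp_add]
    rw [show (s:ℝ) * (3*d/2+2^(d+1)) = 3*d/2*s + 2^(d+1)*s by ring]; ring
  rw [h8]
  have hpos : 0 < (n*d).factorial * (t^(d*s) * y^s * y^j) := by positivity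
  refine le_of_mul_le_mul_right ?_ hpos
  calc _ = S * (n*d).factorial * (t^(d*s) * y^s * y^j) := by ring
    _ ≤ _ := h6
    _ ≤ T * ((n*d).factorial * ((4^(d*s)) * (t^s) * (t^(d*s) * y^s * y^j))) * X * Y := by gcongr
    _ = _ := by ring

theorem small_support {V : Type*} [Fintype V] [DecidableEq V] (d : ℕ) (hd : 3 ≤ d) (s1 : ℕ)
    (hs4 : 4 * s1 ≤ Fintype.card V) (r : ℝ) (hr : r = 2 ^ d * CS d * Real.sqrt (s1 / Fintype.card V))
    (hr2 : r ≤ 1/2) :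
    (((MM (V × Fin d)).filter (fun σ => ∃ S : Finset V, S.Nonempty ∧ S.card ≤ s1 ∧
      ∀ k, (univ.filter (fun i => (σ (k,i)).1 ∈ S)).card ≠ 1)).card : ℝ) ≤ (MM (V × Fin d)).card * (2 * r) := by
  classical
  set T : ℝ := ((MM (V × Fin d)).card : ℝ) with hT
  have hCS : 0 < CS d := by unfold CS; positivity
  set B : ℕ → ℕ → (V → Bool) → Finset (Equiv.Perm (V × Fin d)) := fun s j v =>
    ((MM (V × Fin d)).filter (fun σ => (∀ k, (univ.filter (fun i => v (σ (k,i)).1 = true)).card ≠ 1) ∧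
        hist (lab v σ) = NB (Fintype.card (V × Fin d)) (d*s) j)) with hB
  have hsub : ((MM (V × Fin d)).filter (fun σ => ∃ S : Finset V, S.Nonempty ∧ S.card ≤ s1 ∧
      ∀ k, (univ.filter (fun i => (σ (k,i)).1 ∈ S)).card ≠ 1)) ⊆
      (Icc 1 s1).biUnion (fun s => (range (d*s+1)).biUnion fun j => univ.biUnion fun v => B s j v) := by
    intro σ hσ
    simp only [mem_filter] at hσ
    obtain ⟨hM, S, hS1, hS2, hS3⟩ := hσ
    have hM' : IsM σ := by simpa [MM] using hM
    obtain ⟨j, hj, hj2⟩ := hist_bool (fun k => decide (k ∈ S)) σ hM'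
    have hc : (univ.filter (fun k => decide (k ∈ S) = true)) = S := by ext; simp
    rw [hc] at hj hj2
    simp only [mem_biUnion, mem_Icc, mem_range, mem_univ, true_and]
    refine ⟨S.card, ⟨Finset.card_pos.mpr hS1, hS2⟩, j, by omega, (fun k => decide (k ∈ S)), ?_⟩
    simp only [hB, mem_filter]
    refine ⟨hM, ?_, hj2⟩
    simpa using hS3
  have h1 : (((Icc 1 s1).biUnion (fun s => (range (d*s+1)).biUnion fun j => univ.biUnion fun v => B s j v)).card : ℝ)
      ≤ ∑ s ∈ Icc 1 s1, ∑ j ∈ range (d*s+1), ∑ v, ((B s j v).card : ℝ) := by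
    have : ((Icc 1 s1).biUnion (fun s => (range (d*s+1)).biUnion fun j => univ.biUnion fun v => B s j v)).card
      ≤ ∑ s ∈ Icc 1 s1, ∑ j ∈ range (d*s+1), ∑ v, ((B s j v).card) := by
      refine card_biUnion_le.trans (Finset.sum_le_sum fun s _ => ?_)
      refine card_biUnion_le.trans (Finset.sum_le_sum fun j _ => ?_)
      exact card_biUnion_le
    exact_mod_cast this
  refine (Nat.cast_le.mpr (card_le_card hsub)).trans (h1.trans ?_)
  have hr0 : 0 ≤ r := by rw [hr]; positivity
  calc _ ≤ ∑ s ∈ Icc 1 s1, T * r ^ s := by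
        refine Finset.sum_le_sum fun s hs => ?_
        simp only [mem_Icc] at hs
        have hsq : Real.sqrt (s / Fintype.card V) ≤ Real.sqrt (s1 / Fintype.card V) := by
          apply Real.sqrt_le_sqrt
          have : (s:ℝ) ≤ s1 := by exact_mod_cast hs.2
          gcongr
        calc _ ≤ ∑ j ∈ range (d*s+1), T * (CS d * Real.sqrt (s / Fintype.card V)) ^ s := by
              refine Finset.sum_le_sum fun j hj => ?_
              simp only [mem_range] at hj
              exact small_N d hd s j hs.1 (by omega) (by omega)
          _ = (d*s+1 : ℕ) * (T * (CS d * Real.sqrt (s / Fintype.card V)) ^ s) := by simp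
          _ ≤ 2^(d*s) * (T * (CS d * Real.sqrt (s1 / Fintype.card V)) ^ s) := by
              gcongr
              have : d*s+1 ≤ 2^(d*s) := Nat.lt_two_pow_self
              exact_mod_cast this
          _ = T * r ^ s := by
              rw [hr, pow_mul, mul_assoc (2^d), mul_pow (2^d)]; ring
    _ = T * ∑ s ∈ Icc 1 s1, r ^ s := by rw [Finset.mul_sum]
    _ ≤ _ := by
      have := geom_bound r hr0 hr2 s1
      gcongr

theorem amgm_def {ι : Type*} [Fintype ι] [DecidableEq ι] (y : ι → ℝ) (hy : ∀ i, 0 ≤ y i) (i0 i1 : ι) (h01 : i0 ≠ i1) :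
    ∏ i, y i ^ ((Fintype.card ι : ℝ)⁻¹) ≤
      (Fintype.card ι : ℝ)⁻¹ * (∑ i, y i - (Real.sqrt (y i0) - Real.sqrt (y i1))^2) := by
  set c := (Fintype.card ι : ℝ)⁻¹ with hc
  have hcard : 0 < Fintype.card ι := Fintype.card_pos_iff.mpr ⟨i0⟩
  have hc0 : 0 < c := by positivity
  set m := Real.sqrt (y i0) * Real.sqrt (y i1) with hm
  have hm0 : 0 ≤ m := by positivity
  set y' := Function.update (Function.update y i0 m) i1 m with hy'
  have hy'0 : ∀ i, 0 ≤ y' i := by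
    intro i
    simp only [hy', Function.update_apply]
    split_ifs <;> first | exact hm0 | exact hy i
  have h1 := Real.geom_mean_le_arith_mean_weighted univ (fun _ => c) y' (fun _ _ => hc0.le) (by
    simp [hc]; field_simp) (fun i _ => hy'0 i)
  have hi1 : i1 ∈ univ.erase i0 := by simp [h01.symm]
  have h2 : ∀ G : ι → ℝ, ∑ i, G i = G i0 + (G i1 + ∑ i ∈ (univ.erase i0).erase i1, G i) := by
    intro G
    rw [Finset.add_sum_erase _ _ hi1, Finset.add_sum_erase _ _ (mem_univ i0)]
  have h3 : ∀ G : ι → ℝ, ∏ i, G i = G i0 * (G i1 * ∏ i ∈ (univ.erase i0).erase i1, G i) := by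
    intro G
    rw [Finset.mul_prod_erase _ _ hi1, Finset.mul_prod_erase _ _ (mem_univ i0)]
  have e0 : y' i0 = m := by simp [hy', Function.update_apply, h01]
  have e1 : y' i1 = m := by simp [hy']
  have e2 : ∀ i ∈ (univ.erase i0).erase i1, y' i = y i := by
    intro i hi
    simp only [mem_erase, mem_univ, and_true] at hi
    simp [hy', Function.update_apply, hi.1, hi.2]
  have e3 : ∏ i, y i ^ c = ∏ i, y' i ^ c := by
    rw [h3, h3 (fun i => y' i ^ c), ← mul_assoc, ← mul_assoc, e0, e1]
    congr 1
    · rw [← Real.mul_rpow (hy _) (hy _), ← Real.mul_rpow hm0 hm0]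
      congr 1
      rw [hm]
      nlinarith [Real.sq_sqrt (hy i0), Real.sq_sqrt (hy i1)]
    · exact Finset.prod_congr rfl fun i hi => by rw [e2 i hi]
  rw [e3]
  refine h1.trans (le_of_eq ?_)
  rw [← Finset.mul_sum]
  congr 1
  rw [h2, h2 y, e0, e1, Finset.sum_congr rfl e2]
  have a0 := Real.sq_sqrt (hy i0)
  have a1 := Real.sq_sqrt (hy i1)
  rw [hm]
  nlinarith

section
variable {F : Type*} [Fintype F] [DecidableEq F] [AddCommGroup F]

noncomputable def Phi (d : ℕ) (q : F → ℝ) : ℝ :=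
  ∑ z : Fin d → F, if ∑ i, z i = 0 then ∏ i, q (z i) ^ (((d:ℝ) - 1) / d) else 0

theorem sum_erase_one (d : ℕ) (q : F → ℝ) (hq1 : ∑ a, q a = 1) (j : Fin (d+1)) :
    (∑ z : Fin (d+1) → F, if ∑ i, z i = 0 then ∏ i ∈ univ.erase j, q (z i) else 0) = 1 := by
  rw [← Equiv.sum_comp (Fin.insertNthEquiv (fun _ => F) j), Fintype.sum_prod_type, Finset.sum_comm]
  have h1 : ∀ (z : Fin d → F) (a : F), (if ∑ i, (Fin.insertNthEquiv (fun _ => F) j) (a, z) i = 0 then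
      ∏ i ∈ univ.erase j, q ((Fin.insertNthEquiv (fun _ => F) j) (a, z) i) else 0) =
      if a = - ∑ i, z i then ∏ i, q (z i) else 0 := by
    intro z a
    have e1 : ∑ i, (Fin.insertNthEquiv (fun _ => F) j) (a, z) i = a + ∑ i, z i := by
      rw [Fin.sum_univ_succAbove _ j]; simp
    have e2 : ∏ i ∈ univ.erase j, q ((Fin.insertNthEquiv (fun _ => F) j) (a, z) i) = ∏ i, q (z i) := by
      have : (univ.erase j : Finset (Fin (d+1))) = univ.image j.succAbove := by
        ext i
        simp [Fin.exists_succAbove_eq_iff]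
      rw [this, Finset.prod_image (by intro a _ b _ h; exact Fin.succAbove_right_injective h)]
      simp
    rw [e1, e2]
    simp only [eq_neg_iff_add_eq_zero]
  simp only [h1]
  simp only [Finset.sum_ite_eq', mem_univ, if_true]
  have : ∑ z : Fin d → F, ∏ i, q (z i) = ∏ i : Fin d, ∑ a, q a := by
    rw [Finset.prod_univ_sum]; simp
  rw [this]; simp [hq1]

theorem prod_erase_rpow (d : ℕ) (x : Fin (d+1) → ℝ) (hx : ∀ i, 0 ≤ x i) :
    ∏ j, (∏ i ∈ univ.erase j, x i) ^ (((d+1:ℕ):ℝ)⁻¹) = ∏ i, x i ^ ((((d+1:ℕ):ℝ) - 1) / ((d+1:ℕ):ℝ)) := by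
  have h1 : ∀ j, (∏ i ∈ univ.erase j, x i) ^ (((d+1:ℕ):ℝ)⁻¹) = ∏ i ∈ univ.erase j, x i ^ (((d+1:ℕ):ℝ)⁻¹) := by
    intro j
    rw [Real.finsetProd_rpow _ _ (fun i _ => hx i)]
  simp only [h1]
  rw [Finset.prod_comm' (t' := univ) (s' := fun i => univ.erase i) (by intro a b; simp [eq_comm])]
  refine Finset.prod_congr rfl fun i _ => ?_
  rw [Finset.prod_const, ← Real.rpow_natCast, ← Real.rpow_mul (hx i)]
  congr 1
  simp
  ring

/-- deficit version of Phi ≤ 1 -/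
theorem Phi_deficit (d : ℕ) (q : F → ℝ) (hq : ∀ a, 0 ≤ q a) (hq1 : ∑ a, q a = 1) (i0 i1 : Fin (d+1)) (h01 : i0 ≠ i1) :
    Phi (d+1) q + ((d+1:ℕ):ℝ)⁻¹ * (∑ z : Fin (d+1) → F, if ∑ i, z i = 0 then
      (Real.sqrt (∏ i ∈ univ.erase i0, q (z i)) - Real.sqrt (∏ i ∈ univ.erase i1, q (z i)))^2 else 0) ≤ 1 := by
  have hone : (1:ℝ) = ((d+1:ℕ):ℝ)⁻¹ * ∑ j : Fin (d+1), ∑ z : Fin (d+1) → F, if ∑ i, z i = 0 then ∏ i ∈ univ.erase j, q (z i) else 0 := by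
    simp only [sum_erase_one d q hq1]
    simp
    field_simp
  rw [hone, Finset.sum_comm, ← le_sub_iff_add_le, ← mul_sub, ← Finset.sum_sub_distrib, Finset.mul_sum]
  unfold Phi
  refine Finset.sum_le_sum fun z _ => ?_
  split_ifs with h
  · have := amgm_def (fun j => ∏ i ∈ univ.erase j, q (z i)) (fun j => Finset.prod_nonneg fun i _ => hq _) i0 i1 h01
    rw [Fintype.card_fin] at this
    rw [prod_erase_rpow d (fun i => q (z i)) (fun i => hq _)] at this
    exact this
  · simp

theorem Phi_le_one (d : ℕ) (hd : 2 ≤ d) (q : F → ℝ) (hq : ∀ a, 0 ≤ q a) (hq1 : ∑ a, q a = 1) : Phi d q ≤ 1 := by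
  obtain ⟨e, rfl⟩ : ∃ e, d = e + 1 := ⟨d-1, by omega⟩
  have := Phi_deficit e q hq hq1 ⟨0, by omega⟩ ⟨1, by omega⟩ (by simp)
  refine le_trans ?_ this
  refine le_add_of_nonneg_right (mul_nonneg (by positivity) (Finset.sum_nonneg fun z _ => ?_))
  split_ifs <;> positivity

theorem Phi_nonneg (d : ℕ) (q : F → ℝ) (hq : ∀ a, 0 ≤ q a) : 0 ≤ Phi d q := by
  refine Finset.sum_nonneg fun z _ => ?_
  split_ifs
  · exact Finset.prod_nonneg fun i _ => Real.rpow_nonneg (hq _) _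
  · exact le_rfl

theorem sum_fcons {k : ℕ} {R : Type*} [AddCommMonoid R] (G : (Fin (k+1) → F) → R) :
    ∑ z, G z = ∑ a, ∑ z' : Fin k → F, G (Fin.cons a z') := by
  rw [← Equiv.sum_comp (Fin.consEquiv (fun _ => F)), Fintype.sum_prod_type]
  rfl

/-- consequence of a small deficit -/
theorem Phi_stab (e : ℕ) (q : F → ℝ) (hq : ∀ a, 0 ≤ q a) (hq1 : ∑ a, q a = 1) (η : ℝ) (hη : 1 - η ≤ Phi (e+3) q) :
    ∃ s' : F, ∑ r, q r * ∑ x, (Real.sqrt (q x) - Real.sqrt (q (-x-(r+s'))))^2 ≤ (e+3) * η := by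
  have h := Phi_deficit (e+2) q hq hq1 0 1 (by simp)
  have hE : (∑ z : Fin (e+2+1) → F, if ∑ i, z i = 0 then
      (Real.sqrt (∏ i ∈ univ.erase 0, q (z i)) - Real.sqrt (∏ i ∈ univ.erase 1, q (z i)))^2 else 0) ≤ (e+3)*η := by
    have h2 : (((e+2+1:ℕ):ℝ))⁻¹ * (∑ z : Fin (e+2+1) → F, if ∑ i, z i = 0 then
      (Real.sqrt (∏ i ∈ univ.erase 0, q (z i)) - Real.sqrt (∏ i ∈ univ.erase 1, q (z i)))^2 else 0) ≤ η := by
      have : Phi (e+2+1) q = Phi (e+3) q := rfl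
      linarith
    rw [inv_mul_le_iff₀ (by positivity)] at h2
    refine h2.trans (le_of_eq ?_)
    push_cast; ring
  -- rewrite
  have hE2 : (∑ z : Fin (e+2+1) → F, if ∑ i, z i = 0 then
      (Real.sqrt (∏ i ∈ univ.erase 0, q (z i)) - Real.sqrt (∏ i ∈ univ.erase 1, q (z i)))^2 else 0) =
      ∑ t : Fin e → F, (∏ i, q (t i)) * ∑ r, q r * ∑ x, (Real.sqrt (q x) - Real.sqrt (q (-x-(r+∑ i, t i))))^2 := by
    rw [sum_fcons]
    have : ∀ a : F, ∀ G : (Fin (e+2) → F) → ℝ, ∑ z' : Fin (e+2) → F, G z' = ∑ b, ∑ c, ∑ t : Fin e → F, G (Fin.cons b (Fin.cons c t)) := by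
      intro a G
      rw [sum_fcons]
      refine Finset.sum_congr rfl fun b _ => ?_
      rw [sum_fcons]
    simp only [this 0]
    simp only [Finset.mul_sum]
    have comm : ∀ G : F → F → F → (Fin e → F) → ℝ, ∑ a, ∑ b, ∑ c, ∑ t, G a b c t = ∑ t, ∑ c, ∑ b, ∑ a, G a b c t := by
      intro G
      rw [Finset.sum_comm]
      have : ∀ b, ∑ a, ∑ c, ∑ t, G a b c t = ∑ t, ∑ c, ∑ a, G a b c t := by
        intro b
        rw [Finset.sum_comm]
        have : ∀ c, ∑ a, ∑ t, G a b c t = ∑ t, ∑ a, G a b c t := fun c => Finset.sum_comm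
        simp only [this]
        rw [Finset.sum_comm]
      simp only [this]
      rw [Finset.sum_comm]
      refine Finset.sum_congr rfl fun t _ => ?_
      rw [Finset.sum_comm]
    rw [comm]
    refine Finset.sum_congr rfl fun t _ => ?_
    refine Finset.sum_congr rfl fun c _ => ?_
    refine Finset.sum_congr rfl fun b _ => ?_
    have key : ∀ a : F, (if ∑ i, (Fin.cons a (Fin.cons b (Fin.cons c t) : Fin (e+2) → F) : Fin (e+2+1) → F) i = 0 then
      (Real.sqrt (∏ i ∈ univ.erase 0, q ((Fin.cons a (Fin.cons b (Fin.cons c t) : Fin (e+2) → F) : Fin (e+2+1) → F) i)) - Real.sqrt (∏ i ∈ univ.erase 1, q ((Fin.cons a (Fin.cons b (Fin.cons c t) : Fin (e+2) → F) : Fin (e+2+1) → F) i)))^2 else 0)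
      = if a = - b - (c + ∑ i, t i) then (∏ i, q (t i)) * (q c * (Real.sqrt (q b) - Real.sqrt (q a))^2) else 0 := by
      intro a
      set z : Fin (e+2+1) → F := (Fin.cons a (Fin.cons b (Fin.cons c t) : Fin (e+2) → F) : Fin (e+2+1) → F) with hz
      have z0 : z 0 = a := rfl
      have z1 : z 1 = b := rfl
      have zs : ∑ i, z i = a + (b + (c + ∑ i, t i)) := by
        rw [Fin.sum_univ_succ, Fin.sum_univ_succ, Fin.sum_univ_succ]; rfl
      have er : ∀ (j : Fin (e+2+1)), ∏ i ∈ univ.erase j, q (z i) = ∏ i : Fin (e+2), q (z (j.succAbove i)) := by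
        intro j
        have : (univ.erase j : Finset (Fin (e+2+1))) = univ.image j.succAbove := by
          ext i
          simp [Fin.exists_succAbove_eq_iff]
        rw [this, Finset.prod_image (by intro a _ b _ h; exact Fin.succAbove_right_injective h)]
      have e0 : ∏ i ∈ univ.erase (0 : Fin (e+2+1)), q (z i) = q b * (q c * ∏ i, q (t i)) := by
        rw [er, Fin.prod_univ_succ, Fin.prod_univ_succ]; rfl
      have e1 : ∏ i ∈ univ.erase (1 : Fin (e+2+1)), q (z i) = q a * (q c * ∏ i, q (t i)) := by
        rw [er, Fin.prod_univ_succ, Fin.prod_univ_succ]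
        have s0 : (1 : Fin (e+2+1)).succAbove 0 = 0 := rfl
        have s1 : ∀ i : Fin (e+1), (1 : Fin (e+2+1)).succAbove i.succ = i.succ.succ := by
          intro i
          rw [show (1 : Fin (e+2+1)) = Fin.succ 0 from rfl, Fin.succ_succAbove_succ]; simp
        rw [s0]
        simp only [s1]
        rfl
      rw [zs, e0, e1]
      have iff : (a + (b + (c + ∑ i, t i)) = 0) ↔ (a = - b - (c + ∑ i, t i)) := by
        rw [← eq_neg_iff_add_eq_zero]
        rw [neg_add, sub_eq_add_neg]
      simp only [iff]
      split_ifs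
      · have hR : 0 ≤ q c * ∏ i, q (t i) := mul_nonneg (hq _) (Finset.prod_nonneg fun i _ => hq _)
        rw [Real.sqrt_mul (hq b), Real.sqrt_mul (hq a), ← sub_mul, mul_pow, Real.sq_sqrt hR]
        ring
      · rfl
    simp only [key]
    simp
  rw [hE2] at hE
  by_contra hcon
  push Not at hcon
  have hprob : ∑ t : Fin e → F, ∏ i, q (t i) = 1 := by
    have : ∑ z : Fin e → F, ∏ i, q (z i) = ∏ i : Fin e, ∑ a, q a := by
      rw [Finset.prod_univ_sum]; simp
    rw [this]; simp [hq1]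
  have hex : ∃ t : Fin e → F, 0 < ∏ i, q (t i) := by
    by_contra hh
    push Not at hh
    have : ∑ t : Fin e → F, ∏ i, q (t i) ≤ 0 := Finset.sum_nonpos fun t _ => hh t
    linarith
  obtain ⟨t0, ht0⟩ := hex
  have hlt : ∑ t : Fin e → F, (∏ i, q (t i)) * ((e+3) * η) <
     ∑ t : Fin e → F, (∏ i, q (t i)) * ∑ r, q r * ∑ x, (Real.sqrt (q x) - Real.sqrt (q (-x-(r+∑ i, t i))))^2 := by
    refine Finset.sum_lt_sum (fun t _ => ?_) ⟨t0, mem_univ _, ?_⟩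
    · exact mul_le_mul_of_nonneg_left (hcon _).le (Finset.prod_nonneg fun i _ => hq _)
    · exact mul_lt_mul_of_pos_left (hcon _) ht0
  rw [← Finset.sum_mul, hprob, one_mul] at hlt
  linarith
end

section
variable {p : ℕ} [Fact p.Prime]

noncomputable def Gsh (f : ZMod p → ℝ) (u : ZMod p) : ℝ := ∑ x, (f x - f (x+u))^2

theorem Gsh_avg (ν f : ZMod p → ℝ) (hν : ∀ a, 0 ≤ ν a) (hν1 : ∑ a, ν a = 1) (s' : ZMod p) (E : ℝ)
    (h : ∑ r, ν r * ∑ x, (f x - f (-x-(r+s')))^2 ≤ E) :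
    ∑ r, ∑ r', ν r * ν r' * Gsh f (r - r') ≤ 4 * E := by
  obtain ⟨g, hg⟩ : ∃ g : ZMod p → ℝ, g = fun r => ∑ x, (f x - f (-x-(r+s')))^2 := ⟨_, rfl⟩
  have hgr : ∀ r, ∑ x, (f x - f (-x-(r+s')))^2 = g r := fun r => by rw [hg]
  simp only [hgr] at h
  have h1 : ∀ r r', Gsh f (r - r') ≤ 2 * g r + 2 * g r' := by
    intro r r'
    have e : g r' = ∑ x, (f (-x-(r+s')) - f (x + (r - r')))^2 := by
      simp only [hg]
      rw [← Equiv.sum_comp (Equiv.subLeft (-(r+s')))]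
      refine Finset.sum_congr rfl fun x _ => ?_
      simp only [Equiv.subLeft_apply]
      congr 2
      · congr 1; ring
      · congr 1; ring
    rw [e]
    simp only [Gsh, hg, Finset.mul_sum]
    rw [← Finset.sum_add_distrib]
    refine Finset.sum_le_sum fun x _ => ?_
    nlinarith [sq_nonneg ((f x - f (-x-(r+s'))) - (f (-x-(r+s')) - f (x + (r - r'))))]
  calc _ ≤ ∑ r, ∑ r', ν r * ν r' * (2 * g r + 2 * g r') := by
        refine Finset.sum_le_sum fun r _ => Finset.sum_le_sum fun r' _ => ?_
        exact mul_le_mul_of_nonneg_left (h1 r r') (mul_nonneg (hν _) (hν _))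
    _ = 2 * (∑ r, ν r * g r) * (∑ r', ν r') + 2 * (∑ r, ν r) * ∑ r', ν r' * g r' := by
        have : ∀ r r', ν r * ν r' * (2 * g r + 2 * g r') = 2 * (ν r * g r) * ν r' + 2 * ν r * (ν r' * g r') := fun r r' => by ring
        simp only [this, Finset.sum_add_distrib]
        rw [← Finset.sum_mul_sum, ← Finset.sum_mul_sum, ← Finset.mul_sum, ← Finset.mul_sum]
    _ = 4 * ∑ r, ν r * g r := by rw [hν1]; ring
    _ ≤ _ := by linarith

noncomputable def hat (ν : ZMod p → ℝ) (t : ZMod p) : ℂ := ∑ b, (ν b : ℂ) * ZMod.stdAddChar (t * b)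

theorem hat_sq (ν : ZMod p → ℝ) (t : ZMod p) :
    ‖hat ν t‖^2 = ∑ r, ∑ r', ν r * ν r' * (ZMod.stdAddChar (t * (r - r')) : ℂ).re := by
  have h1 : ((‖hat ν t‖^2 : ℝ) : ℂ) = ∑ r, ∑ r', (ν r : ℂ) * ν r' * (ZMod.stdAddChar (t * (r - r')) : ℂ) := by
    push_cast
    rw [← Complex.mul_conj' (hat ν t)]
    unfold hat
    rw [map_sum, Finset.sum_mul_sum]
    refine Finset.sum_congr rfl fun r _ => Finset.sum_congr rfl fun r' _ => ?_
    rw [map_mul (starRingEnd ℂ), Complex.conj_ofReal, ← AddChar.map_neg_eq_conj, mul_sub, sub_eq_add_neg, AddChar.map_add_eq_mul]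
    ring
  have h2 := congrArg Complex.re h1
  rw [Complex.ofReal_re] at h2
  rw [h2, Complex.re_sum]
  refine Finset.sum_congr rfl fun r _ => ?_
  rw [Complex.re_sum]
  refine Finset.sum_congr rfl fun r' _ => ?_
  rw [← Complex.ofReal_mul, Complex.re_ofReal_mul]

theorem hat_sq_def (ν : ZMod p → ℝ) (hν1 : ∑ a, ν a = 1) (t : ZMod p) :
    1 - ‖hat ν t‖^2 = ∑ r, ∑ r', ν r * ν r' * (1 - (ZMod.stdAddChar (t * (r - r')) : ℂ).re) := by
  rw [hat_sq]
  have : (1:ℝ) = ∑ r, ∑ r', ν r * ν r' := by rw [← Finset.sum_mul_sum, hν1]; ring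
  nth_rw 1 [this]
  rw [← Finset.sum_sub_distrib]
  refine Finset.sum_congr rfl fun r _ => ?_
  rw [← Finset.sum_sub_distrib]
  refine Finset.sum_congr rfl fun r' _ => ?_
  ring

theorem norm_one_sub_sq (a : ZMod p) : ‖1 - (ZMod.stdAddChar a : ℂ)‖^2 = 2 * (1 - (ZMod.stdAddChar a : ℂ).re) := by
  have h : ‖(ZMod.stdAddChar a : ℂ)‖ = 1 := AddChar.norm_apply _ _
  have h2 : (ZMod.stdAddChar a : ℂ).re^2 + (ZMod.stdAddChar a : ℂ).im^2 = 1 := by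
    have := Complex.sq_norm (ZMod.stdAddChar a : ℂ)
    rw [h, Complex.normSq_apply] at this
    nlinarith
  rw [Complex.sq_norm, Complex.normSq_apply]
  simp only [Complex.sub_re, Complex.one_re, Complex.sub_im, Complex.one_im]
  nlinarith

theorem hat_subadd (ν : ZMod p → ℝ) (hν : ∀ a, 0 ≤ ν a) (hν1 : ∑ a, ν a = 1) (s t : ZMod p) :
    1 - ‖hat ν (s+t)‖^2 ≤ 2 * (1 - ‖hat ν s‖^2) + 2 * (1 - ‖hat ν t‖^2) := by
  have key : ∀ a b : ZMod p, 1 - (ZMod.stdAddChar (a+b) : ℂ).re ≤ 2 * (1 - (ZMod.stdAddChar a : ℂ).re) + 2 * (1 - (ZMod.stdAddChar b : ℂ).re) := by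
    intro a b
    have h1 := norm_one_sub_sq (a+b)
    have h2 := norm_one_sub_sq a
    have h3 := norm_one_sub_sq b
    have h4 : ‖1 - (ZMod.stdAddChar (a+b) : ℂ)‖ ≤ ‖1 - (ZMod.stdAddChar a : ℂ)‖ + ‖1 - (ZMod.stdAddChar b : ℂ)‖ := by
      have : 1 - (ZMod.stdAddChar (a+b) : ℂ) = (1 - ZMod.stdAddChar a) + ZMod.stdAddChar a * (1 - ZMod.stdAddChar b) := by
        rw [AddChar.map_add_eq_mul]; ring
      rw [this]
      refine (norm_add_le _ _).trans ?_
      rw [norm_mul, AddChar.norm_apply, one_mul]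
    have h5 := norm_nonneg (1 - (ZMod.stdAddChar (a+b) : ℂ))
    nlinarith [sq_nonneg (‖1 - (ZMod.stdAddChar a : ℂ)‖ - ‖1 - (ZMod.stdAddChar b : ℂ)‖)]
  rw [hat_sq_def ν hν1, hat_sq_def ν hν1, hat_sq_def ν hν1, Finset.mul_sum, Finset.mul_sum, ← Finset.sum_add_distrib]
  refine Finset.sum_le_sum fun r _ => ?_
  rw [Finset.mul_sum, Finset.mul_sum, ← Finset.sum_add_distrib]
  refine Finset.sum_le_sum fun r' _ => ?_
  have := mul_le_mul_of_nonneg_left (key (s*(r-r')) (t*(r-r'))) (mul_nonneg (hν r) (hν r'))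
  rw [← add_mul] at this
  linarith

theorem hat_shift (ν f : ZMod p → ℝ) (hf : ∀ a, ν a = f a ^ 2) (hν1 : ∑ a, ν a = 1) (t u : ZMod p) :
    ‖hat ν t‖ * ‖1 - (ZMod.stdAddChar (t * u) : ℂ)‖ ≤ 2 * Real.sqrt (Gsh f u) := by
  have e1 : hat ν t * (ZMod.stdAddChar (t*u) - 1) = ∑ b, ((ν b - ν (b + u) : ℝ) : ℂ) * ZMod.stdAddChar (t * (b+u)) := by
    have : ∑ b, (ν (b+u) : ℂ) * ZMod.stdAddChar (t * (b+u)) = hat ν t := by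
      unfold hat
      exact Equiv.sum_comp (Equiv.addRight u) (fun b => (ν b : ℂ) * ZMod.stdAddChar (t * b))
    push_cast
    simp only [sub_mul, Finset.sum_sub_distrib]
    rw [this]
    unfold hat
    rw [Finset.sum_mul]
    rw [← Finset.sum_sub_distrib]
    refine Finset.sum_congr rfl fun b _ => ?_
    rw [mul_add, AddChar.map_add_eq_mul]; ring
  rw [← norm_neg (1 - _), neg_sub, ← norm_mul, e1]
  have h1 : ‖∑ b, ((ν b - ν (b + u) : ℝ) : ℂ) * ZMod.stdAddChar (t * (b+u))‖ ≤ ∑ b, |f b - f (b+u)| * |f b + f (b+u)| := by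
    refine (norm_sum_le _ _).trans (Finset.sum_le_sum fun b _ => ?_)
    rw [norm_mul, AddChar.norm_apply, mul_one, Complex.norm_real, Real.norm_eq_abs, ← abs_mul]
    apply le_of_eq; congr 1
    rw [hf, hf]; ring
  refine h1.trans ?_
  refine (Real.sum_mul_le_sqrt_mul_sqrt _ _ _).trans ?_
  simp only [sq_abs]
  rw [mul_comm]
  refine mul_le_mul_of_nonneg_right ?_ (Real.sqrt_nonneg _)
  rw [Real.sqrt_le_left (by norm_num)]
  have e2 : ∑ b, f (b+u)^2 = 1 := by
    rw [← hν1]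
    exact (Equiv.sum_comp (Equiv.addRight u) (fun b => f b ^2)).trans (Finset.sum_congr rfl fun b _ => (hf b).symm)
  have e3 : ∑ b, f b^2 = 1 := by
    rw [← hν1]
    exact Finset.sum_congr rfl fun b _ => (hf b).symm
  calc ∑ b, (f b + f (b+u))^2 ≤ ∑ b, (2 * f b^2 + 2 * f (b+u)^2) :=
        Finset.sum_le_sum fun b _ => by nlinarith [sq_nonneg (f b - f (b+u))]
    _ = 2^2 := by rw [Finset.sum_add_distrib, ← Finset.mul_sum, ← Finset.mul_sum, e2, e3]; norm_num

theorem hat_norm_le (ν : ZMod p → ℝ) (hν : ∀ a, 0 ≤ ν a) (hν1 : ∑ a, ν a = 1) (t : ZMod p) : ‖hat ν t‖ ≤ 1 := by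
  rw [← hν1]
  refine (norm_sum_le _ _).trans (Finset.sum_le_sum fun b _ => ?_)
  rw [norm_mul, AddChar.norm_apply, mul_one, Complex.norm_real, Real.norm_eq_abs, abs_of_nonneg (hν b)]

/-- dichotomy (1) -/
theorem hat_dich (ν f : ZMod p → ℝ) (hν : ∀ a, 0 ≤ ν a) (hf : ∀ a, ν a = f a ^ 2) (hν1 : ∑ a, ν a = 1) (D : ℝ)
    (hD : ∑ r, ∑ r', ν r * ν r' * Gsh f (r - r') ≤ D) (t : ZMod p) :
    ‖hat ν t‖ * (1 - ‖hat ν t‖^2) ≤ 2 * Real.sqrt D := by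
  have hG0 : ∀ u, 0 ≤ Gsh f u := fun u => Finset.sum_nonneg fun x _ => sq_nonneg _
  have hp : ∑ rr : ZMod p × ZMod p, ν rr.1 * ν rr.2 = 1 := by
    rw [Fintype.sum_prod_type]
    simp only
    rw [← Finset.sum_mul_sum, hν1]; ring
  have h1 : ‖hat ν t‖ * (1 - ‖hat ν t‖^2) ≤ 2 * ∑ rr : ZMod p × ZMod p, ν rr.1 * ν rr.2 * Real.sqrt (Gsh f (rr.1 - rr.2)) := by
    rw [hat_sq_def ν hν1, ← Fintype.sum_prod_type' (f := fun r r' => ν r * ν r' * (1 - (ZMod.stdAddChar (t * (r - r')) : ℂ).re)), Finset.mul_sum, Finset.mul_sum]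
    refine Finset.sum_le_sum fun rr _ => ?_
    have h2 := hat_shift ν f hf hν1 t (rr.1 - rr.2)
    have h3 : 1 - (ZMod.stdAddChar (t * (rr.1 - rr.2)) : ℂ).re ≤ ‖1 - (ZMod.stdAddChar (t * (rr.1 - rr.2)) : ℂ)‖ := by
      have := Complex.re_le_norm (1 - (ZMod.stdAddChar (t * (rr.1 - rr.2)) : ℂ))
      simpa using this
    have h4 : ‖hat ν t‖ * (1 - (ZMod.stdAddChar (t * (rr.1 - rr.2)) : ℂ).re) ≤ 2 * Real.sqrt (Gsh f (rr.1 - rr.2)) :=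
      (mul_le_mul_of_nonneg_left h3 (norm_nonneg _)).trans h2
    have := mul_le_mul_of_nonneg_left h4 (mul_nonneg (hν rr.1) (hν rr.2))
    linarith
  refine h1.trans ?_
  have h5 : ∑ rr : ZMod p × ZMod p, ν rr.1 * ν rr.2 * Real.sqrt (Gsh f (rr.1 - rr.2)) ≤ Real.sqrt D := by
    apply Real.le_sqrt_of_sq_le
    have h6 := Finset.sum_mul_sq_le_sq_mul_sq univ (fun rr : ZMod p × ZMod p => Real.sqrt (ν rr.1 * ν rr.2))
      (fun rr => Real.sqrt (ν rr.1 * ν rr.2) * Real.sqrt (Gsh f (rr.1 - rr.2)))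
    have e0 : ∀ rr : ZMod p × ZMod p, Real.sqrt (ν rr.1 * ν rr.2) ^ 2 = ν rr.1 * ν rr.2 := fun rr => Real.sq_sqrt (mul_nonneg (hν _) (hν _))
    have e1 : ∀ rr : ZMod p × ZMod p, Real.sqrt (ν rr.1 * ν rr.2) * (Real.sqrt (ν rr.1 * ν rr.2) * Real.sqrt (Gsh f (rr.1 - rr.2))) = ν rr.1 * ν rr.2 * Real.sqrt (Gsh f (rr.1 - rr.2)) := by
      intro rr; rw [← mul_assoc, ← sq, e0]
    have e2 : ∀ rr : ZMod p × ZMod p, (Real.sqrt (ν rr.1 * ν rr.2) * Real.sqrt (Gsh f (rr.1 - rr.2)))^2 = ν rr.1 * ν rr.2 * Gsh f (rr.1 - rr.2) := by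
      intro rr; rw [mul_pow, e0, Real.sq_sqrt (hG0 _)]
    simp only [e0, e1, e2, hp, one_mul] at h6
    rw [Fintype.sum_prod_type (f := fun rr => ν rr.1 * ν rr.2 * Gsh f (rr.1 - rr.2))] at h6
    exact h6.trans hD
  linarith

theorem conv_bound (ν f : ZMod p → ℝ) (hf : ∀ a, ν a = f a ^ 2) (hν1 : ∑ a, ν a = 1) (D : ℝ)
    (hD : ∑ r, ∑ r', ν r * ν r' * Gsh f (r - r') ≤ D) :
    (1 - D/2) * p ≤ ∑ t, ‖hat f t‖^2 * ‖hat ν t‖^2 := by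
  have e3 : ∑ b, f b^2 = 1 := by
    rw [← hν1]
    exact Finset.sum_congr rfl fun b _ => (hf b).symm
  set c : ZMod p → ℝ := fun x => ∑ r, ν r * f (x - r) with hc
  have h1 : ∀ t, hat f t * hat ν t = ∑ x, (c x : ℂ) * ZMod.stdAddChar (t * x) := by
    intro t
    unfold hat
    simp only [hc]
    push_cast
    simp only [Finset.sum_mul]
    rw [Finset.sum_comm (s := univ) (t := univ) (f := fun x r => (ν r : ℂ) * f (x - r) * ZMod.stdAddChar (t * x))]
    rw [← Finset.sum_mul, Finset.sum_mul_sum, Finset.sum_comm]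
    refine Finset.sum_congr rfl fun r _ => ?_
    rw [← Equiv.sum_comp (Equiv.subRight r)]
    refine Finset.sum_congr rfl fun x _ => ?_
    simp only [Equiv.subRight_apply]
    have : t * x = t * (x - r) + t * r := by ring
    rw [this, AddChar.map_add_eq_mul]
    ring
  have h2 : ∑ t, ‖hat f t‖^2 * ‖hat ν t‖^2 = p * ∑ x, (c x)^2 := by
    have := parseval (fun x => (c x : ℂ))
    simp only [Complex.norm_real, Real.norm_eq_abs, sq_abs] at this
    rw [← this]
    refine Finset.sum_congr rfl fun t _ => ?_
    rw [← h1, norm_mul, mul_pow]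
  rw [h2, mul_comm]
  refine mul_le_mul_of_nonneg_left ?_ (by positivity)
  have h3 : ∀ u, Gsh f u = 2 - 2 * ∑ x, f x * f (x+u) := by
    intro u
    have e2 : ∑ b, f (b+u)^2 = 1 := by
      rw [← e3]; exact Equiv.sum_comp (Equiv.addRight u) (fun b => f b ^2)
    have : ∀ x, (f x - f (x+u))^2 = f x^2 + f (x+u)^2 - 2 * (f x * f (x+u)) := fun x => by ring
    simp only [Gsh, this, Finset.sum_sub_distrib, Finset.sum_add_distrib, e2, e3, ← Finset.mul_sum]
    norm_num
  have h4 : ∑ x, (c x)^2 = ∑ r, ∑ r', ν r * ν r' * ∑ x, f x * f (x + (r - r')) := by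
    have : ∀ r r' : ZMod p, ∑ x, f x * f (x + (r - r')) = ∑ x, f (x - r) * f (x - r') := by
      intro r r'
      rw [← Equiv.sum_comp (Equiv.subRight r)]
      refine Finset.sum_congr rfl fun x _ => ?_
      simp only [Equiv.subRight_apply]
      congr 2; ring
    have hsq : ∀ x, c x ^ 2 = ∑ r, ∑ r', (ν r * f (x - r)) * (ν r' * f (x - r')) := fun x => by
      rw [sq, hc, Finset.sum_mul_sum]
    simp only [this, hsq, Finset.mul_sum]
    rw [Finset.sum_comm]
    refine Finset.sum_congr rfl fun r _ => ?_
    rw [Finset.sum_comm]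
    refine Finset.sum_congr rfl fun r' _ => Finset.sum_congr rfl fun x _ => ?_
    ring
  simp only [h3] at hD
  have h5 : ∑ r, ∑ r', ν r * ν r' * (2 - 2 * ∑ x, f x * f (x + (r - r'))) = 2 - 2 * ∑ x, (c x)^2 := by
    rw [h4]
    have : ∀ r r' : ZMod p, ν r * ν r' * (2 - 2 * ∑ x, f x * f (x + (r - r'))) = 2 * (ν r * ν r') - 2 * (ν r * ν r' * ∑ x, f x * f (x + (r - r'))) := by
      intro r r'; ring
    simp only [this, Finset.sum_sub_distrib, ← Finset.mul_sum]
    simp only [hν1, mul_one]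
  rw [h5] at hD
  linarith

theorem stability (e : ℕ) (ν : ZMod p → ℝ) (hν : ∀ a, 0 ≤ ν a) (hν1 : ∑ a, ν a = 1) (η : ℝ)
    (hη : 1 - η ≤ Phi (e+3) ν) (hη0 : 0 ≤ η) (δ : ℝ) (hδ : δ = 4 * Real.sqrt ((e+3) * η)) (hδ1 : δ ≤ 1/32) :
    ∑ a, (Real.sqrt (ν a) - Real.sqrt (1/p))^2 ≤ 8 * (e+3) * η ∨ ∃ a, 1 - 2 * δ ≤ ν a := by
  have hpp : (0:ℝ) < p := by exact_mod_cast (Fact.out : p.Prime).pos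
  obtain ⟨s', hs'⟩ := Phi_stab e ν hν hν1 η hη
  set f : ZMod p → ℝ := fun a => Real.sqrt (ν a) with hfdef
  have hf : ∀ a, ν a = f a ^ 2 := fun a => (Real.sq_sqrt (hν a)).symm
  have hD := Gsh_avg ν f hν hν1 s' _ hs'
  set D := 4 * ((e+3) * η) with hDdef
  have hsD : 2 * Real.sqrt D = δ := by
    rw [hδ, hDdef, Real.sqrt_mul (by norm_num), show (4:ℝ) = 2^2 by norm_num, Real.sqrt_sq (by norm_num)]; ring
  have hδ0 : 0 ≤ δ := by rw [hδ]; positivity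
  have e3 : ∑ b, f b^2 = 1 := by
    rw [← hν1]
    exact Finset.sum_congr rfl fun b _ => (hf b).symm
  have dich : ∀ t, 1/2 ≤ ‖hat ν t‖^2 → 1 - ‖hat ν t‖^2 ≤ 2 * δ := by
    intro t ht
    have h1 := hat_dich ν f hν hf hν1 D hD t
    rw [hsD] at h1
    have h2 : 1/2 ≤ ‖hat ν t‖ := by nlinarith [norm_nonneg (hat ν t)]
    have h3 : 0 ≤ 1 - ‖hat ν t‖^2 := by
      have := hat_norm_le ν hν hν1 t
      nlinarith [norm_nonneg (hat ν t)]
    nlinarith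
  by_cases hcase : ∀ t, t ≠ 0 → ‖hat ν t‖^2 < 1/2
  · left
    have h1 := conv_bound ν f hf hν1 D hD
    have h2 : ∑ t, ‖hat f t‖^2 = p := by
      have := parseval (fun x => (f x : ℂ))
      simp only [Complex.norm_real, Real.norm_eq_abs, sq_abs, e3, mul_one] at this
      exact this
    have h3 : ∑ t, ‖hat f t‖^2 * ‖hat ν t‖^2 ≤ ‖hat f 0‖^2 + 1/2 * (p - ‖hat f 0‖^2) := by
      rw [← h2, ← Finset.add_sum_erase _ _ (mem_univ (0 : ZMod p))]
      have h0 : ‖hat ν 0‖^2 ≤ 1 := by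
        have := hat_norm_le ν hν hν1 0
        nlinarith [norm_nonneg (hat ν 0)]
      have h4 : ∑ t ∈ univ.erase (0 : ZMod p), ‖hat f t‖^2 * ‖hat ν t‖^2 ≤ ∑ t ∈ univ.erase (0 : ZMod p), ‖hat f t‖^2 * (1/2) := by
        refine Finset.sum_le_sum fun t ht => ?_
        exact mul_le_mul_of_nonneg_left (hcase t (by simpa using ht)).le (by positivity)
      rw [← Finset.add_sum_erase _ (fun t => ‖hat f t‖^2) (mem_univ (0 : ZMod p)), add_sub_cancel_left]
      rw [← Finset.sum_mul] at h4
      have : ‖hat f 0‖^2 * ‖hat ν 0‖^2 ≤ ‖hat f 0‖^2 := mul_le_of_le_one_right (by positivity) h0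
      linarith
    have h5 : (1 - D) * p ≤ ‖hat f 0‖^2 := by nlinarith
    have h6 : ‖hat f 0‖ = ∑ a, f a := by
      have : hat f 0 = ((∑ a, f a : ℝ) : ℂ) := by simp [hat]
      rw [this, Complex.norm_real, Real.norm_eq_abs, abs_of_nonneg]
      exact Finset.sum_nonneg fun a _ => Real.sqrt_nonneg _
    rw [h6] at h5
    set s := Real.sqrt (1/(p:ℝ)) with hs
    have hs2 : s^2 = 1/p := Real.sq_sqrt (by positivity)
    have hs0 : 0 ≤ s := Real.sqrt_nonneg _
    set S := ∑ a, f a with hS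
    have hS0 : 0 ≤ S := Finset.sum_nonneg fun a _ => Real.sqrt_nonneg _
    have h7 : ∑ a, (f a - s)^2 = 2 - 2 * (S * s) := by
      have : ∀ a, (f a - s)^2 = f a^2 + s^2 - 2 * (f a * s) := fun a => by ring
      simp only [this, Finset.sum_sub_distrib, Finset.sum_add_distrib, e3, ← Finset.mul_sum, ← Finset.sum_mul]
      simp only [sum_const, card_univ, ZMod.card, nsmul_eq_mul, hs2]
      field_simp; ring
    have h8 : 1 - D ≤ (S*s)^2 := by
      rw [mul_pow, hs2, mul_one_div, le_div_iff₀ hpp]; exact h5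
    rw [h7]
    have h10 : 0 ≤ S * s := mul_nonneg hS0 hs0
    have h11 : S * s ≤ 1 := by
      have : 0 ≤ ∑ a, (f a - s)^2 := Finset.sum_nonneg fun a _ => sq_nonneg _
      linarith
    nlinarith
  · right
    push Not at hcase
    obtain ⟨t0, ht0, ht1⟩ := hcase
    have hk : ∀ k : ℕ, 1 - ‖hat ν (k * t0)‖^2 ≤ 2 * δ := by
      intro k
      induction k with
      | zero =>
        have : hat ν 0 = 1 := by
          have h : hat ν 0 = ((∑ a, ν a : ℝ) : ℂ) := by simp [hat]
          rw [h, hν1]; simp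
        simp [this, hδ0]
      | succ k ih =>
        have h1 := hat_subadd ν hν hν1 (k * t0) t0
        have h2 := dich t0 ht1
        rw [show ((k+1:ℕ):ZMod p) * t0 = k * t0 + t0 by push_cast; ring]
        apply dich
        linarith
    have hall : ∀ t, 1 - 2 * δ ≤ ‖hat ν t‖^2 := by
      intro t
      have h := hk (t / t0).val
      rw [ZMod.natCast_val, ZMod.cast_id, div_mul_cancel₀ _ ht0] at h
      linarith
    have h1 := parseval (fun x => (ν x : ℂ))
    simp only [Complex.norm_real, Real.norm_eq_abs, sq_abs] at h1
    have h2 : (p:ℝ) * (1 - 2*δ) ≤ p * ∑ b, ν b^2 := by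
      rw [← h1]
      calc _ = ∑ t : ZMod p, (1 - 2*δ) := by rw [Finset.sum_const, card_univ, ZMod.card, nsmul_eq_mul]
        _ ≤ _ := Finset.sum_le_sum fun t _ => hall t
    have h3 := le_of_mul_le_mul_left h2 hpp
    by_contra hcon
    push Not at hcon
    have hex : ∃ a, 0 < ν a := by
      by_contra hh
      push Not at hh
      have : ∑ a, ν a ≤ 0 := Finset.sum_nonpos fun t _ => hh t
      linarith
    obtain ⟨a0, ha0⟩ := hex
    have : ∑ b, ν b^2 < ∑ b, ν b * (1 - 2*δ) := by
      refine Finset.sum_lt_sum (fun b _ => ?_) ⟨a0, mem_univ _, ?_⟩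
      · rw [sq]; exact mul_le_mul_of_nonneg_left (hcon b).le (hν b)
      · rw [sq]; exact mul_lt_mul_of_pos_left (hcon a0) ha0
    rw [← Finset.sum_mul, hν1, one_mul] at this
    linarith
end

section
variable {V F : Type*} [Fintype V] [DecidableEq V] [Fintype F] [DecidableEq F] [AddCommGroup F] {d : ℕ}

/-- number of pairs (matching, kernel vector) with given edge histogram -/
noncomputable def cnt (V : Type*) [Fintype V] [DecidableEq V] (d : ℕ) (N : F × F → ℕ) : ℝ :=
  ∑ v : V → F, (((MM (V × Fin d)).filter (fun σ => (∀ k, ∑ i, v (σ (k,i)).1 = 0) ∧ hist (lab v σ) = N)).card : ℝ)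

theorem LD0 (N : F × F → ℕ) (hN : ∑ b, N b = Fintype.card (V × Fin d)) (hsym : ∀ a b, N (a,b) = N (b,a))
    (hm : 0 < Fintype.card (V × Fin d))
    (x : F → F → ℝ) (hx : ∀ a b, 0 ≤ x a b) (hx0 : ∀ a b, N (a,b) ≠ 0 → 0 < x a b) (R : ℝ)
    (hR : (∑ a, ∑ z : Fin d → F, if ∑ i, z i = 0 then ∏ i, x a (z i) else 0) ≤ R) :
    cnt V d N ≤ (MM (V × Fin d)).card * ((Real.exp 1 * (Fintype.card (V × Fin d) + 1)) ^ (Fintype.card (F × F)) *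
      Real.exp (∑ b, N b * (Real.log (N b / Fintype.card (V × Fin d)) / 2 - Real.log (x b.1 b.2))) * R ^ (Fintype.card V)) := by
  set m := Fintype.card (V × Fin d) with hmdef
  have hm0 : (0:ℝ) < m := by exact_mod_cast hm
  set P : F × F → ℝ := fun b => (N b : ℝ) / m with hP
  have hP0 : ∀ b, 0 ≤ P b := fun b => by simp only [hP]; positivity
  have hPs : ∑ b, P b = 1 := by
    simp only [hP]
    rw [← Finset.sum_div, ← Nat.cast_sum, hN]; field_simp
  have hG := lemmaG (V := V) (d := d) (α := F) (fun _ z => ∑ i, z i = 0) x (fun a b => Real.sqrt (P (a,b)))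
    hx (fun a b => Real.sqrt_nonneg _) N
  rw [← hmdef] at hG
  have e1 : ∑ a, ∑ b, Real.sqrt (P (a,b)) * Real.sqrt (P (b,a)) = 1 := by
    rw [← hPs, Fintype.sum_prod_type]
    refine Finset.sum_congr rfl fun a _ => Finset.sum_congr rfl fun b _ => ?_
    have : P (b,a) = P (a,b) := by simp only [hP]; rw [hsym]
    rw [this, Real.mul_self_sqrt (hP0 _)]
  rw [e1, one_pow, mul_one] at hG
  have hfac := prod_factorial_le N m hN
  set E := (Real.exp 1 * ((m:ℝ)+1)) ^ (Fintype.card (F × F)) with hE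
  have hE0 : 0 ≤ E := by positivity
  set T : ℝ := ((MM (V × Fin d)).card : ℝ) with hT
  have hT0 : 0 ≤ T := by positivity
  set r := (∑ a, ∑ z : Fin d → F, if ∑ i, z i = 0 then ∏ i, x a (z i) else 0) with hr
  have hr0 : 0 ≤ r := by
    refine Finset.sum_nonneg fun a _ => Finset.sum_nonneg fun z _ => ?_
    split_ifs
    · exact Finset.prod_nonneg fun i _ => hx _ _
    · exact le_rfl
  have hrR := pow_le_pow_left₀ hr0 hR (Fintype.card V)
  set X := Real.exp (∑ b, N b * (Real.log (N b / m) / 2 - Real.log (x b.1 b.2))) with hX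
  set Q := ∏ b : F × F, (Real.sqrt (P b) * x b.1 b.2) ^ N b with hQ
  have hfacpos : ∀ b : F × F, 0 < (Real.sqrt (P b) * x b.1 b.2) ^ N b := by
    intro b
    by_cases hb : N b = 0
    · simp [hb]
    · have h1 : 0 < x b.1 b.2 := hx0 b.1 b.2 hb
      have h2 : 0 < P b := by
        have : (0:ℝ) < N b := by exact_mod_cast Nat.pos_of_ne_zero hb
        simp only [hP]; positivity
      have := Real.sqrt_pos.mpr h2
      positivity
  have hQ0 : 0 < Q := Finset.prod_pos fun b _ => hfacpos b
  have e2 : ∏ b, ((N b:ℝ)/m)^(N b) = Q * X := by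
    rw [hX, Real.exp_sum, hQ, ← Finset.prod_mul_distrib]
    refine Finset.prod_congr rfl fun b _ => ?_
    by_cases hb : N b = 0
    · simp [hb]
    · have h1 : 0 < x b.1 b.2 := hx0 b.1 b.2 hb
      have h2 : 0 < P b := by
        have : (0:ℝ) < N b := by exact_mod_cast Nat.pos_of_ne_zero hb
        simp only [hP]; positivity
      rw [Real.exp_nat_mul, ← mul_pow]
      congr 1
      change P b = _ * Real.exp (Real.log (P b) / 2 - _)
      rw [← Real.log_sqrt h2.le, Real.exp_sub, Real.exp_log h1, Real.exp_log (Real.sqrt_pos.mpr h2)]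
      field_simp
      rw [Real.sq_sqrt h2.le]
  rw [e2] at hfac
  have hf0 : (0:ℝ) < m.factorial := by positivity
  have hpos : 0 < m.factorial * Q := by positivity
  refine le_of_mul_le_mul_right ?_ hpos
  calc cnt V d N * (m.factorial * Q) = cnt V d N * m.factorial * Q := by ring
    _ ≤ T * (∏ b : F × F, (N b).factorial : ℕ) * r ^ (Fintype.card V) := hG
    _ ≤ T * (m.factorial * E * (Q * X)) * R ^ (Fintype.card V) := by
        have : ((∏ b : F × F, (N b).factorial : ℕ) : ℝ) ≤ m.factorial * E * (Q * X) := by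
          exact hfac
        have hX0 : 0 < X := Real.exp_pos _
        gcongr
    _ = _ := by ring

noncomputable def nuN (N : F × F → ℕ) (m : ℕ) (a : F) : ℝ := ∑ b, (N (a,b) : ℝ) / m

noncomputable def KLN (N : F × F → ℕ) (m : ℕ) : ℝ :=
  ∑ b : F × F, (N b : ℝ) / m * (Real.log ((N b : ℝ) / m) - Real.log (nuN N m b.1) - Real.log (nuN N m b.2))

theorem nuN_nonneg (N : F × F → ℕ) (m : ℕ) (a : F) : 0 ≤ nuN N m a :=
  Finset.sum_nonneg fun b _ => by positivity

theorem nuN_sum (N : F × F → ℕ) (m : ℕ) (hm : 0 < m) (hN : ∑ b, N b = m) : ∑ a, nuN N m a = 1 := by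
  have hm0 : (m:ℝ) ≠ 0 := by positivity
  unfold nuN
  rw [← Fintype.sum_prod_type (f := fun b : F × F => (N b : ℝ) / m), ← Finset.sum_div, ← Nat.cast_sum, hN]
  field_simp

theorem nuN_pos (N : F × F → ℕ) (m : ℕ) (hm : 0 < m) (a b : F) (h : N (a,b) ≠ 0) : 0 < nuN N m a := by
  have : (N (a,b) : ℝ) / m ≤ nuN N m a :=
    Finset.single_le_sum (f := fun b => (N (a,b) : ℝ) / m) (fun b _ => by positivity) (mem_univ b)
  have h2 : (0:ℝ) < N (a,b) := by exact_mod_cast Nat.pos_of_ne_zero h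
  have h3 : (0:ℝ) < m := by exact_mod_cast hm
  have : 0 < (N (a,b) : ℝ) / m := by positivity
  linarith

theorem row_phi (d : ℕ) (hd : 1 ≤ d) (c q : F → ℝ) (hc : 0 ≤ c 0) (ν : ℝ) (hν : 0 ≤ ν) :
    (∑ z : Fin d → F, if ∑ i, z i = 0 then ∏ i, (ν ^ ((d:ℝ)⁻¹) * q (z i) ^ (((d:ℝ)-1)/d)) else 0) = ν * Phi d q := by
  unfold Phi
  rw [Finset.mul_sum]
  refine Finset.sum_congr rfl fun z _ => ?_
  split_ifs
  · rw [Finset.prod_mul_distrib, Finset.prod_const, card_univ, Fintype.card_fin, Real.rpow_inv_natCast_pow hν (by omega)]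
  · simp

theorem sum_sym (N : F × F → ℕ) (m : ℕ) (hsym : ∀ a b, N (a,b) = N (b,a)) :
    ∑ b : F × F, (N b : ℝ) / m * Real.log (nuN N m b.2) = ∑ b : F × F, (N b : ℝ) / m * Real.log (nuN N m b.1) := by
  rw [← Equiv.sum_comp (Equiv.prodComm F F)]
  refine Finset.sum_congr rfl fun b _ => ?_
  simp only [Equiv.prodComm_apply, Prod.swap, Prod.snd]
  rw [hsym]

theorem LD1 (hd : 3 ≤ d) (N : F × F → ℕ) (hN : ∑ b, N b = Fintype.card (V × Fin d)) (hsym : ∀ a b, N (a,b) = N (b,a))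
    (hm : 0 < Fintype.card (V × Fin d)) :
    cnt V d N ≤ (MM (V × Fin d)).card * ((Real.exp 1 * (Fintype.card (V × Fin d) + 1)) ^ (Fintype.card (F × F)) *
      Real.exp (-(Fintype.card V * (d - 2) / 2 * KLN N (Fintype.card (V × Fin d))))) := by
  have hmc : ((Fintype.card (V × Fin d):ℕ):ℝ) = Fintype.card V * d := by simp
  set m := Fintype.card (V × Fin d) with hmdef
  have hm0 : (0:ℝ) < m := by exact_mod_cast hm
  have hd0 : (0:ℝ) < d := by positivity
  set q : F → F → ℝ := fun a b => (N (a,b) : ℝ) / m / nuN N m a with hq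
  have hq0 : ∀ a b, 0 ≤ q a b := fun a b => div_nonneg (by positivity) (nuN_nonneg _ _ _)
  have h := LD0 (V := V) (d := d) N hN hsym hm (fun a b => (nuN N m a) ^ ((d:ℝ)⁻¹) * q a b ^ (((d:ℝ)-1)/d))
    (fun a b => mul_nonneg (Real.rpow_nonneg (nuN_nonneg _ _ _) _) (Real.rpow_nonneg (hq0 _ _) _)) (by
      intro a b hab
      have h1 := nuN_pos N m hm a b hab
      have h2 : (0:ℝ) < N (a,b) := by exact_mod_cast Nat.pos_of_ne_zero hab
      have h3 : 0 < q a b := by simp only [hq]; positivity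
      positivity) 1 (by
      refine le_trans (Finset.sum_le_sum (g := fun a => nuN N m a) fun a _ => ?_) (nuN_sum N m hm hN).le
      rw [row_phi d (by omega) (fun _ => 0) (q a) le_rfl _ (nuN_nonneg _ _ _)]
      rcases (nuN_nonneg N m a).eq_or_lt with h0 | h0
      · rw [← h0]; simp
      · refine mul_le_of_le_one_right h0.le (Phi_le_one d (by omega) (q a) (hq0 a) ?_)
        simp only [hq]
        rw [← Finset.sum_div]
        exact div_self h0.ne')
  rw [one_pow, mul_one, ← hmdef] at h
  refine h.trans (le_of_eq ?_)
  congr 3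
  have key : ∀ b : F × F, (N b : ℝ) * (Real.log (N b / m) / 2 - Real.log ((nuN N m b.1) ^ ((d:ℝ)⁻¹) * q b.1 b.2 ^ (((d:ℝ)-1)/d)))
     = m * ((1/2 - ((d:ℝ)-1)/d) * ((N b : ℝ)/m * Real.log (N b / m)) + (((d:ℝ)-1)/d - (d:ℝ)⁻¹) * ((N b : ℝ)/m * Real.log (nuN N m b.1))) := by
    intro b
    by_cases hb : N b = 0
    · simp [hb]
    · have h1 := nuN_pos N m hm b.1 b.2 hb
      have h2 : (0:ℝ) < N b := by exact_mod_cast Nat.pos_of_ne_zero hb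
      have h3 : 0 < q b.1 b.2 := by
        simp only [hq]; positivity
      rw [Real.log_mul (by positivity) (by positivity), Real.log_rpow h1, Real.log_rpow h3]
      have : Real.log (q b.1 b.2) = Real.log (N b / m) - Real.log (nuN N m b.1) := by
        simp only [hq]
        exact Real.log_div (by positivity) h1.ne'
      rw [this]
      field_simp
      ring
  rw [Finset.sum_congr rfl fun b _ => key b, ← Finset.mul_sum, Finset.sum_add_distrib, ← Finset.mul_sum, ← Finset.mul_sum]
  unfold KLN
  simp only [mul_sub, Finset.sum_sub_distrib]
  rw [sum_sym N m hsym, hmc]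
  field_simp
  ring

theorem LD2 (hd : 3 ≤ d) (N : F × F → ℕ) (hN : ∑ b, N b = Fintype.card (V × Fin d)) (hsym : ∀ a b, N (a,b) = N (b,a))
    (hm : 0 < Fintype.card (V × Fin d)) :
    cnt V d N ≤ (MM (V × Fin d)).card * ((Real.exp 1 * (Fintype.card (V × Fin d) + 1)) ^ (Fintype.card (F × F)) *
      Real.exp (Fintype.card V * d / 2 * KLN N (Fintype.card (V × Fin d))) *
      (Phi d (nuN N (Fintype.card (V × Fin d)))) ^ (Fintype.card V)) := by
  have hmc : ((Fintype.card (V × Fin d):ℕ):ℝ) = Fintype.card V * d := by simp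
  set m := Fintype.card (V × Fin d) with hmdef
  have hm0 : (0:ℝ) < m := by exact_mod_cast hm
  have hd0 : (0:ℝ) < d := by positivity
  have h := LD0 (V := V) (d := d) N hN hsym hm (fun a b => (nuN N m a) ^ ((d:ℝ)⁻¹) * nuN N m b ^ (((d:ℝ)-1)/d))
    (fun a b => mul_nonneg (Real.rpow_nonneg (nuN_nonneg _ _ _) _) (Real.rpow_nonneg (nuN_nonneg _ _ _) _)) (by
      intro a b hab
      have h1 := nuN_pos N m hm a b hab
      rw [hsym] at hab
      have h2 := nuN_pos N m hm b a hab
      positivity) (Phi d (nuN N m)) (by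
      have : ∀ a, (∑ z : Fin d → F, if ∑ i, z i = 0 then ∏ i, ((nuN N m a) ^ ((d:ℝ)⁻¹) * nuN N m (z i) ^ (((d:ℝ)-1)/d)) else 0) = nuN N m a * Phi d (nuN N m) := by
        intro a
        exact row_phi d (by omega) (fun _ => 0) (nuN N m) le_rfl _ (nuN_nonneg _ _ _)
      simp only [this]
      rw [← Finset.sum_mul, nuN_sum N m hm hN, one_mul])
  rw [← hmdef] at h
  refine h.trans (le_of_eq ?_)
  congr 4
  have key : ∀ b : F × F, (N b : ℝ) * (Real.log (N b / m) / 2 - Real.log ((nuN N m b.1) ^ ((d:ℝ)⁻¹) * nuN N m b.2 ^ (((d:ℝ)-1)/d)))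
     = m * ((1/2) * ((N b : ℝ)/m * Real.log (N b / m)) - (d:ℝ)⁻¹ * ((N b : ℝ)/m * Real.log (nuN N m b.1)) - (((d:ℝ)-1)/d) * ((N b : ℝ)/m * Real.log (nuN N m b.2))) := by
    intro b
    by_cases hb : N b = 0
    · simp [hb]
    · have h1 := nuN_pos N m hm b.1 b.2 hb
      have hb2 := hb
      rw [show b = (b.1, b.2) from rfl, hsym] at hb2
      have h2 := nuN_pos N m hm b.2 b.1 hb2
      rw [Real.log_mul (by positivity) (by positivity), Real.log_rpow h1, Real.log_rpow h2]
      field_simp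
      ring
  rw [Finset.sum_congr rfl fun b _ => key b, ← Finset.mul_sum, Finset.sum_sub_distrib, Finset.sum_sub_distrib, ← Finset.mul_sum, ← Finset.mul_sum, ← Finset.mul_sum]
  unfold KLN
  simp only [mul_sub, Finset.sum_sub_distrib]
  rw [sum_sym N m hsym, hmc]
  field_simp
  ring
end

section
variable {V F : Type*} [Fintype V] [DecidableEq V] [Fintype F] [DecidableEq F] [AddCommGroup F] {d : ℕ}

/-- large deviation events for the edge histogram -/
def BadN (V : Type*) [Fintype V] (d : ℕ) (K : ℝ) (N : F × F → ℕ) : Prop :=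
  K ≤ Fintype.card V * KLN N (Fintype.card (V × Fin d)) ∨
    d * K ≤ Fintype.card V * (1 - Phi d (nuN N (Fintype.card (V × Fin d))))

theorem cnt_bad (hd : 3 ≤ d) (N : F × F → ℕ) (hN : ∑ b, N b = Fintype.card (V × Fin d)) (hsym : ∀ a b, N (a,b) = N (b,a))
    (hm : 0 < Fintype.card (V × Fin d)) (K : ℝ) (hK : 0 ≤ K) (hb : BadN V d K N) :
    cnt V d N ≤ (MM (V × Fin d)).card * ((Real.exp 1 * (Fintype.card (V × Fin d) + 1)) ^ (Fintype.card (F × F)) *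
      Real.exp (-(K / 2))) := by
  have hd3 : (3:ℝ) ≤ d := by exact_mod_cast hd
  by_cases h1 : K ≤ Fintype.card V * KLN N (Fintype.card (V × Fin d))
  · refine (LD1 hd N hN hsym hm).trans ?_
    gcongr
    have : (d - 2) / 2 * (Fintype.card V * KLN N (Fintype.card (V × Fin d))) ≥ 1 / 2 * K := by
      apply mul_le_mul _ h1 hK (by linarith)
      linarith
    linarith
  · have h2 : d * K ≤ Fintype.card V * (1 - Phi d (nuN N (Fintype.card (V × Fin d)))) := by
      rcases hb with h | h
      · exact absurd h h1
      · exact h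
    refine (LD2 hd N hN hsym hm).trans ?_
    rw [mul_assoc (_ ^ _) (Real.exp _)]
    have h3 := Phi_nonneg d (nuN N (Fintype.card (V × Fin d))) (nuN_nonneg _ _)
    have h4 : Phi d (nuN N (Fintype.card (V × Fin d))) ≤ Real.exp (-(1 - Phi d (nuN N (Fintype.card (V × Fin d))))) := by
      have := Real.add_one_le_exp (-(1 - Phi d (nuN N (Fintype.card (V × Fin d)))))
      linarith
    have h5 := pow_le_pow_left₀ h3 h4 (Fintype.card V)
    rw [← Real.exp_nat_mul] at h5
    gcongr
    refine (mul_le_mul_of_nonneg_left h5 (Real.exp_pos _).le).trans ?_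
    rw [← Real.exp_add]
    gcongr
    push Not at h1
    have : (d:ℝ) / 2 * (Fintype.card V * KLN N (Fintype.card (V × Fin d))) ≤ d / 2 * K := by gcongr
    nlinarith

theorem LD_total (hd : 3 ≤ d) (hm : 0 < Fintype.card (V × Fin d)) (K : ℝ) (hK : 0 ≤ K) (S : Finset (Equiv.Perm (V × Fin d)))
    (hS : ∀ σ ∈ S, σ ∈ MM (V × Fin d) ∧ ∃ v : V → F, (∀ k, ∑ i, v (σ (k,i)).1 = 0) ∧ BadN V d K (hist (lab v σ))) :
    (S.card : ℝ)
    ≤ (MM (V × Fin d)).card * (((Fintype.card (V × Fin d) : ℝ) + 1) ^ (Fintype.card (F × F)) * ((Real.exp 1 * (Fintype.card (V × Fin d) + 1)) ^ (Fintype.card (F × F)) *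
      Real.exp (-(K / 2)))) := by
  classical
  set m := Fintype.card (V × Fin d) with hmdef
  set Ns : Finset (F × F → ℕ) := (Fintype.piFinset (fun _ : F × F => range (m+1))).filter
    (fun N => (∑ b, N b = m) ∧ (∀ a b, N (a,b) = N (b,a)) ∧ BadN V d K N) with hNs
  have hsub : S ⊆ Ns.biUnion (fun N => (univ : Finset (V → F)).biUnion (fun v => (MM (V × Fin d)).filter (fun σ => (∀ k, ∑ i, v (σ (k,i)).1 = 0) ∧ hist (lab v σ) = N))) := by
    intro σ hσ
    obtain ⟨hσM, v, hv, hb⟩ := hS σ hσ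
    rw [mem_biUnion]
    refine ⟨hist (lab v σ), ?_, ?_⟩
    · rw [hNs, mem_filter]
      refine ⟨?_, sum_hist _, fun a b => hist_lab_symm v σ (by simpa [MM] using hσM) a b, hb⟩
      rw [Fintype.mem_piFinset]
      intro b
      rw [mem_range]
      exact Nat.lt_succ_of_le (hist_le _ _)
    · rw [mem_biUnion]
      exact ⟨v, mem_univ _, mem_filter.mpr ⟨hσM, hv, rfl⟩⟩
  have h1 := (card_le_card hsub).trans (card_biUnion_le.trans (Finset.sum_le_sum fun N _ => card_biUnion_le))
  have h2 : (S.card : ℝ) ≤ ∑ N ∈ Ns, cnt V d N := by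
    unfold cnt
    exact_mod_cast h1
  refine h2.trans ((Finset.sum_le_card_nsmul Ns _ ((MM (V × Fin d)).card * ((Real.exp 1 * (m + 1)) ^ (Fintype.card (F × F)) * Real.exp (-(K / 2)))) (fun N hN => ?_)).trans ?_)
  · rw [hNs, mem_filter] at hN
    exact cnt_bad hd N hN.2.1 hN.2.2.1 hm K hK hN.2.2.2
  · rw [nsmul_eq_mul]
    have hc : (Ns.card : ℝ) ≤ ((m:ℝ) + 1) ^ (Fintype.card (F × F)) := by
      have : Ns.card ≤ (m+1) ^ (Fintype.card (F × F)) := by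
        refine (card_filter_le _ _).trans ?_
        rw [Fintype.card_piFinset]
        simp
      exact_mod_cast this
    calc _ ≤ ((m:ℝ) + 1) ^ (Fintype.card (F × F)) * ((MM (V × Fin d)).card * ((Real.exp 1 * (m + 1)) ^ (Fintype.card (F × F)) * Real.exp (-(K / 2)))) := by gcongr
      _ = _ := by ring
end

section
variable {V F : Type*} [Fintype V] [DecidableEq V] [Fintype F] [DecidableEq F] [AddCommGroup F] {d : ℕ}

theorem sum_cast_one (N : F × F → ℕ) (m : ℕ) (hm : 0 < m) (hN : ∑ b, N b = m) : ∑ b, (N b : ℝ) / m = 1 := by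
  have hm0 : (m:ℝ) ≠ 0 := by positivity
  rw [← Finset.sum_div, ← Nat.cast_sum, hN]
  field_simp

theorem sum_nunu (N : F × F → ℕ) (m : ℕ) (hm : 0 < m) (hN : ∑ b, N b = m) :
    ∑ b : F × F, nuN N m b.1 * nuN N m b.2 = 1 := by
  rw [Fintype.sum_prod_type]
  simp only
  simp_rw [← Finset.mul_sum, nuN_sum N m hm hN, mul_one]
  exact nuN_sum N m hm hN

theorem KL_hell (N : F × F → ℕ) (m : ℕ) (hm : 0 < m) (hN : ∑ b, N b = m) (hsym : ∀ a b, N (a,b) = N (b,a)) :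
    ∑ b : F × F, (Real.sqrt ((N b : ℝ) / m) - Real.sqrt (nuN N m b.1 * nuN N m b.2)) ^ 2 ≤ KLN N m := by
  have h1 : ∀ b : F × F, 2 * ((N b : ℝ)/m) - 2 * (Real.sqrt ((N b : ℝ) / m) * Real.sqrt (nuN N m b.1 * nuN N m b.2)) ≤
      (N b : ℝ) / m * (Real.log ((N b : ℝ) / m) - Real.log (nuN N m b.1) - Real.log (nuN N m b.2)) := by
    intro b
    by_cases hb : N b = 0
    · simp [hb]
    · have h1 := nuN_pos N m hm b.1 b.2 hb
      have hb2 := hb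
      rw [show b = (b.1, b.2) from rfl, hsym] at hb2
      have h2 := nuN_pos N m hm b.2 b.1 hb2
      have h3 : (0:ℝ) < N b := by exact_mod_cast Nat.pos_of_ne_zero hb
      have hm0 : (0:ℝ) < m := by exact_mod_cast hm
      set P := (N b : ℝ) / m with hP
      have hP0 : 0 < P := by positivity
      set Q := nuN N m b.1 * nuN N m b.2 with hQ
      have hQ0 : 0 < Q := by positivity
      have e : Real.log P - Real.log (nuN N m b.1) - Real.log (nuN N m b.2) = Real.log P - Real.log Q := by
        rw [hQ, Real.log_mul h1.ne' h2.ne']; ring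
      rw [e]
      have hl := Real.log_le_sub_one_of_pos (x := Real.sqrt Q / Real.sqrt P) (by positivity)
      rw [Real.log_div (by positivity) (by positivity), Real.log_sqrt hQ0.le, Real.log_sqrt hP0.le] at hl
      have hs : Real.sqrt P * Real.sqrt Q = P * (Real.sqrt Q / Real.sqrt P) := by
        have : P = Real.sqrt P * Real.sqrt P := (Real.mul_self_sqrt hP0.le).symm
        have h0 : Real.sqrt P ≠ 0 := by positivity
        nth_rewrite 2 [this]
        field_simp
      rw [hs]
      nlinarith
  have h2 := Finset.sum_le_sum (s := univ) fun b _ => h1 b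
  rw [Finset.sum_sub_distrib, ← Finset.mul_sum, sum_cast_one N m hm hN] at h2
  have h3 : ∑ b : F × F, (Real.sqrt ((N b : ℝ) / m) - Real.sqrt (nuN N m b.1 * nuN N m b.2)) ^ 2
     = ∑ b : F × F, ((N b : ℝ)/m + nuN N m b.1 * nuN N m b.2 - 2 * (Real.sqrt ((N b : ℝ) / m) * Real.sqrt (nuN N m b.1 * nuN N m b.2))) := by
    refine Finset.sum_congr rfl fun b _ => ?_
    rw [sub_sq, Real.sq_sqrt (by positivity), Real.sq_sqrt (mul_nonneg (nuN_nonneg _ _ _) (nuN_nonneg _ _ _))]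
    ring
  rw [h3, Finset.sum_sub_distrib, Finset.sum_add_distrib, sum_cast_one N m hm hN, sum_nunu N m hm hN]
  unfold KLN
  linarith

/-- near uniform edge histogram -/
def GoodN {F : Type*} [Fintype F] (N : F × F → ℕ) (m : ℕ) (ε : ℝ) : Prop :=
  ∑ b, (Real.sqrt ((N b : ℝ) / m) - 1 / Fintype.card F) ^ 2 ≤ ε

theorem prod_unif [Nonempty F] (ν : F → ℝ) (h0 : ∀ a, 0 ≤ ν a) (h1 : ∑ a, ν a = 1) :
    ∑ b : F × F, (Real.sqrt (ν b.1 * ν b.2) - 1 / Fintype.card F) ^ 2 ≤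
      2 * ∑ a, (Real.sqrt (ν a) - Real.sqrt (1 / Fintype.card F)) ^ 2 := by
  set u := Real.sqrt (1 / (Fintype.card F : ℝ)) with hu
  have hp : (0:ℝ) < Fintype.card F := by exact_mod_cast Fintype.card_pos
  have huu : u * u = 1 / Fintype.card F := Real.mul_self_sqrt (by positivity)
  have hu0 : 0 ≤ u := Real.sqrt_nonneg _
  set S := ∑ a, Real.sqrt (ν a) * u with hS
  have hS0 : 0 ≤ S := Finset.sum_nonneg fun a _ => by positivity
  have e1 : ∑ a, (Real.sqrt (ν a) - u) ^ 2 = 2 - 2 * S := by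
    have : ∀ a, (Real.sqrt (ν a) - u) ^ 2 = ν a + 1 / Fintype.card F - 2 * (Real.sqrt (ν a) * u) := by
      intro a
      rw [sub_sq, Real.sq_sqrt (h0 a), ← huu]; ring
    simp_rw [this]
    rw [Finset.sum_sub_distrib, Finset.sum_add_distrib, h1, ← Finset.mul_sum, ← hS, Finset.sum_const, card_univ, nsmul_eq_mul]
    field_simp
    ring
  have hS1 : S ≤ 1 := by
    have : 0 ≤ ∑ a, (Real.sqrt (ν a) - u) ^ 2 := Finset.sum_nonneg fun a _ => sq_nonneg _
    linarith
  have e2 : ∑ b : F × F, (Real.sqrt (ν b.1 * ν b.2) - 1 / Fintype.card F) ^ 2 = 2 - 2 * S ^ 2 := by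
    have : ∀ b : F × F, (Real.sqrt (ν b.1 * ν b.2) - 1 / Fintype.card F) ^ 2 = ν b.1 * ν b.2 + 1 / Fintype.card F * (1 / Fintype.card F) - 2 * ((Real.sqrt (ν b.1) * u) * (Real.sqrt (ν b.2) * u)) := by
      intro b
      rw [sub_sq, Real.sq_sqrt (mul_nonneg (h0 _) (h0 _)), Real.sqrt_mul (h0 _), ← huu]; ring
    simp_rw [this]
    have a1 : ∀ f : F → ℝ, ∑ b : F × F, f b.1 * f b.2 = (∑ a, f a) * (∑ a, f a) := by
      intro f
      rw [Finset.sum_mul_sum, Fintype.sum_prod_type]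
    rw [Finset.sum_sub_distrib, Finset.sum_add_distrib, Finset.sum_const, ← Finset.mul_sum, card_univ, nsmul_eq_mul,
      a1 ν, a1 (fun a => Real.sqrt (ν a) * u), h1, ← hS]
    rw [Fintype.card_prod]
    push_cast
    field_simp
    ring
  rw [e1, e2]
  nlinarith

theorem good_or_conc {p : ℕ} [Fact p.Prime] (hd : 3 ≤ d) (N : ZMod p × ZMod p → ℕ) (hN : ∑ b, N b = Fintype.card (V × Fin d))
    (hsym : ∀ a b, N (a,b) = N (b,a)) (hV : 0 < Fintype.card V) (K : ℝ) (hK : 0 ≤ K) (hb : ¬ BadN V d K N)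
    (δ : ℝ) (hδ : δ = 4 * Real.sqrt (d * (d * K / Fintype.card V))) (hδ1 : δ ≤ 1/32) :
    GoodN N (Fintype.card (V × Fin d)) ((2 + 32 * d^2) * K / Fintype.card V) ∨ ∃ a, 1 - 2 * δ ≤ nuN N (Fintype.card (V × Fin d)) a := by
  have hm : 0 < Fintype.card (V × Fin d) := by simp; constructor <;> omega
  unfold BadN at hb
  push Not at hb
  set m := Fintype.card (V × Fin d) with hmdef
  obtain ⟨hb1, hb2⟩ := hb
  have hV0 : (0:ℝ) < Fintype.card V := by exact_mod_cast hV
  obtain ⟨e, rfl⟩ : ∃ e, d = e + 3 := ⟨d - 3, by omega⟩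
  have hs := stability e (nuN N m) (nuN_nonneg N m) (nuN_sum N m hm hN) (((e+3:ℕ):ℝ) * K / Fintype.card V) (by
      have : 1 - Phi (e+3) (nuN N m) ≤ ((e+3:ℕ):ℝ) * K / Fintype.card V := by
        rw [le_div_iff₀ hV0]; linarith
      linarith) (by positivity) δ (by rw [hδ]; push_cast; rfl) hδ1
  rcases hs with hs | hs
  · left
    unfold GoodN
    have h1 := KL_hell N m hm hN hsym
    have h2 := prod_unif (nuN N m) (nuN_nonneg N m) (nuN_sum N m hm hN)
    rw [ZMod.card] at h2
    have hKL : KLN N m ≤ K / Fintype.card V := by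
      rw [le_div_iff₀ hV0]; linarith
    have h3 : ∑ b, (Real.sqrt ((N b : ℝ) / m) - 1 / Fintype.card (ZMod p)) ^ 2 ≤
      2 * ∑ b : ZMod p × ZMod p, (Real.sqrt ((N b : ℝ) / m) - Real.sqrt (nuN N m b.1 * nuN N m b.2)) ^ 2 +
      2 * ∑ b : ZMod p × ZMod p, (Real.sqrt (nuN N m b.1 * nuN N m b.2) - 1 / Fintype.card (ZMod p)) ^ 2 := by
      rw [Finset.mul_sum, Finset.mul_sum, ← Finset.sum_add_distrib]
      refine Finset.sum_le_sum fun b _ => ?_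
      nlinarith [sq_nonneg ((Real.sqrt ((N b : ℝ) / m) - Real.sqrt (nuN N m b.1 * nuN N m b.2)) - (Real.sqrt (nuN N m b.1 * nuN N m b.2) - 1 / Fintype.card (ZMod p)))]
    rw [ZMod.card] at h3 ⊢
    have e1 : (2 + 32 * ((e+3:ℕ):ℝ)^2) * K / Fintype.card V = 2 * (K / Fintype.card V) + 4 * (8 * ((e:ℝ)+3) * (((e+3:ℕ):ℝ) * K / Fintype.card V)) := by
      push_cast
      field_simp
      ring
    rw [e1]
    linarith
  · exact Or.inr hs
end

section
variable {V F : Type*} [Fintype V] [DecidableEq V] [Fintype F] [DecidableEq F]  {d : ℕ}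

theorem nuN_lab (hd : 0 < d) (v : V → F) (σ : Equiv.Perm (V × Fin d)) (a : F) :
    nuN (hist (lab v σ)) (Fintype.card (V × Fin d)) a = ((univ.filter (fun k => v k = a)).card : ℝ) / Fintype.card V := by
  unfold nuN
  rw [← Finset.sum_div, ← Nat.cast_sum, hist_lab_row]
  have : (d:ℝ) ≠ 0 := by positivity
  rw [Fintype.card_prod, Fintype.card_fin]
  push_cast
  rw [mul_comm (d:ℝ)]
  exact mul_div_mul_right _ _ this

theorem conc_supp {p : ℕ} [Fact p.Prime] (hd : 3 ≤ d) (hp : d < p) (v : V → ZMod p) (hv : v ≠ 0)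
    (σ : Equiv.Perm (V × Fin d)) 
    (hker : ∀ k, ∑ i, v (σ (k,i)).1 = 0) (δ : ℝ) (hδ : 2 * δ * d < 1) (a : ZMod p)
    (ha : 1 - 2 * δ ≤ nuN (hist (lab v σ)) (Fintype.card (V × Fin d)) a) (s1 : ℕ) (hs1 : 2 * δ * Fintype.card V ≤ s1) :
    ∃ S : Finset V, S.Nonempty ∧ S.card ≤ s1 ∧ ∀ k, (univ.filter (fun i : Fin d => (σ (k,i)).1 ∈ S)).card ≠ 1 := by
  obtain ⟨k0, hk0⟩ : ∃ k, v k ≠ 0 := by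
    by_contra h
    push Not at h
    exact hv (funext h)
  have hV : (0:ℝ) < Fintype.card V := by
    have : 0 < Fintype.card V := Fintype.card_pos_iff.mpr ⟨k0⟩
    exact_mod_cast this
  rw [nuN_lab (by omega)] at ha
  have hsplit := card_filter_add_card_filter_not (s := (univ : Finset V)) (fun k => v k = a)
  rw [card_univ] at hsplit
  have hsplit' : ((univ.filter (fun k => v k = a)).card : ℝ) + ((univ.filter (fun k => ¬ v k = a)).card : ℝ) = Fintype.card V := by
    exact_mod_cast hsplit
  rw [le_div_iff₀ hV] at ha
  have hne : ((univ.filter (fun k => ¬ v k = a)).card : ℝ) ≤ 2 * δ * Fintype.card V := by linarith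
  by_cases h0 : a = 0
  · subst h0
    refine ⟨univ.filter (fun k => ¬ v k = 0), ⟨k0, by simp [hk0]⟩, ?_, ?_⟩
    · exact_mod_cast hne.trans hs1
    · intro k hk
      rw [card_eq_one] at hk
      obtain ⟨i0, hi0⟩ := hk
      have h1 : ∀ i, v (σ (k,i)).1 ≠ 0 ↔ i = i0 := by
        intro i
        have := Finset.ext_iff.mp hi0 i
        simpa using this
      have h2 := hker k
      rw [Finset.sum_eq_single i0 (fun i _ hi => by
        by_contra hc
        exact hi ((h1 i).mp hc)) (by simp)] at h2
      exact (h1 i0).mpr rfl h2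
  · exfalso
    have hex : ∀ k, ∃ i, v (σ (k,i)).1 ≠ a := by
      intro k
      by_contra hc
      push Not at hc
      have h2 := hker k
      simp only [hc, sum_const, card_univ, Fintype.card_fin, nsmul_eq_mul] at h2
      rcases mul_eq_zero.mp h2 with h3 | h3
      · rw [ZMod.natCast_eq_zero_iff] at h3
        have := Nat.le_of_dvd (by omega) h3
        omega
      · exact h0 h3
    choose f hf using hex
    have hinj : (univ : Finset V).card ≤ ((univ.filter (fun k => ¬ v k = a)) ×ˢ (univ : Finset (Fin d))).card := by
      refine Finset.card_le_card_of_injOn (fun k => σ (k, f k)) ?_ ?_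
      · intro k _
        simp only [coe_product, Set.mem_prod, mem_coe, mem_filter, mem_univ, true_and, and_true]
        exact hf k
      · intro k _ k' _ hkk
        have := σ.injective hkk
        exact (Prod.ext_iff.mp this).1
    rw [card_product, card_univ, card_univ, Fintype.card_fin] at hinj
    have h5 : (Fintype.card V : ℝ) ≤ ((univ.filter (fun k => ¬ v k = a)).card : ℝ) * d := by exact_mod_cast hinj
    have hd0 : (0:ℝ) < d := by positivity
    have h6 := mul_le_mul_of_nonneg_right hne hd0.le
    nlinarith
end

section
variable {F : Type*} [Fintype F] [DecidableEq F] [Nonempty F]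

noncomputable def epsr (P : F × F → ℝ) (a : F) : ℝ := ∑ b, (Real.sqrt (P (a,b)) - 1 / Fintype.card F) ^ 2

theorem epsr_nonneg (P : F × F → ℝ) (a : F) : 0 ≤ epsr P a := Finset.sum_nonneg fun _ _ => sq_nonneg _

theorem sum_epsr (P : F × F → ℝ) : ∑ a, epsr P a = ∑ b, (Real.sqrt (P b) - 1 / Fintype.card F) ^ 2 := by
  rw [Fintype.sum_prod_type]; rfl

theorem entry_bounds (P : F × F → ℝ) (ε : ℝ) (h : ∑ b, (Real.sqrt (P b) - 1 / Fintype.card F) ^ 2 ≤ ε)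
    (hε : (Fintype.card F : ℝ)^2 * ε ≤ 1/100) (b : F × F) :
    9/10 / Fintype.card F ≤ Real.sqrt (P b) ∧ Real.sqrt (P b) ≤ 11/10 / Fintype.card F := by
  have hp : (0:ℝ) < Fintype.card F := by exact_mod_cast Fintype.card_pos
  have h1 := (Finset.single_le_sum (f := fun b => (Real.sqrt (P b) - 1 / Fintype.card F) ^ 2) (fun b _ => sq_nonneg _) (mem_univ b)).trans h
  have h2 : (Real.sqrt (P b) - 1 / Fintype.card F) ^ 2 ≤ (1/10 / Fintype.card F)^2 := by
    refine h1.trans ?_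
    rw [div_pow, le_div_iff₀ (by positivity)]
    linarith
  have h3 := abs_le_of_sq_le_sq' h2 (by positivity)
  constructor
  · have := h3.1
    have e : 9/10 / (Fintype.card F:ℝ) = 1 / Fintype.card F - 1/10 / Fintype.card F := by ring
    linarith
  · have := h3.2
    have e : 11/10 / (Fintype.card F:ℝ) = 1 / Fintype.card F + 1/10 / Fintype.card F := by ring
    linarith

theorem row_bounds (P : F × F → ℝ) (hP : ∀ b, 0 ≤ P b) (ε : ℝ) (h : ∑ b, (Real.sqrt (P b) - 1 / Fintype.card F) ^ 2 ≤ ε)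
    (hε : (Fintype.card F : ℝ)^2 * ε ≤ 1/100) (a : F) :
    81/100 / Fintype.card F ≤ ∑ b, P (a,b) ∧ ∑ b, P (a,b) ≤ 121/100 / Fintype.card F := by
  have hp : (0:ℝ) < Fintype.card F := by exact_mod_cast Fintype.card_pos
  constructor
  · have : ∑ b : F, (9/10 / (Fintype.card F:ℝ))^2 ≤ ∑ b, P (a,b) := by
      refine Finset.sum_le_sum fun b _ => ?_
      rw [← Real.sq_sqrt (hP (a,b))]
      exact pow_le_pow_left₀ (by positivity) (entry_bounds P ε h hε (a,b)).1 2
    rw [Finset.sum_const, card_univ, nsmul_eq_mul] at this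
    refine le_trans (le_of_eq ?_) this
    field_simp; norm_num
  · have : ∑ b, P (a,b) ≤ ∑ b : F, (11/10 / (Fintype.card F:ℝ))^2 := by
      refine Finset.sum_le_sum fun b _ => ?_
      rw [← Real.sq_sqrt (hP (a,b))]
      exact pow_le_pow_left₀ (by positivity) (entry_bounds P ε h hε (a,b)).2 2
    rw [Finset.sum_const, card_univ, nsmul_eq_mul] at this
    refine le_trans this (le_of_eq ?_)
    field_simp; norm_num

/-- squared deviation of entries -/
theorem entry_sq (P : F × F → ℝ) (hP : ∀ b, 0 ≤ P b) (ε : ℝ) (h : ∑ b, (Real.sqrt (P b) - 1 / Fintype.card F) ^ 2 ≤ ε)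
    (hε : (Fintype.card F : ℝ)^2 * ε ≤ 1/100) (b : F × F) :
    (P b - 1 / (Fintype.card F:ℝ)^2)^2 ≤ (Real.sqrt (P b) - 1 / Fintype.card F) ^ 2 * (441/100 / (Fintype.card F:ℝ)^2) := by
  have hp : (0:ℝ) < Fintype.card F := by exact_mod_cast Fintype.card_pos
  have e : P b - 1 / (Fintype.card F:ℝ)^2 = (Real.sqrt (P b) - 1 / Fintype.card F) * (Real.sqrt (P b) + 1 / Fintype.card F) := by
    have := Real.mul_self_sqrt (hP b)
    linear_combination -this
  rw [e, mul_pow]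
  have h1 := (entry_bounds P ε h hε b).2
  have h2 : Real.sqrt (P b) + 1 / Fintype.card F ≤ 21/10 / Fintype.card F := by
    have e : 21/10 / (Fintype.card F:ℝ) = 11/10 / Fintype.card F + 1 / Fintype.card F := by ring
    linarith
  have h3 : (Real.sqrt (P b) + 1 / Fintype.card F)^2 ≤ (21/10 / Fintype.card F)^2 := by gcongr
  refine mul_le_mul_of_nonneg_left (h3.trans (le_of_eq ?_)) (sq_nonneg _)
  rw [div_pow]; norm_num

theorem var_min (q : F → ℝ) (hq : ∑ b, q b = 1) (t : ℝ) :
    (Fintype.card F : ℝ) * ∑ b, q b ^ 2 - 1 ≤ Fintype.card F * ∑ b, (q b - t)^2 := by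
  have e : ∑ b, (q b - t)^2 = ∑ b, q b ^2 - 2 * t + Fintype.card F * t^2 := by
    have : ∀ b, (q b - t)^2 = q b ^ 2 - (2 * t) * q b + t^2 := fun b => by ring
    simp_rw [this]
    rw [Finset.sum_add_distrib, Finset.sum_sub_distrib, ← Finset.mul_sum, hq]
    simp
  rw [e]
  nlinarith [sq_nonneg ((Fintype.card F:ℝ) * t - 1)]

theorem row_kap (P : F × F → ℝ) (hP : ∀ b, 0 ≤ P b) (ε : ℝ) (h : ∑ b, (Real.sqrt (P b) - 1 / Fintype.card F) ^ 2 ≤ ε)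
    (hε : (Fintype.card F : ℝ)^2 * ε ≤ 1/100) (a : F) :
    (Fintype.card F : ℝ) * ∑ b, (P (a,b) / ∑ b', P (a,b'))^2 - 1 ≤ 7 * Fintype.card F * epsr P a := by
  have hp : (0:ℝ) < Fintype.card F := by exact_mod_cast Fintype.card_pos
  obtain ⟨h1, h2⟩ := row_bounds P hP ε h hε a
  set ν := ∑ b', P (a,b') with hν
  have hν0 : 0 < ν := lt_of_lt_of_le (by positivity) h1
  have hs : ∑ b, P (a,b) / ν = 1 := by
    rw [← Finset.sum_div, ← hν]; field_simp
  refine (var_min _ hs (1 / (Fintype.card F:ℝ)^2 / ν)).trans ?_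
  rw [mul_comm (7:ℝ), mul_assoc]
  gcongr
  unfold epsr
  rw [Finset.mul_sum]
  refine Finset.sum_le_sum fun b _ => ?_
  rw [← sub_div, div_pow, div_le_iff₀ (by positivity)]
  refine (entry_sq P hP ε h hε (a,b)).trans ?_
  have h3 : (81/100 / (Fintype.card F:ℝ))^2 ≤ ν^2 := by gcongr
  have h4 : 441/100 / (Fintype.card F:ℝ)^2 ≤ 7 * ν^2 := by
    refine le_trans ?_ (mul_le_mul_of_nonneg_left h3 (by norm_num))
    rw [div_pow, ← mul_div_assoc]
    gcongr
    norm_num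
  have := mul_le_mul_of_nonneg_left h4 (sq_nonneg (Real.sqrt (P (a,b)) - 1 / Fintype.card F))
  linarith

theorem nu_kap (P : F × F → ℝ) (hP : ∀ b, 0 ≤ P b) (hP1 : ∑ b, P b = 1) (ε : ℝ) (h : ∑ b, (Real.sqrt (P b) - 1 / Fintype.card F) ^ 2 ≤ ε)
    (hε : (Fintype.card F : ℝ)^2 * ε ≤ 1/100) :
    (Fintype.card F : ℝ) * ∑ a, (∑ b, P (a,b))^2 - 1 ≤ 5 * ε := by
  have hp : (0:ℝ) < Fintype.card F := by exact_mod_cast Fintype.card_pos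
  refine (var_min (fun a => ∑ b, P (a,b)) (by rw [← hP1, Fintype.sum_prod_type]) (1 / Fintype.card F)).trans ?_
  have key : ∀ a, ((∑ b, P (a,b)) - 1 / Fintype.card F)^2 ≤ 441/100 / Fintype.card F * epsr P a := by
    intro a
    have e : (∑ b, P (a,b)) - 1 / Fintype.card F = ∑ b, (P (a,b) - 1 / (Fintype.card F:ℝ)^2) := by
      rw [Finset.sum_sub_distrib, Finset.sum_const, card_univ, nsmul_eq_mul]
      field_simp
    rw [e]
    refine (sq_sum_le_card_mul_sum_sq).trans ?_
    rw [card_univ]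
    have : ∑ b, (P (a,b) - 1 / (Fintype.card F:ℝ)^2)^2 ≤ epsr P a * (441/100 / (Fintype.card F:ℝ)^2) := by
      unfold epsr
      rw [Finset.sum_mul]
      exact Finset.sum_le_sum fun b _ => entry_sq P hP ε h hε (a,b)
    refine (mul_le_mul_of_nonneg_left this hp.le).trans (le_of_eq ?_)
    field_simp
  have h2 := Finset.sum_le_sum (s := univ) fun a _ => key a
  rw [← Finset.mul_sum, sum_epsr] at h2
  have h3 := mul_le_mul_of_nonneg_left h2 hp.le
  have hS : 0 ≤ ∑ b, (Real.sqrt (P b) - 1 / Fintype.card F) ^ 2 := Finset.sum_nonneg fun b _ => sq_nonneg _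
  refine h3.trans ?_
  rw [← mul_assoc, mul_div_cancel₀ _ hp.ne']
  linarith
end

section
variable {n d p : ℕ} [Fact p.Prime]

theorem mul_sqrt_mono (x A : ℝ) (hA : 0 ≤ A) (h : x ≤ A) : x * Real.sqrt x ≤ A * Real.sqrt A := by
  rcases le_total x 0 with hx | hx
  · rw [Real.sqrt_eq_zero_of_nonpos hx, mul_zero]; positivity
  · exact mul_le_mul h (Real.sqrt_le_sqrt h) (Real.sqrt_nonneg _) hA

theorem hist_class (v : Fin n → ZMod p) (σ : Equiv.Perm (Fin n × Fin d)) (a b : ZMod p) :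
    hist (fun h : {k : Fin n // v k = a} × Fin d => v (σ (h.1.1, h.2)).1) b = hist (lab v σ) (a,b) := by
  unfold hist lab
  refine Finset.card_bij (fun h _ => (h.1.1, h.2)) ?_ ?_ ?_
  · intro h hh
    simp only [mem_filter, mem_univ, true_and, Prod.mk.injEq] at hh ⊢
    exact ⟨h.1.2, hh⟩
  · intro h _ h' _ e
    simp only [Prod.mk.injEq] at e
    exact Prod.ext (Subtype.ext e.1) e.2
  · intro h hh
    simp only [mem_filter, mem_univ, true_and, Prod.mk.injEq] at hh
    exact ⟨(⟨h.1, hh.1⟩, h.2), by simp [hh.2], rfl⟩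

theorem sum_class (v : Fin n → ZMod p) (f : Fin n × Fin d → ZMod p) (a : ZMod p) :
    ∑ h : {k : Fin n // v k = a} × Fin d, f (h.1.1, h.2) = ∑ h ∈ univ.filter (fun h : Fin n × Fin d => v h.1 = a), f h := by
  refine Finset.sum_bij (fun h _ => (h.1.1, h.2)) ?_ ?_ ?_ ?_
  · intro h hh
    simp only [mem_filter, mem_univ, true_and]
    exact h.1.2
  · intro h _ h' _ e
    simp only [Prod.mk.injEq] at e
    exact Prod.ext (Subtype.ext e.1) e.2
  · intro h hh
    simp only [mem_filter, mem_univ, true_and] at hh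
    exact ⟨(⟨h.1, hh⟩, h.2), by simp, rfl⟩
  · intro h _
    rfl

set_option maxHeartbeats 1000000 in
theorem good_class (hd : 3 ≤ d) (hn : 0 < n) (v : Fin n → ZMod p) (σ : Equiv.Perm (Fin n × Fin d))
    (hD : ∀ a, ∑ h ∈ univ.filter (fun h : Fin n × Fin d => v h.1 = a), v (σ h).1 = 0)
    (ε : ℝ) (hg : GoodN (hist (lab v σ)) (n * d) ε) (hε : (p:ℝ)^2 * ε ≤ 1/100)
    (s0 : ℕ) (hs0 : 1 ≤ s0) (hs1 : 2 * d * (s0:ℝ)^2 ≤ 81/100 / p * n) (L : ℝ) (hL : L = 1 + Real.log (n * d + 1))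
    (hs2 : 9 * d * n * ε + 3 * p * L ≤ s0 / 2) (R : ℝ)
    (hR : R = 3 * 2^d * (9 * n * ε * Real.sqrt (7 * p * ε) + 4 * p^2 * Real.sqrt (s0 * p / n))) (hR2 : R ≤ 1/2) :
    ∏ a, (((univ.filter (fun g : Equiv.Perm ({k : Fin n // v k = a} × Fin d) =>
        ∀ k, ∑ i, v (σ ((g (k, i)).1.1, (g (k, i)).2)).1 = 0)).card : ℝ) /
          (Fintype.card ({k : Fin n // v k = a} × Fin d)).factorial) ≤ (p:ℝ)^p / (p:ℝ)^n * Real.exp (4 * R + p * Real.exp (-(p * L))) := by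
  have hp : (0:ℝ) < p := by exact_mod_cast (Fact.out : p.Prime).pos
  have hn0 : (0:ℝ) < n := by exact_mod_cast hn
  have hd0 : (0:ℝ) < d := by positivity
  set N := hist (lab v σ) with hN
  set P : ZMod p × ZMod p → ℝ := fun b => (N b : ℝ) / (n * d : ℕ) with hP
  have hP0 : ∀ b, 0 ≤ P b := fun b => by simp only [hP]; positivity
  have hcF : (Fintype.card (ZMod p) : ℝ) = p := by rw [ZMod.card]
  have hg' : ∑ b, (Real.sqrt (P b) - 1 / Fintype.card (ZMod p)) ^ 2 ≤ ε := hg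
  have hε' : (Fintype.card (ZMod p) : ℝ)^2 * ε ≤ 1/100 := by rw [hcF]; exact hε
  have hε0 : 0 ≤ ε := le_trans (Finset.sum_nonneg fun b _ => sq_nonneg _) hg'
  set na : ZMod p → ℕ := fun a => Fintype.card {k : Fin n // v k = a} with hna
  have hna2 : ∀ a, ∑ b, P (a,b) = (na a : ℝ) / n := by
    intro a
    have := nuN_lab (V := Fin n) (d := d) (by omega) v σ a
    rw [Fintype.card_prod, Fintype.card_fin, Fintype.card_fin] at this
    unfold nuN at this
    simp only [hna]
    rw [Fintype.card_subtype]
    exact this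
  set ea : ZMod p → ℝ := fun a => epsr P a with hea
  have hea0 : ∀ a, 0 ≤ ea a := fun a => epsr_nonneg P a
  have heas : ∑ a, ea a ≤ ε := by
    simp only [hea]; rw [sum_epsr]; exact hg'
  have hea1 : ∀ a, ea a ≤ ε := fun a => (Finset.single_le_sum (fun a _ => hea0 a) (mem_univ a)).trans heas
  set ρ : ZMod p → ℝ := fun a => 3 * 2^d * (9 * n * ea a * Real.sqrt (7 * p * ε) + 4 * p * Real.sqrt (s0 * p / n)) with hρ
  have hρ0 : ∀ a, 0 ≤ ρ a := fun a => by
    have := hea0 a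
    simp only [hρ]; positivity
  have hρs : ∑ a, ρ a ≤ R := by
    simp only [hρ]
    rw [← Finset.mul_sum, Finset.sum_add_distrib, ← Finset.sum_mul, ← Finset.mul_sum, Finset.sum_const, card_univ, ZMod.card, nsmul_eq_mul, hR]
    have e : (p:ℝ) * (4 * p * Real.sqrt (s0 * p / n)) = 4 * p^2 * Real.sqrt (s0 * p / n) := by ring
    rw [e]
    gcongr
  have hρ1 : ∀ a, ρ a ≤ 1/2 := fun a => ((Finset.single_le_sum (fun a _ => hρ0 a) (mem_univ a)).trans hρs).trans hR2
  have hE : Real.exp L = Real.exp 1 * (n * d + 1) := by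
    rw [hL, Real.exp_add, Real.exp_log (by positivity)]
  have main : ∀ a, (((univ.filter (fun g : Equiv.Perm ({k : Fin n // v k = a} × Fin d) =>
        ∀ k, ∑ i, v (σ ((g (k, i)).1.1, (g (k, i)).2)).1 = 0)).card : ℝ) /
          (Fintype.card ({k : Fin n // v k = a} × Fin d)).factorial) ≤ p / (p:ℝ)^(na a) * Real.exp (4 * ρ a + Real.exp (-(p * L))) := by
    intro a
    obtain ⟨hb1, hb2⟩ := row_bounds P hP0 ε hg' hε' a
    have hk := row_kap P hP0 ε hg' hε' a
    rw [hna2 a, hcF] at hb1 hb2 hk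
    have hna0 : (0:ℝ) < na a := by
      have h1 : 0 < (na a:ℝ) / n := lt_of_lt_of_le (by positivity) hb1
      by_contra hc
      have h2 : (na a:ℝ) = 0 := le_antisymm (not_lt.mp hc) (by positivity)
      rw [h2] at h1
      simp at h1
    have hcx : Fintype.card ({k : Fin n // v k = a} × Fin d) = na a * d := by
      rw [Fintype.card_prod, Fintype.card_fin]
    set κ := kap (hist (fun h : {k : Fin n // v k = a} × Fin d => v (σ (h.1.1, h.2)).1)) (Fintype.card ({k : Fin n // v k = a} × Fin d)) with hκ
    have hκ1 : κ ≤ 7 * p * ea a := by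
      refine le_trans (le_of_eq ?_) hk
      rw [hκ]
      unfold kap
      rw [hcx, hcF]
      congr 2
      refine Finset.sum_congr rfl fun b _ => ?_
      rw [hist_class, ← hN]
      simp only [hP]
      congr 1
      push_cast
      field_simp
    have hlo : (81/100:ℝ) / p * n ≤ na a := by rwa [le_div_iff₀ hn0] at hb1
    have hhi : (na a:ℝ) ≤ 121/100 / p * n := by rwa [div_le_iff₀ hn0] at hb2
    have hnk : (na a) * κ ≤ 9 * n * ea a := by
      calc (na a) * κ ≤ (na a) * (7 * p * ea a) := by gcongr
        _ ≤ (121/100 / p * n) * (7 * p * ea a) := by have := hea0 a; gcongr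
        _ = 847/100 * (n * ea a) := by field_simp; ring
        _ ≤ 9 * (n * ea a) := by have := hea0 a; gcongr; norm_num
        _ = _ := by ring
    set r := 3 * 2 ^ d * (na a * (κ * Real.sqrt κ) + 3 * p * Real.sqrt (s0 / na a)) with hr
    have hrρ : r ≤ ρ a := by
      simp only [hr, hρ]
      have h1 : na a * (κ * Real.sqrt κ) ≤ 9 * n * ea a * Real.sqrt (7 * p * ε) := by
        rcases le_total κ 0 with hx | hx
        · rw [Real.sqrt_eq_zero_of_nonpos hx]
          have := hea0 a
          simp only [mul_zero]
          positivity
        · rw [← mul_assoc]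
          have := hea0 a
          have h2 : κ ≤ 7 * p * ε := hκ1.trans (by have := hea1 a; gcongr)
          exact mul_le_mul hnk (Real.sqrt_le_sqrt h2) (Real.sqrt_nonneg _) (by positivity)
      have h2 : 3 * p * Real.sqrt (s0 / na a) ≤ 4 * p * Real.sqrt (s0 * p / n) := by
        have h3 : (s0:ℝ) / na a ≤ (10/9)^2 * (s0 * p / n) := by
          calc (s0:ℝ) / na a ≤ s0 / (81/100 / p * n) := by gcongr
            _ = _ := by field_simp; norm_num
        have h4 := Real.sqrt_le_sqrt h3
        rw [Real.sqrt_mul (by norm_num), Real.sqrt_sq (by norm_num)] at h4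
        have h5 : 0 ≤ Real.sqrt (s0 * p / n) := Real.sqrt_nonneg _
        have h6 : Real.sqrt (s0 / na a) ≤ 4/3 * Real.sqrt (s0 * p / n) := by linarith
        calc 3 * p * Real.sqrt (s0 / na a) ≤ 3 * p * (4/3 * Real.sqrt (s0 * p / n)) := by gcongr
          _ = _ := by ring
      gcongr
    have hs3 : 2 * d * s0 ^ 2 ≤ Fintype.card {k : Fin n // v k = a} := by
      have : 2 * d * (s0:ℝ)^2 ≤ na a := hs1.trans hlo
      exact_mod_cast this
    have hcl := class_lemma (V := {k : Fin n // v k = a}) hd (fun h => v (σ (h.1.1, h.2)).1)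
      (by rw [sum_class v (fun h => v (σ h).1) a]; exact hD a) s0 hs0 hs3 r rfl (hrρ.trans (hρ1 a))
    have hfac : (0:ℝ) < (Fintype.card ({k : Fin n // v k = a} × Fin d)).factorial := by positivity
    rw [div_le_iff₀ hfac]
    refine hcl.trans ?_
    have hnan : (na a : ℝ) ≤ n := by
      have : na a ≤ n := by
        simp only [hna]
        exact (Fintype.card_subtype_le _).trans (by simp)
      exact_mod_cast this
    have hB : ((Real.exp 1 * (Fintype.card ({k : Fin n // v k = a} × Fin d) + 1)) ^ p *
        Real.exp (Fintype.card ({k : Fin n // v k = a} × Fin d) * κ)) *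
          (Real.exp (-s0 / 2) * ((Fintype.card {k : Fin n // v k = a} : ℝ) + 1) ^ p) ≤ Real.exp (-(p * L)) := by
      have c1 : (Real.exp 1 * (Fintype.card ({k : Fin n // v k = a} × Fin d) + 1)) ^ p ≤ Real.exp (p * L) := by
        rw [Real.exp_nat_mul, hE, hcx]
        push_cast
        gcongr
      have c2 : ((Fintype.card {k : Fin n // v k = a} : ℝ) + 1) ^ p ≤ Real.exp (p * L) := by
        rw [Real.exp_nat_mul, hE]
        have h1 : (1:ℝ) ≤ Real.exp 1 := Real.one_le_exp (by norm_num)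
        have hd1 : (1:ℝ) ≤ d := by exact_mod_cast (by omega : 1 ≤ d)
        have h2 : (na a : ℝ) + 1 ≤ n * d + 1 := by nlinarith
        have h3 : (na a : ℝ) + 1 ≤ Real.exp 1 * (n * d + 1) := by nlinarith
        exact pow_le_pow_left₀ (by positivity) h3 p
      have c3 : Real.exp (Fintype.card ({k : Fin n // v k = a} × Fin d) * κ) ≤ Real.exp (9 * d * n * ε) := by
        rw [hcx]
        apply Real.exp_le_exp.mpr
        push_cast
        calc (na a:ℝ) * d * κ = d * (na a * κ) := by ring
          _ ≤ d * (9 * n * ε) := by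
            have : 9 * n * ea a ≤ 9 * n * ε := by have := hea1 a; gcongr
            exact mul_le_mul_of_nonneg_left (hnk.trans this) hd0.le
          _ = _ := by ring
      calc _ ≤ (Real.exp (p * L) * Real.exp (9 * d * n * ε)) * (Real.exp (-s0 / 2) * Real.exp (p * L)) := by gcongr
        _ = Real.exp (p * L + 9 * d * n * ε + (-s0/2 + p * L)) := by rw [Real.exp_add, Real.exp_add, Real.exp_add]
        _ ≤ _ := by
          apply Real.exp_le_exp.mpr
          linarith
    have hfin : 1 + 4 * r + ((Real.exp 1 * (Fintype.card ({k : Fin n // v k = a} × Fin d) + 1)) ^ p *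
        Real.exp (Fintype.card ({k : Fin n // v k = a} × Fin d) * κ)) *
          (Real.exp (-s0 / 2) * ((Fintype.card {k : Fin n // v k = a} : ℝ) + 1) ^ p) ≤ Real.exp (4 * ρ a + Real.exp (-(p * L))) := by
      have := Real.add_one_le_exp (4 * ρ a + Real.exp (-(p * L)))
      linarith
    refine (mul_le_mul_of_nonneg_left hfin (by positivity)).trans (le_of_eq ?_)
    simp only [hna]
    ring
  refine (Finset.prod_le_prod (fun a _ => by positivity) fun a _ => main a).trans ?_
  rw [Finset.prod_mul_distrib, Finset.prod_div_distrib, Finset.prod_const, card_univ, ZMod.card, Finset.prod_pow_eq_pow_sum, ← Real.exp_sum]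
  have hsn : ∑ a, na a = n := by
    simp only [hna, Fintype.card_subtype]
    have := Finset.card_eq_sum_card_fiberwise (s := (univ : Finset (Fin n))) (t := (univ : Finset (ZMod p))) (f := v) (fun _ _ => mem_univ _)
    rw [card_univ, Fintype.card_fin] at this
    exact this.symm
  rw [hsn, Finset.sum_add_distrib, ← Finset.mul_sum, Finset.sum_const, card_univ, ZMod.card, nsmul_eq_mul]
  gcongr
end

section
variable {n d p : ℕ} [Fact p.Prime]

theorem lab_conj (v : Fin n → ZMod p) (σ γ : Equiv.Perm (Fin n × Fin d)) (hγ : ∀ h, v (γ h).1 = v h.1) :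
    hist (lab v (γ * σ * γ⁻¹)) = hist (lab v σ) := by
  rw [← hist_comp (lab v σ) γ⁻¹]
  congr 1
  funext h
  simp only [lab, Function.comp, Equiv.Perm.mul_apply]
  have h1 := hγ (γ⁻¹ h)
  rw [show γ (γ⁻¹ h) = h from γ.apply_symm_apply h] at h1
  rw [hγ, h1]

theorem hist_fst (v : Fin n → ZMod p) (σ : Equiv.Perm (Fin n × Fin d)) (a : ZMod p) :
    hist (fun h : Fin n × Fin d => v h.1) a = ∑ b, hist (lab v σ) (a,b) := by
  unfold hist
  rw [Finset.card_eq_sum_card_fiberwise (f := fun h => v (σ h).1) (t := univ) (by intro; simp)]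
  refine Finset.sum_congr rfl fun b _ => ?_
  congr 1
  ext h
  simp [lab]

theorem count_sum_zero (hn : 0 < n) :
    p * (univ.filter (fun v : Fin n → ZMod p => ∑ k, v k = 0)).card ≤ p ^ n := by
  have h : ((univ : Finset (ZMod p)) ×ˢ (univ.filter (fun v : Fin n → ZMod p => ∑ k, v k = 0))).card ≤ (univ : Finset (Fin n → ZMod p)).card := by
    refine Finset.card_le_card_of_injOn (fun x => x.2 + Pi.single (⟨0, hn⟩ : Fin n) x.1) (fun _ _ => by simp) ?_
    intro x hx y hy hxy
    simp only [coe_product, Set.mem_prod, mem_coe, mem_filter, mem_univ, true_and] at hx hy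
    have hs : ∀ z : ZMod p × (Fin n → ZMod p), ∑ k, z.2 k = 0 → ∑ k, (z.2 + Pi.single (⟨0, hn⟩ : Fin n) z.1 : Fin n → ZMod p) k = z.1 := by
      intro z hz
      simp only [Pi.add_apply]
      rw [Finset.sum_add_distrib, hz, zero_add, Finset.sum_pi_single']
      simp
    have h1 : x.1 = y.1 := by
      rw [← hs x hx, ← hs y hy]
      exact congrArg (fun f : Fin n → ZMod p => ∑ k, f k) hxy
    simp only at hxy
    rw [h1] at hxy
    exact Prod.ext h1 (add_right_cancel hxy)
  rw [card_product, card_univ, ZMod.card, card_univ, Fintype.card_fun, ZMod.card, Fintype.card_fin] at h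
  exact h

open Classical in
theorem X_good (hd : 3 ≤ d) (hn : 0 < n) (hev : Even (n * d)) (hp2 : p ≠ 2) (hdp : d < p)
    (ε : ℝ) (hε : (p:ℝ)^2 * ε ≤ 1/100)
    (s0 : ℕ) (hs0 : 1 ≤ s0) (hs1 : 2 * d * (s0:ℝ)^2 ≤ 81/100 / p * n) (L : ℝ) (hL : L = 1 + Real.log (n * d + 1))
    (hs2 : 9 * d * n * ε + 3 * p * L ≤ s0 / 2) (R : ℝ)
    (hR : R = 3 * 2^d * (9 * n * ε * Real.sqrt (7 * p * ε) + 4 * p^2 * Real.sqrt (s0 * p / n))) (hR2 : R ≤ 1/2)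
    (hE : Real.exp (4 * R + p * Real.exp (-(p * L))) ≤ 3/2)
    (herr : (p:ℝ)^p * ((Real.exp 1 * (n * d + 1)) ^ p * Real.exp (n * d * (5 * ε)) * Real.exp (-(n * d) / (32 * (p:ℝ) ^ 4))) ≤ 1) :
    ∑ v : Fin n → ZMod p, (((MM (Fin n × Fin d)).filter (fun σ => GoodN (hist (lab v σ)) (n * d) ε ∧ ∀ k, ∑ i, v (σ (k,i)).1 = 0)).card : ℝ)
      ≤ 3 * (MM (Fin n × Fin d)).card := by
  have hp : (0:ℝ) < p := by exact_mod_cast (Fact.out : p.Prime).pos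
  have hn0 : (0:ℝ) < n := by exact_mod_cast hn
  have hcH : Fintype.card (Fin n × Fin d) = n * d := by simp
  set T : ℝ := ((MM (Fin n × Fin d)).card : ℝ) with hT
  have hT0 : 0 ≤ T := by positivity
  have key : ∀ v : Fin n → ZMod p, (((MM (Fin n × Fin d)).filter (fun σ => GoodN (hist (lab v σ)) (n * d) ε ∧ ∀ k, ∑ i, v (σ (k,i)).1 = 0)).card : ℝ)
      ≤ 3/2 / (p:ℝ)^n * (p * T * (if ∑ k, v k = 0 then 1 else 0) + T) := by
    intro v
    by_cases hex : ∃ σ ∈ MM (Fin n × Fin d), GoodN (hist (lab v σ)) (n * d) ε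
    · obtain ⟨σ0, hσ0, hg0⟩ := hex
      have hav := class_avg v (fun σ => GoodN (hist (lab v σ)) (n * d) ε)
        (by
          intro σ γ hγ hg
          rw [lab_conj v σ γ hγ]
          exact hg) ((p:ℝ)^p / (p:ℝ)^n * Real.exp (4 * R + p * Real.exp (-(p * L)))) (by positivity)
        (by
          intro σ _ hg hD
          exact good_class hd hn v σ hD ε hg hε s0 hs0 hs1 L hL hs2 R hR hR2)
      have hDc := D_count (by rw [hcH]; exact hev) hp2 (fun h : Fin n × Fin d => v h.1)
      set D : ℝ := (((MM (Fin n × Fin d)).filter (fun σ =>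
        ∀ a, ∑ h ∈ univ.filter (fun h : Fin n × Fin d => v h.1 = a), v (σ h).1 = 0)).card : ℝ) with hDdef
      have hkap : kap (hist (fun h : Fin n × Fin d => v h.1)) (Fintype.card (Fin n × Fin d)) ≤ 5 * ε := by
        rw [hcH]
        have hm : 0 < n * d := Nat.mul_pos hn (by omega)
        have := nu_kap (fun b : ZMod p × ZMod p => (hist (lab v σ0) b : ℝ) / (n * d : ℕ)) (fun b => by positivity)
          (sum_cast_one _ _ hm (by rw [sum_hist, hcH])) ε hg0 (by rw [ZMod.card]; exact hε)
        refine le_trans (le_of_eq ?_) this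
        unfold kap
        congr 2
        refine Finset.sum_congr rfl fun a _ => ?_
        rw [hist_fst v σ0 a]
        rw [← Finset.sum_div]
        push_cast
        rfl
      have hsum : (∑ h : Fin n × Fin d, v h.1 = 0) ↔ ∑ k, v k = 0 := by
        rw [Fintype.sum_prod_type]
        simp only [sum_const, card_univ, Fintype.card_fin, nsmul_eq_mul]
        rw [← Finset.mul_sum, mul_eq_zero]
        constructor
        · rintro (h | h)
          · exfalso
            rw [ZMod.natCast_eq_zero_iff] at h
            have := Nat.le_of_dvd (by omega) h
            omega
          · exact h
        · exact Or.inr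
      simp only [hsum] at hDc
      have hD2 : (p:ℝ)^p * D ≤ p * T * (if ∑ k, v k = 0 then 1 else 0) + T := by
        refine hDc.trans ?_
        have h1 : (p:ℝ) ^ p * (T * ((Real.exp 1 * (Fintype.card (Fin n × Fin d) + 1)) ^ p *
          Real.exp (Fintype.card (Fin n × Fin d) * kap (hist (fun h : Fin n × Fin d => v h.1)) (Fintype.card (Fin n × Fin d))) *
          Real.exp (-(Fintype.card (Fin n × Fin d) : ℝ) / (32 * (p:ℝ) ^ 4)))) ≤ T := by
          calc _ ≤ (p:ℝ) ^ p * (T * ((Real.exp 1 * (Fintype.card (Fin n × Fin d) + 1)) ^ p *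
              Real.exp (Fintype.card (Fin n × Fin d) * (5 * ε)) *
              Real.exp (-(Fintype.card (Fin n × Fin d) : ℝ) / (32 * (p:ℝ) ^ 4)))) := by gcongr
            _ = T * ((p:ℝ)^p * ((Real.exp 1 * (n * d + 1)) ^ p * Real.exp (n * d * (5 * ε)) * Real.exp (-(n * d) / (32 * (p:ℝ) ^ 4)))) := by
              rw [hcH]; push_cast; ring
            _ ≤ T * 1 := by gcongr
            _ = T := mul_one _
        gcongr
      calc _ ≤ (p:ℝ)^p / (p:ℝ)^n * Real.exp (4 * R + p * Real.exp (-(p * L))) * D := hav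
        _ = Real.exp (4 * R + p * Real.exp (-(p * L))) / (p:ℝ)^n * ((p:ℝ)^p * D) := by ring
        _ ≤ 3/2 / (p:ℝ)^n * (p * T * (if ∑ k, v k = 0 then 1 else 0) + T) := by
          gcongr
    · have : (MM (Fin n × Fin d)).filter (fun σ => GoodN (hist (lab v σ)) (n * d) ε ∧ ∀ k, ∑ i, v (σ (k,i)).1 = 0) = ∅ := by
        rw [Finset.filter_eq_empty_iff]
        intro σ hσ hg
        exact hex ⟨σ, hσ, hg.1⟩
      rw [this]
      simp only [card_empty, Nat.cast_zero]
      split_ifs <;> positivity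
  refine (Finset.sum_le_sum fun v _ => key v).trans ?_
  rw [← Finset.mul_sum, Finset.sum_add_distrib, ← Finset.mul_sum, Finset.sum_const, card_univ, Fintype.card_fun, ZMod.card, Fintype.card_fin, nsmul_eq_mul,
    Finset.sum_boole]
  have hc : (p:ℝ) * ((univ.filter (fun v : Fin n → ZMod p => ∑ k, v k = 0)).card : ℝ) ≤ (p:ℝ)^n := by
    exact_mod_cast count_sum_zero hn
  have hpn : (0:ℝ) < (p:ℝ)^n := by positivity
  calc _ ≤ 3/2 / (p:ℝ)^n * ((p:ℝ)^n * T + (p:ℝ)^n * T) := by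
        refine mul_le_mul_of_nonneg_left (add_le_add ?_ ?_) (by positivity)
        · rw [mul_right_comm]
          gcongr
        · push_cast; exact le_rfl
    _ = _ := by field_simp; ring
end

section
variable {n d p : ℕ} [Fact p.Prime]

theorem kernel_of_det (σ : Equiv.Perm (Fin n × Fin d)) (h : (adjMat n d σ).det = 0) :
    ∃ v : Fin n → ZMod p, v ≠ 0 ∧ ∀ k, ∑ i, v (σ (k,i)).1 = 0 := by
  have h1 : ((Int.castRingHom (ZMod p)).mapMatrix (adjMat n d σ)).det = 0 := by
    rw [← RingHom.map_det, h, map_zero]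
  obtain ⟨v, hv, hv2⟩ := Matrix.exists_mulVec_eq_zero_iff.mpr h1
  refine ⟨v, hv, fun k => ?_⟩
  have h2 := congrFun hv2 k
  refine Eq.trans ?_ h2
  simp only [Matrix.mulVec, dotProduct, RingHom.mapMatrix_apply, Matrix.map_apply, adjMat]
  rw [← Finset.sum_fiberwise (s := univ) (g := fun i => (σ (k,i)).1)]
  refine Finset.sum_congr rfl fun l _ => ?_
  rw [Finset.sum_congr rfl (g := fun _ => v l) (fun i hi => by rw [(mem_filter.mp hi).2])]
  simp

open Classical in
theorem sing_bound (hd : 3 ≤ d) (hn : 0 < n) (hdp : d < p)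
    (K : ℝ) (hK : 0 ≤ K) (δ : ℝ) (hδ : δ = 4 * Real.sqrt (d * (d * K / n))) (hδ1 : δ ≤ 1/32) (hδ2 : 2 * δ * d < 1)
    (s1 : ℕ) (hs1 : 2 * δ * n ≤ s1) (hs4 : 4 * s1 ≤ n) (r : ℝ) (hr : r = 2 ^ d * CS d * Real.sqrt (s1 / n)) (hr2 : r ≤ 1/2)
    (hX : ∑ v : Fin n → ZMod p, (((MM (Fin n × Fin d)).filter (fun σ => GoodN (hist (lab v σ)) (n * d) ((2 + 32 * d^2) * K / n) ∧ ∀ k, ∑ i, v (σ (k,i)).1 = 0)).card : ℝ)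
      ≤ 3 * (MM (Fin n × Fin d)).card) :
    (((MM (Fin n × Fin d)).filter (fun σ => (adjMat n d σ).det = 0)).card : ℝ) ≤
      (MM (Fin n × Fin d)).card * (2 * r + ((n * d : ℝ) + 1) ^ (p * p) * ((Real.exp 1 * (n * d + 1)) ^ (p * p) *
      Real.exp (-(K / 2))) + 3 / (p - 1)) := by
  have hp1 : (1:ℝ) < p := by exact_mod_cast (Fact.out : p.Prime).one_lt
  have hcH : Fintype.card (Fin n × Fin d) = n * d := by simp
  set T : ℝ := ((MM (Fin n × Fin d)).card : ℝ) with hT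
  set A := (MM (Fin n × Fin d)).filter (fun σ => ∃ S : Finset (Fin n), S.Nonempty ∧ S.card ≤ s1 ∧
      ∀ k, (univ.filter (fun i => (σ (k,i)).1 ∈ S)).card ≠ 1) with hA
  have hAc := small_support (V := Fin n) d hd s1 (by simpa using hs4) r (by simpa using hr) hr2
  set B := (MM (Fin n × Fin d)).filter (fun σ => ∃ v : Fin n → ZMod p, (∀ k, ∑ i, v (σ (k,i)).1 = 0) ∧ BadN (Fin n) d K (hist (lab v σ))) with hB
  have hBc := LD_total (V := Fin n) (F := ZMod p) hd (by rw [hcH]; exact Nat.mul_pos hn (by omega)) K hK B (fun σ hσ => by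
    rw [hB, mem_filter] at hσ; exact hσ)
  rw [hcH, Fintype.card_prod, ZMod.card] at hBc
  set S := (MM (Fin n × Fin d)).filter (fun σ => (adjMat n d σ).det = 0) with hS
  set C := (S \ A) \ B with hC
  have hsub : S ⊆ A ∪ (B ∪ C) := by
    intro σ hσ
    simp only [hC, mem_union, mem_sdiff]
    tauto
  have hcard : (S.card : ℝ) ≤ A.card + (B.card + C.card) := by
    have := (card_le_card hsub).trans ((card_union_le _ _).trans (Nat.add_le_add_left (card_union_le _ _) _))
    exact_mod_cast this
  have hCc : (p - 1) * (C.card : ℝ) ≤ 3 * T := by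
    refine le_trans ?_ hX
    have e : ∀ v : Fin n → ZMod p, (((MM (Fin n × Fin d)).filter (fun σ => GoodN (hist (lab v σ)) (n * d) ((2 + 32 * d^2) * K / n) ∧ ∀ k, ∑ i, v (σ (k,i)).1 = 0)).card : ℝ)
       = ∑ σ ∈ MM (Fin n × Fin d), if (GoodN (hist (lab v σ)) (n * d) ((2 + 32 * d^2) * K / n) ∧ ∀ k, ∑ i, v (σ (k,i)).1 = 0) then (1:ℝ) else 0 := by
      intro v
      rw [Finset.sum_boole]
    simp_rw [e]
    rw [Finset.sum_comm]
    have hCM : C ⊆ MM (Fin n × Fin d) := by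
      intro σ hσ
      simp only [hC, hS, mem_sdiff, mem_filter] at hσ
      exact hσ.1.1.1
    have hσb : ∀ σ ∈ C, ((p:ℝ) - 1) ≤ ∑ v : Fin n → ZMod p, if (GoodN (hist (lab v σ)) (n * d) ((2 + 32 * d^2) * K / n) ∧ ∀ k, ∑ i, v (σ (k,i)).1 = 0) then (1:ℝ) else 0 := by
      intro σ hσ
      have hσM := hCM hσ
      have hIsM : IsM σ := by simpa [MM] using hσM
      simp only [hC, mem_sdiff] at hσ
      obtain ⟨⟨hσS, hσA⟩, hσB⟩ := hσ
      obtain ⟨v, hv, hker⟩ := kernel_of_det (p := p) σ (by rw [hS, mem_filter] at hσS; exact hσS.2)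
      have hgood : ∀ u : Fin n → ZMod p, u ≠ 0 → (∀ k, ∑ i, u (σ (k,i)).1 = 0) → GoodN (hist (lab u σ)) (n * d) ((2 + 32 * d^2) * K / n) := by
        intro u hu hk
        have hnb : ¬ BadN (Fin n) d K (hist (lab u σ)) := by
          intro hb
          exact hσB (by rw [hB, mem_filter]; exact ⟨hσM, u, hk, hb⟩)
        have := good_or_conc (V := Fin n) hd (hist (lab u σ)) (sum_hist _) (fun a b => hist_lab_symm u σ hIsM a b) (by simpa using hn) K hK hnb δ (by simpa using hδ) hδ1
        rcases this with h | ⟨a, ha⟩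
        · rw [hcH, Fintype.card_fin] at h
          exact h
        · exfalso
          apply hσA
          rw [hA, mem_filter]
          exact ⟨hσM, conc_supp hd hdp u hu σ hk δ hδ2 a ha s1 (by simpa using hs1)⟩
      rw [Finset.sum_boole]
      have hcu : (univ : Finset (ZMod p)ˣ).card ≤ (univ.filter (fun v : Fin n → ZMod p => GoodN (hist (lab v σ)) (n * d) ((2 + 32 * d^2) * K / n) ∧ ∀ k, ∑ i, v (σ (k,i)).1 = 0)).card := by
        refine Finset.card_le_card_of_injOn (fun c k => (c : ZMod p) * v k) ?_ ?_
        · intro c _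
          simp only [coe_filter, Set.mem_ofPred_eq, mem_univ, true_and]
          have hk : ∀ k, ∑ i, ((c : ZMod p) * v (σ (k,i)).1) = 0 := by
            intro k
            rw [← Finset.mul_sum, hker k, mul_zero]
          refine ⟨hgood _ ?_ hk, hk⟩
          intro h0
          apply hv
          funext k
          have := congrFun h0 k
          simpa using this
        · intro c _ c' _ hcc
          obtain ⟨k, hk⟩ : ∃ k, v k ≠ 0 := by
            by_contra h
            push Not at h
            exact hv (funext h)
          have := congrFun hcc k
          exact Units.ext (mul_right_cancel₀ hk this)
      rw [card_univ, ZMod.card_units_eq_totient, Nat.totient_prime Fact.out] at hcu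
      have h1 : ((p - 1 : ℕ) : ℝ) = p - 1 := by
        rw [Nat.cast_sub (Fact.out : p.Prime).one_lt.le]; simp
      rw [← h1]
      exact_mod_cast hcu
    calc (p - 1) * (C.card : ℝ) = ∑ σ ∈ C, ((p:ℝ) - 1) := by rw [Finset.sum_const, nsmul_eq_mul]; ring
      _ ≤ ∑ σ ∈ C, ∑ v : Fin n → ZMod p, if (GoodN (hist (lab v σ)) (n * d) ((2 + 32 * d^2) * K / n) ∧ ∀ k, ∑ i, v (σ (k,i)).1 = 0) then (1:ℝ) else 0 := Finset.sum_le_sum hσb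
      _ ≤ _ := Finset.sum_le_sum_of_subset_of_nonneg hCM (fun σ _ _ => Finset.sum_nonneg fun v _ => by split_ifs <;> norm_num)
  have hCc2 : (C.card : ℝ) ≤ T * (3 / (p - 1)) := by
    rw [← mul_div_assoc, le_div_iff₀ (by linarith)]
    linarith
  have hAc2 : (A.card : ℝ) ≤ T * (2 * r) := by
    convert hAc using 2
    rw [hA]
    congr!
  push_cast at hBc
  have e2 : T * (2 * r + ((n * d : ℝ) + 1) ^ (p * p) * ((Real.exp 1 * (n * d + 1)) ^ (p * p) *
      Real.exp (-(K / 2))) + 3 / (p - 1)) = T * (2 * r) + (T * (((n * d : ℝ) + 1) ^ (p * p) * ((Real.exp 1 * (n * d + 1)) ^ (p * p) *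
      Real.exp (-(K / 2)))) + T * (3 / (p - 1))) := by ring
  rw [e2]
  linarith
end

theorem card_MM_le {H : Type*} [Fintype H] [DecidableEq H] (N : ℕ) (hN : Fintype.card H = N) (hpos : 0 < N) (hev : Even N) :
    ((MM H).card : ℝ) ≤ (N.factorial : ℝ) / ((2:ℝ) ^ (N / 2) * ((N/2).factorial : ℝ)) := by
  have hm2 : 2 * (N/2) = N := Nat.two_mul_div_two_of_even hev
  have hm : N / 2 ≠ 0 := by omega
  have hsub : MM H ⊆ univ.filter (fun g : Equiv.Perm H => g.cycleType = Multiset.replicate (N/2) 2) := by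
    intro σ hσ
    have hM : IsM σ := by simpa [MM] using hσ
    rw [mem_filter]
    refine ⟨mem_univ _, ?_⟩
    have hne : Nonempty H := Fintype.card_pos_iff.mp (by omega)
    obtain ⟨x⟩ := hne
    have ho : orderOf σ = 2 := by
      haveI : Fact (Nat.Prime 2) := ⟨Nat.prime_two⟩
      rw [orderOf_eq_prime_iff]
      refine ⟨by ext x; simp [pow_two, hM.1 x], fun h => hM.2 x (by rw [h]; rfl)⟩
    obtain ⟨k, hk⟩ := Equiv.Perm.cycleType_prime_order (σ := σ) (by rw [ho]; exact Nat.prime_two)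
    have hs := Equiv.Perm.sum_cycleType σ
    have hsup : σ.support = univ := by
      ext y; simp [hM.2 y]
    rw [hsup, hk, ho, card_univ, hN, Multiset.sum_replicate, smul_eq_mul] at hs
    rw [hk, ho]
    congr 1
    omega
  have h1 := Equiv.Perm.card_of_cycleType_mul_eq H (Multiset.replicate (N/2) 2)
  have h2 : (Multiset.replicate (N/2) 2).sum = N := by rw [Multiset.sum_replicate, smul_eq_mul]; omega
  rw [if_pos ⟨by rw [h2, hN], fun a ha => by rw [Multiset.eq_of_mem_replicate ha]⟩, h2, hN, Nat.sub_self, Nat.factorial_zero, one_mul,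
    Multiset.prod_replicate, Multiset.toFinset_replicate, if_neg hm, Finset.prod_singleton, Multiset.count_replicate_self] at h1
  rw [le_div_iff₀ (by positivity)]
  have h3 := Nat.mul_le_mul_right (2 ^ (N/2) * (N/2).factorial) (card_le_card hsub)
  rw [h1] at h3
  exact_mod_cast h3

theorem aux_sqrt (c y z : ℝ) (k : ℕ) (hc : 1 ≤ c) (hy : 1 ≤ y) (hz : z * y ^ (2 * k) ≤ c) :
    Real.sqrt z ≤ c / y ^ k := by
  have hy0 : 0 < y := by linarith
  rw [Real.sqrt_le_left (by positivity), div_pow, le_div_iff₀ (by positivity), ← pow_mul, mul_comm k 2]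
  nlinarith

set_option maxHeartbeats 2000000 in
/-- The numerical conditions on the first set of parameters. -/
theorem asym1 (d n p : ℕ) (hd : 3 ≤ d) (y L ε C1 C2 C3 : ℝ)
    (hy1 : 1 ≤ y) (hn : (n:ℝ) = y ^ 80) (hL1 : 1 ≤ L) (hLy : L ≤ y)
    (hpl : 8 * y ^ 10 ≤ p) (hpu : (p:ℝ) ≤ 18 * y ^ 10)
    (hL : L = 1 + Real.log (n * d + 1)) 
    (hε : ε = (2 + 32 * d^2) * (8 * p^2 * L) / n)
    (hC1 : C1 = 2592 * (2 + 32 * d^2)) (hC2 : C2 = 18 * d * C1 + 109)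
    (hC3 : C3 = 3 * 2^d * (1134 * C1^2 + 23328 * C2))
    (hyC1 : 32400 * C1 ≤ y) (hyC2 : 45 * d * C2 ≤ y) (hyC2' : C2 ≤ y) (hyC3 : 24 * C3 ≤ y) (hyd : 200000000 * (d * C1) ≤ y) (hyn : 1000000000 ≤ y) :
    ∃ s0 : ℕ, 1 ≤ s0 ∧ (p:ℝ)^2 * ε ≤ 1/100 ∧ 2 * d * (s0:ℝ)^2 ≤ 81/100 / p * n ∧ 
     9 * d * n * ε + 3 * p * L ≤ s0 / 2 ∧ 
     3 * 2^d * (9 * n * ε * Real.sqrt (7 * p * ε) + 4 * p^2 * Real.sqrt (s0 * p / n)) ≤ 1/2 ∧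
     Real.exp (4 * (3 * 2^d * (9 * n * ε * Real.sqrt (7 * p * ε) + 4 * p^2 * Real.sqrt (s0 * p / n))) + p * Real.exp (-(p * L))) ≤ 3/2 ∧
     (p:ℝ)^p * ((Real.exp 1 * (n * d + 1)) ^ p * Real.exp (n * d * (5 * ε)) * Real.exp (-(n * d) / (32 * (p:ℝ) ^ 4))) ≤ 1 := by
  have hy0 : 0 < y := by linarith
  have hd3 : (3:ℝ) ≤ d := by exact_mod_cast hd
  have hn0 : (0:ℝ) < n := by rw [hn]; positivity
  have hp0 : (0:ℝ) < p := lt_of_lt_of_le (by positivity) hpl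
  have hC10 : 1 ≤ C1 := by rw [hC1]; clear * - hd3; nlinarith
  have hC20 : 1 ≤ C2 := by rw [hC2]; have : 0 ≤ 18 * d * C1 := by positivity
                           linarith
  have hp2 : (p:ℝ)^2 ≤ 324 * y^20 := by
    have := pow_le_pow_left₀ hp0.le hpu 2
    refine this.trans (le_of_eq (by ring))
  have hp4 : (p:ℝ)^4 ≤ 104976 * y^40 := by
    have := pow_le_pow_left₀ hp0.le hpu 4
    refine this.trans (le_of_eq (by ring))
  have hε0 : 0 ≤ ε := by rw [hε]; positivity
  have hnε : n * ε ≤ C1 * y^21 := by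
    have : n * ε = (2 + 32 * d^2) * (8 * (p^2 * L)) := by rw [hε]; field_simp
    rw [this]
    calc (2 + 32 * (d:ℝ)^2) * (8 * (p^2 * L)) ≤ (2 + 32 * (d:ℝ)^2) * (8 * ((324 * y^20) * y)) := by gcongr
      _ = C1 * y^21 := by rw [hC1]; ring
  have hε59 : ε * y^59 ≤ C1 := by
    have : (ε * y^59) * y^21 ≤ C1 * y^21 := by
      calc (ε * y^59) * y^21 = n * ε := by rw [hn]; ring
        _ ≤ _ := hnε
    exact le_of_mul_le_mul_right this (by positivity)
  have hpL : p * L ≤ 18 * y^11 := by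
    calc p * L ≤ (18 * y^10) * y := by gcongr
      _ = _ := by ring
  have y1 : ∀ k : ℕ, 1 ≤ y^k := fun k => one_le_pow₀ hy1
  have ymono : ∀ {j k : ℕ}, j ≤ k → y^j ≤ y^k := fun h => pow_le_pow_right₀ hy1 h
  set s0 := ⌈2 * (9 * d * n * ε + 3 * p * L)⌉₊ with hs0
  have hs0l : 2 * (9 * d * n * ε + 3 * p * L) ≤ s0 := Nat.le_ceil _
  have hpos : 0 < 2 * (9 * d * n * ε + 3 * p * L) := by positivity
  have hs0u : (s0:ℝ) ≤ C2 * y^21 := by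
    have h1 := (Nat.ceil_lt_add_one hpos.le).le
    rw [← hs0] at h1
    refine h1.trans ?_
    have e1 : 18 * d * (n * ε) ≤ 18 * d * (C1 * y^21) := by gcongr
    have e2 := ymono (j := 11) (k := 21) (by norm_num)
    have e3 := y1 21
    have e4 : C2 * y^21 = 18 * d * (C1 * y^21) + 109 * y^21 := by rw [hC2]; ring
    rw [e4]
    clear * - e1 e2 e3 hpL
    linarith
  have hR : 3 * 2^d * (9 * n * ε * Real.sqrt (7 * p * ε) + 4 * p^2 * Real.sqrt (s0 * p / n)) ≤ 1/24 := by
    have q1 : Real.sqrt (7 * p * ε) ≤ (126 * C1) / y^24 := by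
      refine aux_sqrt _ y _ 24 (by linarith) hy1 ?_
      calc 7 * p * ε * y^(2*24) ≤ 7 * (18 * y^10) * ε * y^(2*24) := by gcongr
        _ = 126 * (ε * y^58) := by ring
        _ ≤ 126 * (ε * y^59) := by
          have := ymono (j := 58) (k := 59) (by norm_num)
          gcongr
        _ ≤ _ := by linarith
    have q2 : Real.sqrt (s0 * p / n) ≤ (18 * C2) / y^24 := by
      refine aux_sqrt _ y _ 24 (by linarith) hy1 ?_
      calc s0 * p / n * y^(2*24) ≤ (C2 * y^21) * (18 * y^10) / n * y^(2*24) := by gcongr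
        _ = 18 * C2 * y^79 / y^80 := by rw [hn]; ring
        _ ≤ 18 * C2 * y^80 / y^80 := by
          have := ymono (j := 79) (k := 80) (by norm_num)
          gcongr
        _ = _ := by field_simp
    calc 3 * 2^d * (9 * n * ε * Real.sqrt (7 * p * ε) + 4 * p^2 * Real.sqrt (s0 * p / n))
        = 3 * 2^d * (9 * (n * ε) * Real.sqrt (7 * p * ε) + 4 * p^2 * Real.sqrt (s0 * p / n)) := by ring
      _ ≤ 3 * 2^d * (9 * (C1 * y^21) * ((126 * C1) / y^24) + 4 * (324 * y^20) * ((18 * C2) / y^24)) := by gcongr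
      _ = 3 * 2^d * (1134 * C1^2 / y^3 + 23328 * C2 / y^4) := by
          congr 1; field_simp; ring
      _ ≤ 3 * 2^d * (1134 * C1^2 / y + 23328 * C2 / y) := by
          have e1 := ymono (j := 1) (k := 3) (by norm_num)
          have e2 := ymono (j := 1) (k := 4) (by norm_num)
          rw [pow_one] at e1 e2
          gcongr
      _ = C3 / y := by rw [hC3]; ring
      _ ≤ 1/24 := by rw [div_le_div_iff₀ hy0 (by norm_num)]; linarith
  set R := 3 * 2^d * (9 * n * ε * Real.sqrt (7 * p * ε) + 4 * p^2 * Real.sqrt (s0 * p / n)) with hRdef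
  have hy10 := ymono (j := 1) (k := 10) (by norm_num)
  rw [pow_one] at hy10
  have hp12 : (12:ℝ) ≤ p := by linarith
  refine ⟨s0, ?_, ?_, ?_, by linarith, by linarith, ?_, ?_⟩
  · exact Nat.one_le_iff_ne_zero.mpr (fun h => by rw [h] at hs0l; simp at hs0l; linarith)
  · have e1 : (p:ℝ)^2 * ε * y ≤ 324 * C1 := by
      calc (p:ℝ)^2 * ε * y ≤ 324 * y^20 * ε * y := by gcongr
        _ = 324 * (ε * y^21) := by ring
        _ ≤ 324 * (ε * y^59) := by
          have := ymono (j := 21) (k := 59) (by norm_num)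
          gcongr
        _ ≤ _ := by linarith
    have e2 : (p:ℝ)^2 * ε * y ≤ 1/100 * y := by linarith
    exact le_of_mul_le_mul_right e2 hy0
  · rw [div_mul_eq_mul_div, le_div_iff₀ hp0]
    calc 2 * d * (s0:ℝ)^2 * p ≤ 2 * d * (C2 * y^21)^2 * (18 * y^10) := by gcongr
      _ = 36 * d * C2 * C2 * y^52 := by ring
      _ ≤ 36/45 * y * y * y^52 := by
        have : 36 * d * C2 ≤ 36/45 * y := by linarith
        gcongr
      _ = 36/45 * y^54 := by ring
      _ ≤ 81/100 * y^80 := by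
        have := ymono (j := 54) (k := 80) (by norm_num)
        have h8 := y1 80
        clear * - this h8
        linarith
      _ = _ := by rw [hn]
  · have e1 : (p:ℝ) * Real.exp (-(p * L)) ≤ 1/6 := by
      have h1 : (p:ℝ) ≤ p * L := le_mul_of_one_le_right hp0.le hL1
      have h2 : Real.exp (-(p * L)) ≤ Real.exp (-p) := Real.exp_le_exp.mpr (by linarith)
      have h3 : (p:ℝ)^2/2 ≤ Real.exp p := by
        have := Real.quadratic_le_exp_of_nonneg hp0.le
        linarith
      calc (p:ℝ) * Real.exp (-(p * L)) ≤ p * Real.exp (-p) := by gcongr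
        _ = p / Real.exp p := by rw [Real.exp_neg]; rfl
        _ ≤ p / (p^2/2) := by gcongr
        _ = 2 / p := by field_simp
        _ ≤ 1/6 := by rw [div_le_div_iff₀ hp0 (by norm_num)]; linarith
    have e2 : Real.exp (4 * R + p * Real.exp (-(p * L))) ≤ Real.exp (1/3) := Real.exp_le_exp.mpr (by linarith)
    refine e2.trans ?_
    have e3 := Real.add_one_le_exp (-(1/3:ℝ))
    rw [Real.exp_neg] at e3
    have e4 := Real.exp_pos (1/3)
    have : Real.exp (1/3) * (2/3) ≤ 1 := by
      calc Real.exp (1/3) * (2/3) ≤ Real.exp (1/3) * (Real.exp (1/3))⁻¹ := by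
            refine mul_le_mul_of_nonneg_left (by linarith) e4.le
        _ = 1 := by field_simp
    linarith
  · have hnd : Real.exp 1 * (n * d + 1) = Real.exp L := by
      rw [hL, Real.exp_add, Real.exp_log (by positivity)]
    have hpn : (p:ℝ) ≤ Real.exp L := by
      rw [← hnd]
      have h1 : (2:ℝ) ≤ Real.exp 1 := by have := Real.add_one_le_exp (1:ℝ); linarith
      have h2 : (p:ℝ) ≤ n * d + 1 := by
        have h3 : 18 * y^10 ≤ y^80 := by
          calc 18 * y^10 ≤ y * y^10 := by gcongr; linarith
            _ = y^11 := by ring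
            _ ≤ _ := ymono (by norm_num)
        rw [hn]
        have h4 := y1 80
        have h5 : y^80 * 1 ≤ y^80 * d := mul_le_mul_of_nonneg_left (by linarith) (by positivity)
        clear * - h3 h5 hpu
        linarith
      have h6 : 1 * ((n:ℝ) * d + 1) ≤ Real.exp 1 * (n * d + 1) := mul_le_mul_of_nonneg_right (by linarith) (by positivity)
      linarith
    have hpp : (p:ℝ)^p ≤ Real.exp L ^ p := pow_le_pow_left₀ hp0.le hpn p
    rw [hnd]
    calc (p:ℝ)^p * (Real.exp L ^ p * Real.exp (n * d * (5 * ε)) * Real.exp (-(n * d) / (32 * (p:ℝ) ^ 4)))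
       ≤ Real.exp L ^ p * (Real.exp L ^ p * Real.exp (n * d * (5 * ε)) * Real.exp (-(n * d) / (32 * (p:ℝ) ^ 4))) := by gcongr
      _ = Real.exp (2 * (p * L) + 5 * d * (n * ε) + -(n * d) / (32 * (p:ℝ) ^ 4)) := by
        rw [← Real.exp_nat_mul, ← Real.exp_add, ← Real.exp_add, ← Real.exp_add]
        congr 1; ring
      _ ≤ 1 := by
        rw [Real.exp_le_one_iff]
        have a1 : 2 * (p * L) + 5 * d * (n * ε) ≤ 41 * (d * C1) * y^21 := by
          have b1 : 5 * d * (n * ε) ≤ 5 * d * (C1 * y^21) := by gcongr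
          have b2 := ymono (j := 11) (k := 21) (by norm_num)
          have b3 : 1 ≤ d * C1 := one_le_mul_of_one_le_of_one_le (by linarith) hC10
          have b4 : 1 * y^21 ≤ (d*C1) * y^21 := mul_le_mul_of_nonneg_right b3 (by positivity)
          clear * - b1 b2 b4 hpL
          linarith
        have a2 : 41 * (d * C1) * y^21 ≤ n * d / (32 * (p:ℝ)^4) := by
          rw [le_div_iff₀ (by positivity)]
          calc 41 * (d * C1) * y^21 * (32 * (p:ℝ)^4) ≤ 41 * (d * C1) * y^21 * (32 * (104976 * y^40)) := by gcongr
            _ = 137728512 * (d * C1) * y^61 := by ring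
            _ ≤ y * y^61 := by
              have : 0 ≤ d * C1 := by positivity
              gcongr; linarith
            _ = y^62 := by ring
            _ ≤ y^80 := ymono (by norm_num)
            _ = n * 1 := by rw [hn, mul_one]
            _ ≤ n * d := by gcongr; linarith
        rw [neg_div]
        linarith

/-- The numerical conditions on the second set of parameters. -/
theorem asym2 (d n p : ℕ) (hd : 3 ≤ d) (y L K δ Q C4 C5 : ℝ)
    (hy1 : 1 ≤ y) (hn : (n:ℝ) = y ^ 80) (hL1 : 1 ≤ L) (hLy : L ≤ y)
    (hpl : 8 * y ^ 10 ≤ p) (hpu : (p:ℝ) ≤ 18 * y ^ 10)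
    (hL : L = 1 + Real.log (n * d + 1))
    (hK : K = 8 * p^2 * L) (hδ : δ = 4 * Real.sqrt (d * (d * K / n))) (hQ : 0 < Q)
    (hC4 : C4 = 2592 * d^2) (hC5 : C5 = Q * (9 * C4))
    (hyC4 : 1000 * (d * C4) ≤ y) (hyC5 : 8 * C5 ≤ y) :
    ∃ s1 : ℕ, δ ≤ 1/32 ∧ 2 * δ * d < 1 ∧ 2 * δ * n ≤ s1 ∧ 4 * s1 ≤ n ∧ Q * Real.sqrt (s1 / n) ≤ 1/2 ∧
      2 * (Q * Real.sqrt (s1 / n)) + ((n * d : ℝ) + 1) ^ (p * p) * ((Real.exp 1 * (n * d + 1)) ^ (p * p) *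
      Real.exp (-(K / 2))) + 3 / (p - 1) ≤ 1 / y^10 := by
  have hy0 : 0 < y := by linarith
  have hd3 : (3:ℝ) ≤ d := by exact_mod_cast hd
  have hn0 : (0:ℝ) < n := by rw [hn]; positivity
  have hp0 : (0:ℝ) < p := lt_of_lt_of_le (by positivity) hpl
  have hC40 : 1 ≤ C4 := by rw [hC4]; clear * - hd3; nlinarith
  have y1 : ∀ k : ℕ, 1 ≤ y^k := fun k => one_le_pow₀ hy1
  have ymono : ∀ {j k : ℕ}, j ≤ k → y^j ≤ y^k := fun h => pow_le_pow_right₀ hy1 h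
  have hp2 : (p:ℝ)^2 ≤ 324 * y^20 := by
    have := pow_le_pow_left₀ hp0.le hpu 2
    refine this.trans (le_of_eq (by ring))
  have hK1 : K ≤ 2592 * y^21 := by
    rw [hK]
    calc 8 * (p:ℝ)^2 * L ≤ 8 * (324 * y^20) * y := by gcongr
      _ = _ := by ring
  have hδ0 : 0 ≤ δ := by rw [hδ]; positivity
  have hδu : δ ≤ 4 * (C4 / y^29) := by
    rw [hδ]
    refine mul_le_mul_of_nonneg_left ?_ (by norm_num)
    refine aux_sqrt _ y _ 29 hC40 hy1 ?_
    calc d * (d * K / n) * y^(2*29) ≤ d * (d * (2592 * y^21) / n) * y^(2*29) := by gcongr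
      _ = C4 * y^79 / y^80 := by rw [hn, hC4]; ring
      _ ≤ C4 * y^80 / y^80 := by
          have := ymono (j := 79) (k := 80) (by norm_num)
          gcongr
      _ = _ := by field_simp
  have hy29 := ymono (j := 1) (k := 29) (by norm_num)
  rw [pow_one] at hy29
  have hdδ : d * δ ≤ 1/250 := by
    calc d * δ ≤ d * (4 * (C4 / y^29)) := by gcongr
      _ ≤ d * (4 * (C4 / y)) := by gcongr
      _ = 4 * (d * C4) / y := by ring
      _ ≤ 1/250 := by rw [div_le_div_iff₀ hy0 (by norm_num)]; linarith
  have hδ3 : 3 * δ ≤ d * δ := mul_le_mul_of_nonneg_right hd3 hδ0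
  set s1 := ⌈2 * δ * n⌉₊ with hs1
  have hs1l : 2 * δ * n ≤ s1 := Nat.le_ceil _
  have hpos : 0 ≤ 2 * δ * n := by positivity
  have hs1u' : (s1:ℝ) ≤ 2 * δ * n + 1 := (Nat.ceil_lt_add_one hpos).le
  have hδn : δ * n ≤ 4 * C4 * y^51 := by
    calc δ * n ≤ 4 * (C4 / y^29) * n := by gcongr
      _ = 4 * C4 * y^51 := by rw [hn]; field_simp
  have hs1u : (s1:ℝ) ≤ 9 * C4 * y^51 := by
    have e1 : 1 * 1 ≤ C4 * y^51 := mul_le_mul hC40 (y1 51) (by norm_num) (by linarith)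
    clear * - e1 hs1u' hδn
    linarith
  have hsq : Real.sqrt (s1 / n) ≤ 9 * C4 / y^14 := by
    refine aux_sqrt _ y _ 14 (by linarith) hy1 ?_
    calc s1 / n * y^(2*14) ≤ (9 * C4 * y^51) / n * y^(2*14) := by gcongr
      _ = 9 * C4 * y^79 / y^80 := by rw [hn]; ring
      _ ≤ 9 * C4 * y^80 / y^80 := by
          have := ymono (j := 79) (k := 80) (by norm_num)
          gcongr
      _ = _ := by field_simp
  have hr : Q * Real.sqrt (s1 / n) ≤ 1 / 8 / y^10 := by
    calc Q * Real.sqrt (s1 / n) ≤ Q * (9 * C4 / y^14) := by gcongr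
      _ = C5 / y^14 := by rw [hC5]; ring
      _ ≤ (1/8 * y) / y^14 := by gcongr; linarith
      _ ≤ (1/8 * y^4) / y^14 := by
        have := ymono (j := 1) (k := 4) (by norm_num)
        rw [pow_one] at this
        gcongr
      _ = _ := by field_simp
  have hLD : ((n * d : ℝ) + 1) ^ (p * p) * ((Real.exp 1 * (n * d + 1)) ^ (p * p) * Real.exp (-(K / 2))) ≤ 1/4 / y^10 := by
    have hnd : Real.exp 1 * (n * d + 1) = Real.exp L := by
      rw [hL, Real.exp_add, Real.exp_log (by positivity)]
    have h1 : (n * d : ℝ) + 1 ≤ Real.exp L := by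
      rw [← hnd]
      exact le_mul_of_one_le_left (by positivity) (Real.one_le_exp (by norm_num))
    rw [hnd]
    have hp1 : (1:ℝ) ≤ p := by linarith [y1 10]
    calc ((n * d : ℝ) + 1) ^ (p * p) * (Real.exp L ^ (p * p) * Real.exp (-(K / 2)))
       ≤ Real.exp L ^ (p * p) * (Real.exp L ^ (p * p) * Real.exp (-(K / 2))) := by gcongr
      _ = Real.exp (-(2 * (p * (p * L)))) := by
        rw [← Real.exp_nat_mul, ← Real.exp_add, ← Real.exp_add, hK]
        congr 1; push_cast; ring
      _ ≤ Real.exp (-p) := by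
        refine Real.exp_le_exp.mpr ?_
        have a1 : (1:ℝ) ≤ p * L := one_le_mul_of_one_le_of_one_le hp1 hL1
        have a2 : (p:ℝ) ≤ p * (p * L) := le_mul_of_one_le_right hp0.le a1
        linarith
      _ = 1 / Real.exp p := by rw [Real.exp_neg, one_div]
      _ ≤ 1 / (4 * y^10) := by
        have := Real.add_one_le_exp (p:ℝ)
        have := y1 10
        exact one_div_le_one_div_of_le (by positivity) (by linarith)
      _ = _ := by field_simp
  have h3 : 3 / ((p:ℝ) - 1) ≤ 3/7 / y^10 := by
    have := y1 10
    rw [div_div]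
    exact div_le_div_of_nonneg_left (by norm_num) (by positivity) (by linarith)
  have hz : 1 / y^10 ≤ 1 := by rw [div_le_one (by positivity)]; exact y1 10
  have ez : ∀ c : ℝ, c / y^10 = c * (1 / y^10) := fun c => by ring
  have hz0 : 0 < 1 / y^10 := by positivity
  rw [ez] at hr hLD h3
  refine ⟨s1, by linarith, by linarith, hs1l, ?_, ?_, ?_⟩
  · have : (4 * s1 : ℝ) ≤ n := by
      have e1 : δ * n ≤ 1/32 * n := mul_le_mul_of_nonneg_right (by linarith) hn0.le
      have e2 : 8 ≤ (n:ℝ) := by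
        rw [hn]
        have := ymono (j := 1) (k := 80) (by norm_num)
        rw [pow_one] at this
        have e3 : 1 ≤ d * C4 := one_le_mul_of_one_le_of_one_le (by linarith) hC40
        linarith
      linarith
    exact_mod_cast this
  · linarith
  · linarith

open Filter in
theorem ev_large (d : ℕ) (C : ℝ) : ∃ N : ℕ, ∀ n : ℕ, N ≤ n → 
    C ≤ (n:ℝ)^(1/80:ℝ) ∧ 1 + Real.log (n * d + 1) ≤ (n:ℝ)^(1/80:ℝ) := by
  have t1 : Tendsto (fun n : ℕ => (n:ℝ)^(1/80:ℝ)) atTop atTop :=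
    (tendsto_rpow_atTop (by norm_num)).comp tendsto_natCast_atTop_atTop
  have t2 := ((isLittleO_log_rpow_atTop (r := 1/80) (by norm_num)).bound (c := 1/2) (by norm_num))
  have t3 := tendsto_natCast_atTop_atTop (R := ℝ) |>.eventually t2
  have h := (t1.eventually_ge_atTop (max C (2 * (1 + Real.log (d + 1))))).and (t3.and (eventually_ge_atTop 1))
  obtain ⟨N, hN⟩ := eventually_atTop.mp h
  refine ⟨N, fun n hn => ?_⟩
  obtain ⟨a1, a2, a3⟩ := hN n hn
  refine ⟨(le_max_left _ _).trans a1, ?_⟩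
  have a4 := (le_max_right _ _).trans a1
  have hn1 : (1:ℝ) ≤ n := by exact_mod_cast a3
  have b1 : Real.log (n * d + 1) ≤ Real.log n + Real.log (d + 1) := by
    rw [← Real.log_mul (by positivity) (by positivity)]
    exact Real.log_le_log (by positivity) (by linarith)
  rw [Real.norm_of_nonneg (Real.log_nonneg hn1), Real.norm_of_nonneg (by positivity)] at a2
  linarith

/-- For fixed `d ≥ 3` and `𝔡 = min {1/8, (d-2)/(5d-6)}`, eventually in `n` (with `nd` even),
the number of fixed-point-free involutions `σ` of `[n]×[d]` with `det A(σ) = 0` is at most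
`n^{-𝔡} (nd)!/(2^{nd/2}(nd/2)!)`. -/
theorem undirected_singular_real (d : ℕ) (hd : 3 ≤ d) :
    ∃ N : ℕ, ∀ n : ℕ, N ≤ n → Even (n * d) →
      ((Finset.univ.filter (fun σ : Equiv.Perm (Fin n × Fin d) =>
          (∀ x, σ (σ x) = x) ∧ (∀ x, σ x ≠ x) ∧ (adjMat n d σ).det = 0)).card : ℝ)
        ≤ (n : ℝ) ^ (-(min (1/8 : ℝ) (((d : ℝ) - 2) / (5 * (d : ℝ) - 6)))) *
            (((n * d).factorial : ℝ) / ((2 : ℝ) ^ (n * d / 2) * ((n * d / 2).factorial : ℝ))) := by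
  obtain ⟨C1, hC1⟩ : ∃ C1 : ℝ, C1 = 2592 * (2 + 32 * d^2) := ⟨_, rfl⟩
  obtain ⟨C2, hC2⟩ : ∃ C2 : ℝ, C2 = 18 * d * C1 + 109 := ⟨_, rfl⟩
  obtain ⟨C3, hC3⟩ : ∃ C3 : ℝ, C3 = 3 * 2^d * (1134 * C1^2 + 23328 * C2) := ⟨_, rfl⟩
  obtain ⟨C4, hC4⟩ : ∃ C4 : ℝ, C4 = 2592 * d^2 := ⟨_, rfl⟩
  obtain ⟨Q, hQ⟩ : ∃ Q : ℝ, Q = 2^d * CS d := ⟨_, rfl⟩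
  have hQ0 : 0 < Q := by rw [hQ]; unfold CS; positivity
  obtain ⟨C5, hC5⟩ : ∃ C5 : ℝ, C5 = Q * (9 * C4) := ⟨_, rfl⟩
  have p1 : 0 ≤ C1 := by rw [hC1]; positivity
  have p2 : 0 ≤ C2 := by rw [hC2]; positivity
  have p3 : 0 ≤ C3 := by rw [hC3]; positivity
  have p4 : 0 ≤ C4 := by rw [hC4]; positivity
  have p5 : 0 ≤ C5 := by rw [hC5]; positivity
  have p6 : 0 ≤ d * C1 := by positivity
  have p7 : 0 ≤ d * C2 := by positivity
  have p8 : 0 ≤ d * C4 := by positivity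
  have p9 : (0:ℝ) ≤ d := by positivity
  obtain ⟨N, hN⟩ := ev_large d (32400 * C1 + 45 * (d * C2) + C2 + 24 * C3 + 200000000 * (d * C1) + 1000000000 + 1000 * (d * C4) + 8 * C5 + (d + 1))
  refine ⟨N + 1, fun n hn hev => ?_⟩
  obtain ⟨hyC, hLy⟩ := hN n (by omega)
  have hnpos : 0 < n := by omega
  have hn1 : (1:ℝ) ≤ n := by exact_mod_cast hnpos
  set y := (n:ℝ)^(1/80:ℝ) with hy
  have hny : (n:ℝ) = y^80 := by
    rw [hy, ← Real.rpow_natCast, ← Real.rpow_mul (by positivity)]; norm_num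
  have hy10 : 1 / y^10 = (n:ℝ)^(-(1/8:ℝ)) := by
    rw [hy, ← Real.rpow_natCast, ← Real.rpow_mul (by positivity), Real.rpow_neg (by positivity), one_div]; norm_num
  obtain ⟨L, hL⟩ : ∃ L : ℝ, L = 1 + Real.log (n * d + 1) := ⟨_, rfl⟩
  rw [← hL] at hLy
  have hL1 : 1 ≤ L := by
    rw [hL]
    have : 0 ≤ Real.log (n * d + 1) := Real.log_nonneg (by have : (0:ℝ) ≤ n * d := by positivity
                                                           linarith)
    linarith
  have hy1 : 1 ≤ y := by linarith
  have hy10' : y ≤ y^10 := by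
    have := pow_le_pow_right₀ hy1 (show 1 ≤ 10 by norm_num)
    rwa [pow_one] at this
  have hm0 : ⌈8 * y^10⌉₊ ≠ 0 := by
    intro h
    have := Nat.le_ceil (8 * y^10)
    rw [h, Nat.cast_zero] at this
    linarith
  obtain ⟨p, hp, hpm, hpm2⟩ := Nat.exists_prime_lt_and_le_two_mul _ hm0
  have hpl : 8 * y^10 ≤ p := (Nat.le_ceil _).trans (by exact_mod_cast hpm.le)
  have hpu : (p:ℝ) ≤ 18 * y^10 := by
    have h1 : (p:ℝ) ≤ 2 * ⌈8 * y^10⌉₊ := by exact_mod_cast hpm2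
    have h2 := (Nat.ceil_lt_add_one (show 0 ≤ 8 * y^10 by positivity)).le
    linarith
  have : Fact p.Prime := ⟨hp⟩
  have hdp : d < p := by
    have : (d:ℝ) < p := by linarith
    exact_mod_cast this
  obtain ⟨s0, a1, a2, a3, a4, a5, a6, a7⟩ := asym1 d n p hd y L _ C1 C2 C3 hy1 hny hL1 hLy hpl hpu hL rfl hC1 hC2 hC3
    (by linarith) (by linarith) (by linarith) (by linarith) (by linarith) (by linarith)
  have hX := X_good (n := n) (d := d) (p := p) hd hnpos hev (by omega) hdp _ a2 s0 a1 a3 L hL a4 _ rfl a5 a6 a7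
  obtain ⟨s1, b1, b2, b3, b4, b5, b6⟩ := asym2 d n p hd y L _ _ Q C4 C5 hy1 hny hL1 hLy hpl hpu hL rfl rfl hQ0 hC4 hC5
    (by linarith) (by linarith)
  rw [hQ] at b5 b6
  have hS := sing_bound (n := n) (d := d) (p := p) hd hnpos hdp _ (by positivity) _ rfl b1 b2 s1 b3 b4 _ rfl b5 hX
  have hT := card_MM_le (H := Fin n × Fin d) (n * d) (by simp) (Nat.mul_pos hnpos (by omega)) hev
  have hset : (Finset.univ.filter (fun σ : Equiv.Perm (Fin n × Fin d) =>
          (∀ x, σ (σ x) = x) ∧ (∀ x, σ x ≠ x) ∧ (adjMat n d σ).det = 0)) =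
          (MM (Fin n × Fin d)).filter (fun σ => (adjMat n d σ).det = 0) := by
    ext σ
    simp only [MM, IsM, mem_filter, mem_univ, true_and, and_assoc]
  rw [hset]
  calc (((MM (Fin n × Fin d)).filter (fun σ => (adjMat n d σ).det = 0)).card : ℝ)
      ≤ _ := by convert hS
    _ ≤ (MM (Fin n × Fin d)).card * (1 / y^10) := mul_le_mul_of_nonneg_left b6 (Nat.cast_nonneg _)
    _ = (1 / y^10) * (MM (Fin n × Fin d)).card := mul_comm _ _
    _ ≤ _ := by
      rw [hy10]
      refine mul_le_mul ?_ hT (Nat.cast_nonneg _) (Real.rpow_nonneg (by linarith) _)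
      exact Real.rpow_le_rpow_of_exponent_le hn1 (neg_le_neg (min_le_left _ _))
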